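/- Generalised quantum Sanov theorem revisited (arbitrarily varying alternative). Let ℋ = ℂ^d be a finite-dimensional Hilbert space, let 𝒜 = (𝒜_n)_n be a sequence of topologically closed, convex sets 𝒜_n ⊆ 𝒟(ℋ^{⊗n}) satisfying Axioms Q.I–Q.IV, and let ℬ₁ ⊆ 𝒟(ℋ) be a non-empty topologically closed set of states. Then Stein(𝒜‖ℬ₁^{av}) = Stein(𝒜‖co(ℬ₁)^{av}) = Stein(𝒜‖co(ℬ₁)^{iid}) = min*_{μ∈𝒫(co(ℬ₁))} lim_{n→∞} (1/n) inf_{ρ_n∈𝒜_n} D(ρ_n ‖ ∫_{co(ℬ₁)} dμ(σ) σ^{⊗n}), where the minimum is restricted to those μ for which the inner limit in n exists (a non-empty set on which the minimum is attained). -/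

import Mathlib

open Filter MeasureTheory Topology
open scoped BigOperators Classical ComplexOrder

noncomputable section

namespace QSanov

/-- Matrices representing operators on the single-copy Hilbert space with orthonormal
basis indexed by `ι`. -/
abbrev MatC (ι : Type*) := Matrix ι ι ℂ

/-- Matrices representing operators on the `n`-fold tensor power Hilbert space. -/
abbrev MatN (ι : Type*) (n : ℕ) := Matrix (Fin n → ι) (Fin n → ι) ℂ

instance matMeasurableSpace (m n : Type*) : MeasurableSpace (Matrix m n ℂ) :=
  inferInstanceAs (MeasurableSpace (m → n → ℂ))

/-- A quantum state: a positive semidefinite matrix of trace one. -/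
def IsState {κ : Type*} [Fintype κ] (ρ : Matrix κ κ ℂ) : Prop :=
  ρ.PosSemidef ∧ ρ.trace = 1

/-- Loewner order: `A ≤ B` iff `B - A` is positive semidefinite. -/
def loewnerLE {κ : Type*} [Fintype κ] (A B : Matrix κ κ ℂ) : Prop :=
  (B - A).PosSemidef

/-- The `n`-fold tensor power `ρ^{⊗n}` of a single-copy matrix. -/
def tensorPow {ι : Type*} (ρ : MatC ι) (n : ℕ) : MatN ι n :=
  fun i j => ∏ k, ρ (i k) (j k)

/-- The tensor product `ρ₁ ⊗ ⋯ ⊗ ρ_n` of a family of single-copy matrices. -/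
def tensorProdFam {ι : Type*} {n : ℕ} (ρ : Fin n → MatC ι) : MatN ι n :=
  fun i j => ∏ k, ρ k (i k) (j k)

/-- The tensor product of an `n`-copy matrix and an `m`-copy matrix. -/
def tensorMul {ι : Type*} {n m : ℕ} (ρ : MatN ι n) (σ : MatN ι m) : MatN ι (n + m) :=
  fun i j => ρ (fun t => i (Fin.castAdd m t)) (fun t => j (Fin.castAdd m t)) *
    σ (fun t => i (Fin.natAdd n t)) (fun t => j (Fin.natAdd n t))

/-- Conjugation `U_π ρ U_π†` by the unitary permuting the `n` tensor factors. -/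
def permCopies {ι : Type*} {n : ℕ} (π : Equiv.Perm (Fin n)) (ρ : MatN ι n) : MatN ι n :=
  fun i j => ρ (i ∘ π) (j ∘ π)

/-- Matrix logarithm via functional calculus on the support (eigenvalue `0` is sent
to `0`, since `Real.log 0 = 0`). -/
def matLog {κ : Type*} [Fintype κ] [DecidableEq κ] (A : Matrix κ κ ℂ) : Matrix κ κ ℂ :=
  if hA : A.IsHermitian then
    (hA.eigenvectorUnitary : Matrix κ κ ℂ) *
      (Matrix.diagonal fun i => (Real.log (hA.eigenvalues i) : ℂ)) *
      (star (hA.eigenvectorUnitary : Matrix κ κ ℂ))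
  else 0

/-- Support inclusion `supp ρ ⊆ supp σ`, phrased as inclusion of ranges. -/
def suppLE {κ : Type*} [Fintype κ] [DecidableEq κ] (ρ σ : Matrix κ κ ℂ) : Prop :=
  LinearMap.range (Matrix.toLin' ρ) ≤ LinearMap.range (Matrix.toLin' σ)

/-- Umegaki relative entropy `D(ρ‖σ) = Tr[ρ (log ρ - log σ)]`, equal to `+∞` when
`supp ρ ⊄ supp σ`. -/
def relEnt {κ : Type*} [Fintype κ] [DecidableEq κ] (ρ σ : Matrix κ κ ℂ) : EReal :=
  if suppLE ρ σ then (((ρ * (matLog ρ - matLog σ)).trace.re : ℝ) : EReal) else ⊤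

/-- Relative entropy between two sets of states: `D(𝒜‖ℬ) = inf_{ρ∈𝒜, σ∈ℬ} D(ρ‖σ)`. -/
def relEntSet {κ : Type*} [Fintype κ] [DecidableEq κ] (A B : Set (Matrix κ κ ℂ)) : EReal :=
  ⨅ ρ ∈ A, ⨅ σ ∈ B, relEnt ρ σ

/-- The composite i.i.d. hypothesis `𝒻₁^{⊗n, iid}` built on the base set `F1`. -/
def iidSet {ι : Type*} (F1 : Set (MatC ι)) (n : ℕ) : Set (MatN ι n) :=
  {ρ | ∃ σ ∈ F1, ρ = tensorPow σ n}

/-- The arbitrarily varying hypothesis `𝒻₁^{⊗n, av}` built on the base set `F1`. -/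
def avSet {ι : Type*} (F1 : Set (MatC ι)) (n : ℕ) : Set (MatN ι n) :=
  {ρ | ∃ f : Fin n → MatC ι, (∀ p, f p ∈ F1) ∧ ρ = tensorProdFam f}

/-- Worst-case type II error probability `β_ε(A‖B)` for a threshold `ε` on the
worst-case type I error probability. -/
def typeII {κ : Type*} [Fintype κ] [DecidableEq κ] (A B : Set (Matrix κ κ ℂ)) (ε : ℝ) : ℝ :=
  sInf {b : ℝ | ∃ E : Matrix κ κ ℂ, E.PosSemidef ∧ (1 - E).PosSemidef ∧
    (∀ ρ ∈ A, (ρ * (1 - E)).trace.re ≤ ε) ∧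
    b = sSup {x : ℝ | ∃ σ ∈ B, x = (σ * E).trace.re}}

/-- `- log x`, with value `+∞` for `x ≤ 0`. -/
def negLog (x : ℝ) : EReal := if x ≤ 0 then ⊤ else ((-Real.log x : ℝ) : EReal)

/-- `(1/n : EReal)`. -/
def cFrac (n : ℕ) : EReal := (((n : ℝ)⁻¹ : ℝ) : EReal)

/-- The Stein exponent `Stein(𝒜‖ℬ) = lim_{ε→0⁺} liminf_n -(1/n) log β_ε(𝒜_n‖ℬ_n)`;
since the inner quantity is monotone nondecreasing in `ε`, the limit as `ε → 0⁺`
coincides with the infimum over `ε ∈ (0,1)`. -/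
def steinExponent {ι : Type*} [Fintype ι] [DecidableEq ι]
    (A B : ∀ n : ℕ, Set (MatN ι n)) : EReal :=
  ⨅ ε ∈ Set.Ioo (0 : ℝ) 1,
    Filter.liminf (fun n : ℕ => cFrac n * negLog (typeII (A n) (B n) ε)) Filter.atTop

/-- The mixture `∫ dμ(σ) σ^{⊗n}` of i.i.d. states along a measure `μ` on a set of
states `C` (Bochner integral, computed entrywise). -/
def iidMix {ι : Type*} {C : Set (MatC ι)} (μ : Measure ↥C) (n : ℕ) : MatN ι n :=
  fun i j => ∫ σ, (∏ k, (σ : MatC ι) (i k) (j k)) ∂μ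

/-- The `b`-th block of size `k` of an index of `ℋ^{⊗ mk}`. -/
def blockOf {ι : Type*} {m k : ℕ} (i : Fin (m * k) → ι) (b : Fin m) : Fin k → ι :=
  fun t => i (finProdFinEquiv (b, t))

/-- Replace the blocks in `S` of the index `i` by the values prescribed by `c`. -/
def mergeBlocks {ι : Type*} {m k : ℕ} (S : Finset (Fin m)) (c : Fin m → Fin k → ι)
    (i : Fin (m * k) → ι) : Fin (m * k) → ι :=
  fun p => if (finProdFinEquiv.symm p).1 ∈ S
    then c (finProdFinEquiv.symm p).1 (finProdFinEquiv.symm p).2 else i p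

/-- Entry `(i,j)` of the partial trace of `ρ` over the blocks in `S`
(the remaining blocks being evaluated at `i`, `j`). -/
def blockPartialTrace {ι : Type*} [Fintype ι] {m k : ℕ} (S : Finset (Fin m))
    (ρ : MatN ι (m * k)) (i j : Fin (m * k) → ι) : ℂ :=
  (((Fintype.card ι : ℂ) ^ (k * (m - S.card)))⁻¹) *
    ∑ c : Fin m → Fin k → ι, ρ (mergeBlocks S c i) (mergeBlocks S c j)

/-- The `m`-fold tensor power `(𝒩^δ_ω)^{⊗ m}` of the depolarising channel
`𝒩^δ_ω(X) = (1-δ) X + δ Tr[X] ω`, acting blockwise on blocks of `k` tensor factors. -/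
def blockDepolarize {ι : Type*} [Fintype ι] (δ : ℝ) {k : ℕ} (ω : MatN ι k) (m : ℕ)
    (ρ : MatN ι (m * k)) : MatN ι (m * k) :=
  fun i j => ∑ S : Finset (Fin m),
    (((1 - δ) ^ (m - S.card) * δ ^ S.card : ℝ) : ℂ) *
      ((∏ b ∈ S, ω (blockOf i b) (blockOf j b)) * blockPartialTrace S ρ i j)

/-- The `m`-fold tensor power of a `k`-copy matrix, as an `mk`-copy matrix. -/
def powBlocks {ι : Type*} {k : ℕ} (ρ : MatN ι k) (m : ℕ) : MatN ι (m * k) :=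
  fun i j => ∏ b : Fin m, ρ (blockOf i b) (blockOf j b)

/-- `Tr_{n+1,…,n+k}[ρ (𝟙^{⊗n} ⊗ F)]`, the filtered reduction of an `(n+k)`-copy matrix. -/
def condReduce {ι : Type*} [Fintype ι] {n k : ℕ} (ρ : MatN ι (n + k)) (F : MatN ι k) :
    MatN ι n :=
  fun i j => ∑ a : Fin k → ι, ∑ b : Fin k → ι,
    ρ (Fin.append i a) (Fin.append j b) * F b a

/-- Partial trace over the `k`-th tensor factor. -/
def traceOutAt {ι : Type*} [Fintype ι] {n : ℕ} (k : Fin (n + 1)) (σ : MatN ι (n + 1)) :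
    MatN ι n :=
  fun i j => ∑ a : ι, σ (k.insertNth a i) (k.insertNth a j)

/-- Insert the single-copy state `τ` at position `k` into an `n`-copy matrix. -/
def insertState {ι : Type*} {n : ℕ} (k : Fin (n + 1)) (τ : MatC ι) (σ : MatN ι n) :
    MatN ι (n + 1) :=
  fun i j => τ (i k) (j k) *
    σ (fun t => i (k.succAbove t)) (fun t => j (k.succAbove t))

/-- Product of a state on `A^n` and a state on `B^n`, viewed as a state on
`(ℋ_A ⊗ ℋ_B)^{⊗ n}` (reordering tensor factors implicitly). -/
def prodStateAB {ιA ιB : Type*} {n : ℕ} (α : Matrix (Fin n → ιA) (Fin n → ιA) ℂ)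
    (β : Matrix (Fin n → ιB) (Fin n → ιB) ℂ) : MatN (ιA × ιB) n :=
  fun i j => α (fun k => (i k).1) (fun k => (j k).1) * β (fun k => (i k).2) (fun k => (j k).2)


/-- The set `𝒮_{A^n:B^n}` of separable states across the cut `A^n : B^n`. -/
def sepSet (ιA ιB : Type*) [Fintype ιA] [Fintype ιB] (n : ℕ) : Set (MatN (ιA × ιB) n) :=
  convexHull ℝ {ρ | ∃ α β, IsState α ∧ IsState β ∧ ρ = prodStateAB α β}

/-- Classical relative entropy of two finitely supported output distributions. -/
def clRelEnt {m : ℕ} (P Q : Fin m → ℝ) : EReal :=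
  ∑ x, (if P x = 0 then (0 : EReal) else if Q x = 0 then (⊤ : EReal)
    else ((P x * Real.log (P x / Q x) : ℝ) : EReal))

/-- Measured relative entropy: supremum over all finite POVMs of the classical
relative entropy of the induced outcome distributions. -/
def measuredRelEnt {κ : Type*} [Fintype κ] [DecidableEq κ] (ρ σ : Matrix κ κ ℂ) : EReal :=
  ⨆ (m : ℕ) (E : Fin m → Matrix κ κ ℂ) (_ : ∀ x, (E x).PosSemidef) (_ : ∑ x, E x = 1),
    clRelEnt (fun x => (ρ * E x).trace.re) (fun x => (σ * E x).trace.re)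


/-- Axiom Q.I: there is a full-support free state `τ ∈ 𝒜₁` such that every `𝒜_{mk}`
is stable under blockwise depolarising towards `τ^{⊗k}`. -/
def AxiomQI {ι : Type*} [Fintype ι] [DecidableEq ι] (A : ∀ n : ℕ, Set (MatN ι n)) : Prop :=
  ∃ τ : MatC ι, tensorPow τ 1 ∈ A 1 ∧
    ∀ m k : ℕ, 1 ≤ m → 1 ≤ k → ∀ ρ ∈ A (m * k),
      suppLE ρ (tensorPow τ (m * k)) ∧
      ∀ δ ∈ Set.Icc (0 : ℝ) 1, blockDepolarize δ (tensorPow τ k) m ρ ∈ A (m * k)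

/-- Axiom Q.II: closedness under tensor powers. -/
def AxiomQII {ι : Type*} (A : ∀ n : ℕ, Set (MatN ι n)) : Prop :=
  ∀ m k : ℕ, 1 ≤ m → 1 ≤ k → ∀ ρ ∈ A k, powBlocks ρ m ∈ A (m * k)

/-- Axiom Q.III: closedness under permutations of the tensor factors. -/
def AxiomQIII {ι : Type*} (A : ∀ n : ℕ, Set (MatN ι n)) : Prop :=
  ∀ n : ℕ, ∀ ρ ∈ A n, ∀ π : Equiv.Perm (Fin n), permCopies π ρ ∈ A n

/-- Axiom Q.IV: filtering by Hermitian operators in a neighbourhood of the identity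
is completely `cone(𝒜)`-preserving. -/
def AxiomQIV {ι : Type*} [Fintype ι] [DecidableEq ι] (A : ∀ n : ℕ, Set (MatN ι n)) : Prop :=
  ∀ k : ℕ, 1 ≤ k →
    ∃ V : Set (MatN ι k), V ∈ nhds (1 : MatN ι k) ∧
      ∀ F ∈ V, F.IsHermitian → ∀ n : ℕ, 1 ≤ n → ∀ ρ ∈ A (n + k),
        ∃ (lam : ℝ) (ω : MatN ι n), 0 ≤ lam ∧ ω ∈ A n ∧ condReduce ρ F = (lam : ℂ) • ω


section Spectral

variable {κ : Type*} [Fintype κ] [DecidableEq κ]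

open scoped MatrixOrder in
theorem PosSemidef.exists_conjTranspose_mul_self {A : Matrix κ κ ℂ}
    (hA : A.PosSemidef) : ∃ C : Matrix κ κ ℂ, A = C.conjTranspose * C :=
  CStarAlgebra.nonneg_iff_eq_star_mul_self.mp hA.nonneg

theorem PosSemidef.trace_mul_re_nonneg {A B : Matrix κ κ ℂ} (hA : A.PosSemidef)
    (hB : B.PosSemidef) : 0 ≤ (A * B).trace.re := by
  obtain ⟨C, rfl⟩ := PosSemidef.exists_conjTranspose_mul_self hB
  rw [← Matrix.mul_assoc, Matrix.trace_mul_comm, ← Matrix.mul_assoc]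
  exact (Complex.le_def.1 (hA.mul_mul_conjTranspose_same C).trace_nonneg).1

theorem trace_mul_re_mono_right {A B C : Matrix κ κ ℂ} (hA : A.PosSemidef)
    (h : (C - B).PosSemidef) : (A * B).trace.re ≤ (A * C).trace.re := by
  have := PosSemidef.trace_mul_re_nonneg hA h
  rw [Matrix.mul_sub, Matrix.trace_sub, Complex.sub_re] at this
  linarith

theorem trace_mul_re_mono_left {A B C : Matrix κ κ ℂ} (hA : A.PosSemidef)
    (h : (C - B).PosSemidef) : (B * A).trace.re ≤ (C * A).trace.re := by
  rw [Matrix.trace_mul_comm B, Matrix.trace_mul_comm C]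
  exact trace_mul_re_mono_right hA h

/-- The Hermitian matrix with eigenvalues `f` on the orthonormal basis given by the columns
of `U`. -/
def spec (U : Matrix κ κ ℂ) (f : κ → ℝ) : Matrix κ κ ℂ :=
  U * Matrix.diagonal (fun i => (f i : ℂ)) * U.conjTranspose

/-- Unitarity of a square matrix. -/
def IsUni (U : Matrix κ κ ℂ) : Prop := U.conjTranspose * U = 1 ∧ U * U.conjTranspose = 1

theorem spec_add (U : Matrix κ κ ℂ) (f g : κ → ℝ) :
    spec U (fun i => f i + g i) = spec U f + spec U g := by
  simp only [spec, ← Matrix.add_mul, ← Matrix.mul_add, Matrix.diagonal_add]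
  congr 3
  ext i; push_cast; rfl

theorem spec_smul (U : Matrix κ κ ℂ) (c : ℝ) (f : κ → ℝ) :
    spec U (fun i => c * f i) = (c : ℂ) • spec U f := by
  rw [spec, spec, ← Matrix.smul_mul, ← Matrix.mul_smul, ← Matrix.diagonal_smul]
  congr 3
  ext i; push_cast; rfl

theorem spec_neg (U : Matrix κ κ ℂ) (f : κ → ℝ) : spec U (fun i => - f i) = - spec U f := by
  simpa using spec_smul U (-1) f

theorem spec_sub (U : Matrix κ κ ℂ) (f g : κ → ℝ) :
    spec U (fun i => f i - g i) = spec U f - spec U g := by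
  simp only [sub_eq_add_neg, ← spec_neg, ← spec_add]

theorem spec_mul {U : Matrix κ κ ℂ} (hU : IsUni U) (f g : κ → ℝ) :
    spec U f * spec U g = spec U (fun i => f i * g i) := by
  simp only [spec]
  calc _ = U * Matrix.diagonal (fun i => (f i : ℂ)) * (U.conjTranspose * U) *
        Matrix.diagonal (fun i => (g i : ℂ)) * U.conjTranspose := by
        simp only [Matrix.mul_assoc]
    _ = _ := by
        rw [hU.1, Matrix.mul_one, Matrix.mul_assoc U, Matrix.diagonal_mul_diagonal]
        push_cast; rfl

theorem spec_one {U : Matrix κ κ ℂ} (hU : IsUni U) : spec U (fun _ => 1) = 1 := by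
  simp [spec, hU.2]

theorem spec_const {U : Matrix κ κ ℂ} (hU : IsUni U) (c : ℝ) :
    spec U (fun _ => c) = (c : ℂ) • (1 : Matrix κ κ ℂ) := by
  have := spec_smul U c (fun _ => 1)
  rw [spec_one hU] at this
  simpa using this

theorem spec_sum {α : Type*} (s : Finset α) (U : Matrix κ κ ℂ) (f : α → κ → ℝ) :
    spec U (fun i => ∑ a ∈ s, f a i) = ∑ a ∈ s, spec U (f a) := by
  induction s using Finset.induction_on with
  | empty => simp [spec]
  | insert a s ha ih => simp only [Finset.sum_insert ha, ← ih, ← spec_add]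

theorem spec_posSemidef (U : Matrix κ κ ℂ) {f : κ → ℝ} (hf : ∀ i, 0 ≤ f i) :
    (spec U f).PosSemidef := by
  apply Matrix.PosSemidef.mul_mul_conjTranspose_same
  rw [Matrix.posSemidef_diagonal_iff]
  intro i; exact_mod_cast hf i

theorem spec_isHermitian (U : Matrix κ κ ℂ) (f : κ → ℝ) : (spec U f).IsHermitian := by
  simp only [Matrix.IsHermitian, spec, Matrix.conjTranspose_mul, Matrix.conjTranspose_conjTranspose,
    Matrix.diagonal_conjTranspose, Matrix.mul_assoc]
  congr 3
  ext i; simp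

theorem spec_mono (U : Matrix κ κ ℂ) {f g : κ → ℝ} (hfg : ∀ i, f i ≤ g i) :
    (spec U g - spec U f).PosSemidef := by
  rw [← spec_sub]
  exact spec_posSemidef U fun i => sub_nonneg.2 (hfg i)

theorem trace_spec {U : Matrix κ κ ℂ} (hU : IsUni U) (f : κ → ℝ) :
    (spec U f).trace = ((∑ i, f i : ℝ) : ℂ) := by
  rw [spec, Matrix.trace_mul_comm, ← Matrix.mul_assoc, hU.1, Matrix.one_mul, Matrix.trace_diagonal]
  push_cast; rfl

theorem exp_spec {U : Matrix κ κ ℂ} (hU : IsUni U) (f : κ → ℝ) :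
    NormedSpace.exp (spec U f) = spec U (fun i => Real.exp (f i)) := by
  have hinv : U.conjTranspose = U⁻¹ := (Matrix.inv_eq_left_inv hU.1).symm
  have hunit : IsUnit U := ⟨⟨U, U.conjTranspose, hU.2, hU.1⟩, rfl⟩
  simp only [spec, hinv]
  rw [Matrix.exp_conj U _ hunit, Matrix.exp_diagonal]
  congr 3
  ext i
  rw [Pi.coe_exp]
  simp [← Complex.exp_eq_exp_ℂ]

theorem IsHermitian.exists_spec {A : Matrix κ κ ℂ} (hA : A.IsHermitian) :
    ∃ U : Matrix κ κ ℂ, ∃ p : κ → ℝ, IsUni U ∧ A = spec U p ∧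
      matLog A = spec U (fun i => Real.log (p i)) ∧ (A.PosSemidef → ∀ i, 0 ≤ p i) ∧
      (A.PosDef → ∀ i, 0 < p i) := by
  refine ⟨hA.eigenvectorUnitary, hA.eigenvalues, ⟨?_, ?_⟩, ?_, ?_, ?_, ?_⟩
  · exact Unitary.coe_star_mul_self hA.eigenvectorUnitary
  · exact Unitary.coe_mul_star_self hA.eigenvectorUnitary
  · have := hA.spectral_theorem
    rw [Unitary.conjStarAlgAut_apply] at this
    exact this
  · rw [matLog, dif_pos hA]; rfl
  · intro h i; exact h.eigenvalues_nonneg i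
  · intro h i; exact h.eigenvalues_pos i

/-- The overlap weights between two orthonormal bases. -/
def overlap (U V : Matrix κ κ ℂ) (i j : κ) : ℝ := Complex.normSq ((U.conjTranspose * V) i j)

theorem overlap_nonneg (U V : Matrix κ κ ℂ) (i j : κ) : 0 ≤ overlap U V i j :=
  Complex.normSq_nonneg _

theorem trace_spec_mul_spec (U V : Matrix κ κ ℂ) (f g : κ → ℝ) :
    (spec U f * spec V g).trace.re = ∑ i, ∑ j, f i * g j * overlap U V i j := by
  have h1 : (spec U f * spec V g).trace =
      (Matrix.diagonal (fun i => (f i : ℂ)) * (U.conjTranspose * V) *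
        (Matrix.diagonal (fun i => (g i : ℂ)) * (U.conjTranspose * V).conjTranspose)).trace := by
    rw [spec, spec, Matrix.mul_assoc, Matrix.mul_assoc, Matrix.trace_mul_comm]
    simp only [Matrix.mul_assoc, Matrix.conjTranspose_mul, Matrix.conjTranspose_conjTranspose]
  rw [h1, Matrix.trace]
  simp only [Matrix.diag_apply, Matrix.mul_apply (M := Matrix.diagonal _ * _),
    Matrix.diagonal_mul, Matrix.conjTranspose_apply (_ * _), Complex.re_sum]
  refine Finset.sum_congr rfl fun i _ => Finset.sum_congr rfl fun j _ => ?_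
  rw [overlap]
  set z := (U.conjTranspose * V) i j
  have : (f i : ℂ) * z * ((g j : ℂ) * star z) = ((f i * g j * Complex.normSq z : ℝ) : ℂ) := by
    push_cast
    rw [Complex.normSq_eq_conj_mul_self]
    simp only [RCLike.star_def]
    ring
  rw [this, Complex.ofReal_re]

theorem overlap_sum_right {U V : Matrix κ κ ℂ} (hU : IsUni U) (hV : IsUni V) (i : κ) :
    ∑ j, overlap U V i j = 1 := by
  have := trace_spec_mul_spec U V (fun a => if a = i then 1 else 0) (fun _ => 1)
  rw [spec_one hV, Matrix.mul_one, trace_spec hU, Complex.ofReal_re] at this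
  simpa [Finset.sum_ite_eq, ite_mul] using this.symm

theorem overlap_sum_left {U V : Matrix κ κ ℂ} (hU : IsUni U) (hV : IsUni V) (j : κ) :
    ∑ i, overlap U V i j = 1 := by
  have := trace_spec_mul_spec U V (fun _ => 1) (fun a => if a = j then 1 else 0)
  rw [spec_one hU, Matrix.one_mul, trace_spec hV, Complex.ofReal_re] at this
  simpa [Finset.sum_ite_eq, mul_ite] using this.symm

end Spectral

section Entropy

variable {κ : Type*} [Fintype κ] [DecidableEq κ]

theorem trace_spec_mul_log_le {U V : Matrix κ κ ℂ} (hU : IsUni U) (hV : IsUni V) {p q : κ → ℝ}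
    (hp : ∀ i, 0 ≤ p i) (hq : ∀ j, 0 < q j) :
    (spec U p * spec V (fun j => Real.log (q j))).trace.re
      ≤ (∑ i, p i * Real.log (p i)) + (∑ j, q j - ∑ i, p i) := by
  have e1 : (∑ i, p i * Real.log (p i)) + (∑ j, q j - ∑ i, p i) =
      ∑ i, ∑ j, (p i * Real.log (p i) + (q j - p i)) * overlap U V i j := by
    have h1 : ∀ f : κ → ℝ, ∑ i, ∑ j, f i * overlap U V i j = ∑ i, f i := fun f => by
      simp_rw [← Finset.mul_sum, overlap_sum_right hU hV, mul_one]
    have h2 : ∑ i, ∑ j, q j * overlap U V i j = ∑ j, q j := by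
      rw [Finset.sum_comm]
      simp_rw [← Finset.mul_sum, overlap_sum_left hU hV, mul_one]
    simp_rw [add_mul, sub_mul, Finset.sum_add_distrib, Finset.sum_sub_distrib, h1, h2]
  rw [trace_spec_mul_spec, e1]
  refine Finset.sum_le_sum fun i _ => Finset.sum_le_sum fun j _ => ?_
  refine mul_le_mul_of_nonneg_right ?_ (overlap_nonneg _ _ _ _)
  rcases (hp i).eq_or_lt with h | h
  · rw [← h]; simpa using (hq j).le
  · have := Real.log_le_sub_one_of_pos (div_pos (hq j) h)
    rw [Real.log_div (hq j).ne' h.ne'] at this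
    have h3 := mul_le_mul_of_nonneg_left this h.le
    have h4 : p i * (q j / p i - 1) = q j - p i := by field_simp
    linarith

theorem sum_mul_log_sub_le {U V : Matrix κ κ ℂ} (hU : IsUni U) (hV : IsUni V) {p q : κ → ℝ}
    (hp : ∀ i, 0 ≤ p i) (hq : ∀ j, 0 < q j) {c : ℝ} (hc : 0 < c) :
    (∑ i, p i * Real.log (p i)) - (spec U p * spec V (fun j => Real.log (q j))).trace.re
      ≤ (Real.log c - 1) * ∑ i, p i +
        (spec U p * spec U p * spec V (fun j => (q j)⁻¹)).trace.re / c := by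
  have h1 : ∀ f : κ → ℝ, ∑ i, ∑ j, f i * overlap U V i j = ∑ i, f i := fun f => by
    simp_rw [← Finset.mul_sum, overlap_sum_right hU hV, mul_one]
  rw [spec_mul hU, trace_spec_mul_spec, trace_spec_mul_spec, ← h1, ← h1 p, Finset.mul_sum,
    Finset.sum_div, ← Finset.sum_sub_distrib, ← Finset.sum_add_distrib]
  refine Finset.sum_le_sum fun i _ => ?_
  rw [Finset.mul_sum, Finset.sum_div, ← Finset.sum_sub_distrib, ← Finset.sum_add_distrib]
  refine Finset.sum_le_sum fun j _ => ?_
  have e : (Real.log c - 1) * (p i * overlap U V i j) +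
      p i * p i * (q j)⁻¹ * overlap U V i j / c =
      ((Real.log c - 1) * p i + p i * p i * (q j)⁻¹ / c) * overlap U V i j := by ring
  rw [e, ← sub_mul]
  refine mul_le_mul_of_nonneg_right ?_ (overlap_nonneg _ _ _ _)
  rcases (hp i).eq_or_lt with h | h
  · rw [← h]; simp
  · have hq' := hq j
    have := Real.log_le_sub_one_of_pos (div_pos h (mul_pos hc hq'))
    rw [Real.log_div h.ne' (mul_pos hc hq').ne', Real.log_mul hc.ne' hq'.ne'] at this
    have h3 := mul_le_mul_of_nonneg_left this h.le
    have h4 : p i * (p i / (c * q j) - 1) = p i * p i * (q j)⁻¹ / c - p i := by field_simp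
    linarith

theorem spec_single_mul_mul_spec_single {U : Matrix κ κ ℂ} (hU : IsUni U) (K : Matrix κ κ ℂ)
    (i : κ) : spec U (Pi.single i 1) * K * spec U (Pi.single i 1) =
      (spec U (Pi.single i 1) * K).trace • spec U (Pi.single i 1) := by
  have h0 : ∀ N : Matrix κ κ ℂ, Matrix.diagonal (fun a => ((Pi.single i 1 : κ → ℝ) a : ℂ)) * N *
      Matrix.diagonal (fun a => ((Pi.single i 1 : κ → ℝ) a : ℂ)) =
      N i i • Matrix.diagonal (fun a => ((Pi.single i 1 : κ → ℝ) a : ℂ)) := fun N => by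
    ext a b
    rw [Matrix.mul_diagonal, Matrix.diagonal_mul, Matrix.smul_apply, Matrix.diagonal_apply]
    by_cases ha : a = i <;> by_cases hb : b = i
    · subst ha; subst hb; simp
    · subst ha; simp [hb, Ne.symm hb]
    · subst hb; simp [ha]
    · simp [ha, hb]
  have h1 : spec U (Pi.single i 1) * K * spec U (Pi.single i 1) =
      (U.conjTranspose * K * U) i i • spec U (Pi.single i 1) := by
    have := congrArg (fun X => U * X * U.conjTranspose) (h0 (U.conjTranspose * K * U))
    simp only [Matrix.mul_smul, Matrix.smul_mul] at this
    rw [spec, ← this]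
    simp only [Matrix.mul_assoc]
  have h2 : (spec U (Pi.single i 1) * K).trace = (U.conjTranspose * K * U) i i := by
    have h3 := congrArg Matrix.trace h1
    have hidem : spec U (Pi.single i 1) * spec U (Pi.single i 1) = spec U (Pi.single i 1) := by
      rw [spec_mul hU]; congr 1; ext a; by_cases ha : a = i <;> simp [ha]
    rw [Matrix.mul_assoc, Matrix.trace_mul_comm, Matrix.mul_assoc, hidem, Matrix.trace_mul_comm,
      Matrix.trace_smul, trace_spec hU] at h3
    simpa using h3
  rw [h1, h2]

theorem spec_eq_sum_single (U : Matrix κ κ ℂ) (p : κ → ℝ) :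
    spec U p = ∑ i, (p i : ℂ) • spec U (Pi.single i 1) := by
  simp_rw [← spec_smul, ← spec_sum]
  congr 1
  ext i
  simp [Pi.single_apply]

theorem trace_spec_single_mul_re_le {U V : Matrix κ κ ℂ} (hU : IsUni U) (hV : IsUni V)
    {p q : κ → ℝ} (hp : ∀ i, 0 ≤ p i) (hq : ∀ j, 0 < q j) {c : ℝ} (hc : 0 ≤ c)
    (h : ((c : ℂ) • spec V q - spec U p).PosSemidef) (i : κ) :
    p i * (spec U (Pi.single i 1) * spec V (fun j => (q j)⁻¹)).trace.re ≤ c := by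
  set K := spec V (fun j => (q j)⁻¹) with hK
  set P := spec U (Pi.single i 1) with hP
  have hPp : P.PosSemidef := spec_posSemidef U fun a => by
    by_cases ha : a = i <;> simp [ha]
  have hKp : K.PosSemidef := spec_posSemidef V fun j => (inv_pos.2 (hq j)).le
  have hKh : K.conjTranspose = K := hKp.1
  have hM : (K * P * K).PosSemidef := by
    have := hPp.mul_mul_conjTranspose_same K
    rwa [hKh] at this
  set x := (P * K).trace.re with hx
  have hxC : (P * K).trace = (x : ℂ) := by
    rw [hP, hK, hx]
    apply Complex.ext
    · simp [hP, hK]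
    · have h5 : star (P * K).trace = (P * K).trace := by
        rw [← Matrix.trace_conjTranspose, Matrix.conjTranspose_mul, hKh, hPp.1, Matrix.trace_mul_comm]
      have := Complex.conj_eq_iff_im.1 h5
      simpa using this
  have h1 : ((spec U p - (p i : ℂ) • P)).PosSemidef := by
    rw [hP, ← spec_smul]
    apply spec_mono
    intro a
    by_cases ha : a = i
    · subst ha; simp
    · simpa [Pi.single_apply, ha] using hp a
  have h2 := trace_mul_re_mono_left hM h1
  have h3 := trace_mul_re_mono_left hM h
  have h4 : ((c : ℂ) • spec V q * (K * P * K)).trace.re = c * x := by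
    have : spec V q * K = 1 := by
      rw [hK, spec_mul hV, ← spec_one hV]; congr 1; ext j; exact mul_inv_cancel₀ (hq j).ne'
    rw [Matrix.smul_mul, Matrix.trace_smul, ← Matrix.mul_assoc, ← Matrix.mul_assoc, this,
      Matrix.one_mul, hxC]
    simp
  have h5 : ((p i : ℂ) • P * (K * P * K)).trace.re = p i * (x * x) := by
    rw [Matrix.smul_mul, Matrix.trace_smul, ← Matrix.mul_assoc, ← Matrix.mul_assoc,
      spec_single_mul_mul_spec_single hU, Matrix.smul_mul, Matrix.trace_smul, hxC]
    simp
  have hx0 : 0 ≤ x := PosSemidef.trace_mul_re_nonneg hPp hKp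
  rcases hx0.eq_or_lt with h0 | h0
  · rw [← h0]; simpa using hc
  · have : p i * (x * x) ≤ c * x := by linarith
    nlinarith

/-- If `ρ ≤ c κ` then the relative entropy of `ρ` to `κ` is at most `log c`. -/
theorem sum_mul_log_sub_le_log {U V : Matrix κ κ ℂ} (hU : IsUni U) (hV : IsUni V)
    {p q : κ → ℝ} (hp : ∀ i, 0 ≤ p i) (hp1 : ∑ i, p i = 1) (hq : ∀ j, 0 < q j) {c : ℝ} (hc : 0 < c)
    (h : ((c : ℂ) • spec V q - spec U p).PosSemidef) :
    (∑ i, p i * Real.log (p i)) - (spec U p * spec V (fun j => Real.log (q j))).trace.re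
      ≤ Real.log c := by
  have h1 := sum_mul_log_sub_le hU hV hp hq hc
  have h2 : (spec U p * spec U p * spec V (fun j => (q j)⁻¹)).trace.re ≤ c := by
    have e : (spec U p * spec U p * spec V (fun j => (q j)⁻¹)).trace.re =
        ∑ i, p i * (p i * (spec U (Pi.single i 1) * spec V (fun j => (q j)⁻¹)).trace.re) := by
      rw [spec_mul hU, spec_eq_sum_single, Finset.sum_mul, Matrix.trace_sum, Complex.re_sum]
      refine Finset.sum_congr rfl fun i _ => ?_
      rw [Matrix.smul_mul, Matrix.trace_smul, smul_eq_mul, Complex.re_ofReal_mul]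
      ring
    rw [e]
    calc _ ≤ ∑ i, p i * c := Finset.sum_le_sum fun i _ => mul_le_mul_of_nonneg_left
            (trace_spec_single_mul_re_le hU hV hp hq hc.le h i) (hp i)
      _ = c := by rw [← Finset.sum_mul, hp1, one_mul]
  rw [hp1] at h1
  have h3 : (spec U p * spec U p * spec V (fun j => (q j)⁻¹)).trace.re / c ≤ 1 :=
    (div_le_one hc).2 h2
  linarith

/-- The negative entropy `Tr ρ log ρ`. -/
def negEnt (ρ : Matrix κ κ ℂ) : ℝ := (ρ * matLog ρ).trace.re

theorem negEnt_eq_sum {ρ U : Matrix κ κ ℂ} {p : κ → ℝ} (hU : IsUni U) (h : ρ = spec U p)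
    (hl : matLog ρ = spec U (fun i => Real.log (p i))) :
    negEnt ρ = ∑ i, p i * Real.log (p i) := by
  rw [negEnt, hl, h, spec_mul hU, trace_spec hU, Complex.ofReal_re]

theorem IsState.exists_spec {ρ : Matrix κ κ ℂ} (hρ : IsState ρ) :
    ∃ U : Matrix κ κ ℂ, ∃ p : κ → ℝ, IsUni U ∧ ρ = spec U p ∧ (∀ i, 0 ≤ p i) ∧ ∑ i, p i = 1 ∧
      matLog ρ = spec U (fun i => Real.log (p i)) ∧ negEnt ρ = ∑ i, p i * Real.log (p i) := by
  obtain ⟨U, p, hU, h1, h2, h3, -⟩ := IsHermitian.exists_spec hρ.1.1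
  refine ⟨U, p, hU, h1, h3 hρ.1, ?_, h2, negEnt_eq_sum hU h1 h2⟩
  have := hρ.2
  rw [h1, trace_spec hU] at this
  exact_mod_cast this

theorem IsState.trace_mul_log_le {ρ V : Matrix κ κ ℂ} (hρ : IsState ρ) (hV : IsUni V)
    {q : κ → ℝ} (hq : ∀ j, 0 < q j) :
    (ρ * spec V (fun j => Real.log (q j))).trace.re ≤ negEnt ρ + (∑ j, q j - 1) := by
  obtain ⟨U, p, hU, h1, hp, hp1, -, h2⟩ := hρ.exists_spec
  rw [h2, ← hp1, h1]
  exact trace_spec_mul_log_le hU hV hp hq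

theorem IsState.negEnt_sub_le_log {ρ V : Matrix κ κ ℂ} (hρ : IsState ρ) (hV : IsUni V)
    {q : κ → ℝ} (hq : ∀ j, 0 < q j) {c : ℝ} (hc : 0 < c)
    (h : ((c : ℂ) • spec V q - ρ).PosSemidef) :
    negEnt ρ - (ρ * spec V (fun j => Real.log (q j))).trace.re ≤ Real.log c := by
  obtain ⟨U, p, hU, h1, hp, hp1, -, h2⟩ := hρ.exists_spec
  rw [h1] at h
  rw [h2, h1]
  exact sum_mul_log_sub_le_log hU hV hp hp1 hq hc h

theorem IsState.negEnt_sub_le_quad {ρ V : Matrix κ κ ℂ} (hρ : IsState ρ) (hV : IsUni V)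
    {q : κ → ℝ} (hq : ∀ j, 0 < q j) :
    negEnt ρ - (ρ * spec V (fun j => Real.log (q j))).trace.re ≤
      (ρ * ρ * spec V (fun j => (q j)⁻¹)).trace.re - 1 := by
  obtain ⟨U, p, hU, h1, hp, hp1, -, h2⟩ := hρ.exists_spec
  rw [h2, h1]
  have := sum_mul_log_sub_le hU hV hp hq one_pos
  rw [hp1] at this
  simp only [Real.log_one, div_one] at this
  linarith

end Entropy

section Converse

variable {κ : Type*} [Fintype κ] [DecidableEq κ]

theorem sum_mul_normSq_left {U V : Matrix κ κ ℂ} (hV : IsUni V) (f : κ → ℝ)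
    (X : Matrix κ κ ℂ) :
    ∑ i, ∑ j, f i * Complex.normSq ((U.conjTranspose * X * V) i j) =
      (spec U f * (X * X.conjTranspose)).trace.re := by
  have h1 : (spec U f * (X * X.conjTranspose)).trace =
      (Matrix.diagonal (fun i => (f i : ℂ)) * ((U.conjTranspose * X * V) *
        (U.conjTranspose * X * V).conjTranspose)).trace := by
    rw [spec, Matrix.mul_assoc, Matrix.mul_assoc, Matrix.trace_mul_comm]
    simp only [Matrix.mul_assoc, Matrix.conjTranspose_mul, Matrix.conjTranspose_conjTranspose]
    rw [← Matrix.mul_assoc V, hV.2, Matrix.one_mul]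
  rw [h1, Matrix.trace]
  simp only [Matrix.diag_apply, Matrix.diagonal_mul, Complex.re_sum, Complex.re_ofReal_mul]
  refine Finset.sum_congr rfl fun i _ => ?_
  rw [Matrix.mul_apply, Complex.re_sum, Finset.mul_sum]
  refine Finset.sum_congr rfl fun j _ => ?_
  rw [Matrix.conjTranspose_apply, RCLike.star_def, Complex.mul_conj, Complex.ofReal_re]

theorem sum_mul_normSq_right {U V : Matrix κ κ ℂ} (hU : IsUni U) (g : κ → ℝ)
    (X : Matrix κ κ ℂ) :
    ∑ i, ∑ j, g j * Complex.normSq ((U.conjTranspose * X * V) i j) =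
      (spec V g * (X.conjTranspose * X)).trace.re := by
  have := sum_mul_normSq_left (U := V) hU g X.conjTranspose
  rw [Matrix.conjTranspose_conjTranspose] at this
  rw [← this, Finset.sum_comm]
  refine Finset.sum_congr rfl fun j _ => Finset.sum_congr rfl fun i _ => ?_
  have h : V.conjTranspose * X.conjTranspose * U = (U.conjTranspose * X * V).conjTranspose := by
    simp only [Matrix.mul_assoc, Matrix.conjTranspose_mul, Matrix.conjTranspose_conjTranspose]
  rw [h, Matrix.conjTranspose_apply, RCLike.star_def, Complex.normSq_conj]

theorem posSemidef_sub_mul_self {E : Matrix κ κ ℂ} (hE : E.PosSemidef)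
    (hE1 : (1 - E).PosSemidef) : (E - E * E).PosSemidef := by
  have h1 := hE1.mul_mul_conjTranspose_same E
  have h2 := hE.mul_mul_conjTranspose_same (1 - E)
  rw [hE.1.eq] at h1
  rw [hE1.1.eq] at h2
  convert h1.add h2 using 1
  noncomm_ring

theorem sum_min_mul_overlap_le {U V E : Matrix κ κ ℂ} (hU : IsUni U) (hV : IsUni V)
    {p q : κ → ℝ} (hp : ∀ i, 0 ≤ p i) (hq : ∀ j, 0 ≤ q j) (hE : E.PosSemidef)
    (hE1 : (1 - E).PosSemidef) {c : ℝ} (hc : 0 ≤ c) :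
    ∑ i, ∑ j, min (p i) (c * q j) * overlap U V i j ≤
      2 * ((spec U p * (1 - E)).trace.re + c * (spec V q * E).trace.re) := by
  have h1 : (spec U p * ((1 - E) * (1 - E).conjTranspose)).trace.re ≤
      (spec U p * (1 - E)).trace.re := by
    rw [hE1.1.eq]
    exact trace_mul_re_mono_right (spec_posSemidef U hp)
      (posSemidef_sub_mul_self hE1 (by simpa using hE))
  have h2 : (spec V q * (E.conjTranspose * E)).trace.re ≤ (spec V q * E).trace.re := by
    rw [hE.1.eq]
    exact trace_mul_re_mono_right (spec_posSemidef V hq) (posSemidef_sub_mul_self hE hE1)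
  rw [← sum_mul_normSq_left (U := U) hV] at h1
  rw [← sum_mul_normSq_right (V := V) hU] at h2
  have h3 : ∀ i j, min (p i) (c * q j) * overlap U V i j ≤
      2 * (p i * Complex.normSq ((U.conjTranspose * (1 - E) * V) i j)) +
      2 * (c * (q j * Complex.normSq ((U.conjTranspose * E * V) i j))) := by
    intro i j
    set a := (U.conjTranspose * (1 - E) * V) i j
    set b := (U.conjTranspose * E * V) i j
    have hab : (U.conjTranspose * V) i j = a + b := by
      simp only [a, b, ← Matrix.add_apply]
      rw [← Matrix.add_mul, ← Matrix.mul_add, sub_add_cancel, Matrix.mul_one]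
    have hn : overlap U V i j ≤ 2 * Complex.normSq a + 2 * Complex.normSq b := by
      rw [overlap, hab, Complex.normSq_apply, Complex.normSq_apply, Complex.normSq_apply,
        Complex.add_re, Complex.add_im]
      nlinarith [sq_nonneg (a.re - b.re), sq_nonneg (a.im - b.im)]
    have hm : 0 ≤ min (p i) (c * q j) := le_min (hp i) (mul_nonneg hc (hq j))
    have h4 := mul_le_mul_of_nonneg_left hn hm
    have h5 := mul_le_mul_of_nonneg_right (min_le_left (p i) (c * q j)) (Complex.normSq_nonneg a)
    have h6 := mul_le_mul_of_nonneg_right (min_le_right (p i) (c * q j)) (Complex.normSq_nonneg b)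
    nlinarith
  calc _ ≤ ∑ i, ∑ j, (2 * (p i * Complex.normSq ((U.conjTranspose * (1 - E) * V) i j)) +
      2 * (c * (q j * Complex.normSq ((U.conjTranspose * E * V) i j)))) :=
        Finset.sum_le_sum fun i _ => Finset.sum_le_sum fun j _ => h3 i j
    _ = 2 * (∑ i, ∑ j, p i * Complex.normSq ((U.conjTranspose * (1 - E) * V) i j)) +
        2 * (c * ∑ i, ∑ j, q j * Complex.normSq ((U.conjTranspose * E * V) i j)) := by
        simp only [Finset.mul_sum, Finset.sum_add_distrib]
    _ ≤ _ := by nlinarith [mul_le_mul_of_nonneg_left h2 hc]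

theorem suppLE.mul_eq_zero {ρ σ P : Matrix κ κ ℂ} (h : suppLE ρ σ) (hP : P * σ = 0) :
    P * ρ = 0 := by
  apply Matrix.toLin'.injective
  refine LinearMap.ext fun x => ?_
  have hx : Matrix.toLin' ρ x ∈ LinearMap.range (Matrix.toLin' σ) := h ⟨_, rfl⟩
  obtain ⟨y, hy⟩ := hx
  rw [Matrix.toLin'_mul, LinearMap.comp_apply, ← hy, ← LinearMap.comp_apply, ← Matrix.toLin'_mul, hP]
  simp

theorem suppLE_of_eq_mul {ρ σ X : Matrix κ κ ℂ} (h : ρ = σ * X) : suppLE ρ σ := by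
  rintro _ ⟨x, rfl⟩
  exact ⟨Matrix.toLin' X x, by rw [h, Matrix.toLin'_mul, LinearMap.comp_apply]⟩

theorem suppLE.mul_overlap_eq_zero {U V : Matrix κ κ ℂ} (hV : IsUni V) {p q : κ → ℝ}
    (hp : ∀ i, 0 ≤ p i) (h : suppLE (spec U p) (spec V q)) {i j : κ} (hj : q j = 0) :
    p i * overlap U V i j = 0 := by
  have h0 : spec V (Pi.single j 1) * spec V q = 0 := by
    rw [spec_mul hV]
    have : (fun a => (Pi.single j (1 : ℝ) : κ → ℝ) a * q a) = fun a => 0 * q a := by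
      ext a
      by_cases ha : a = j
      · subst ha; simp [hj]
      · simp [ha]
    rw [this]
    simp [spec]
  have h1 := congrArg (fun X => X.trace.re) (h.mul_eq_zero h0)
  simp only [Matrix.trace_mul_comm (spec V _), trace_spec_mul_spec, Matrix.trace_zero,
    Complex.zero_re] at h1
  have h2 : ∀ i, ∑ j', p i * (Pi.single j (1 : ℝ) : κ → ℝ) j' * overlap U V i j' =
      p i * overlap U V i j := by
    intro i
    rw [Finset.sum_eq_single j]
    · simp
    · intro b _ hb; simp [hb]
    · simp
  simp only [h2] at h1
  exact (Finset.sum_eq_zero_iff_of_nonneg fun i _ =>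
    mul_nonneg (hp i) (overlap_nonneg _ _ _ _)).1 h1 i (Finset.mem_univ _)

theorem relEnt_eq {ρ σ : Matrix κ κ ℂ} (h : suppLE ρ σ) :
    relEnt ρ σ = ((negEnt ρ - (ρ * matLog σ).trace.re : ℝ) : EReal) := by
  rw [relEnt, if_pos h, Matrix.mul_sub, Matrix.trace_sub, Complex.sub_re, negEnt]

/-- A test which discriminates `ρ` from `ω` bounds the relative entropy from below. -/
theorem le_relEnt_of_test {ρ ω E : Matrix κ κ ℂ} (hρ : IsState ρ) (hω : IsState ω)
    (hE : E.PosSemidef) (hE1 : (1 - E).PosSemidef) {ε b c : ℝ} (hc : 1 ≤ c)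
    (h1 : (ρ * (1 - E)).trace.re ≤ ε) (h2 : (ω * E).trace.re ≤ b) :
    (((1 - 2 * (ε + c * b)) * Real.log c - 1 : ℝ) : EReal) ≤ relEnt ρ ω := by
  by_cases hs : suppLE ρ ω
  swap
  · rw [relEnt, if_neg hs]; exact le_top
  rw [relEnt_eq hs, EReal.coe_le_coe_iff]
  obtain ⟨U, p, hU, e1, hp, hp1, -, e2⟩ := hρ.exists_spec
  obtain ⟨V, q, hV, e3, hq, hq1, e4, -⟩ := hω.exists_spec
  have hc0 : 0 ≤ c := by linarith
  have hmin := sum_min_mul_overlap_le hU hV hp hq hE hE1 hc0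
  rw [← e1, ← e3] at hmin
  have hmin2 : ∑ i, ∑ j, min (p i) (c * q j) * overlap U V i j ≤ 2 * (ε + c * b) := by
    nlinarith [mul_le_mul_of_nonneg_left h2 hc0]
  rw [e1, e3] at hs
  rw [e2, e4, e1, trace_spec_mul_spec]
  have hlc := Real.log_nonneg hc
  have f1 : ∀ f : κ → ℝ, ∑ i, ∑ j, f i * overlap U V i j = ∑ i, f i := fun f => by
    simp_rw [← Finset.mul_sum, overlap_sum_right hU hV, mul_one]
  have f2 : ∑ i, ∑ j, q j * overlap U V i j = 1 := by
    rw [Finset.sum_comm]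
    simp_rw [← Finset.mul_sum, overlap_sum_left hU hV, mul_one, hq1]
  have key : ∀ i j, Real.log c * (p i * overlap U V i j - min (p i) (c * q j) * overlap U V i j)
      - q j * overlap U V i j ≤ p i * Real.log (p i) * overlap U V i j
        - p i * Real.log (q j) * overlap U V i j := by
    intro i j
    have hu := overlap_nonneg U V i j
    rcases (hq j).eq_or_lt with h0 | h0
    · have hz := hs.mul_overlap_eq_zero hV hp (i := i) h0.symm
      rcases mul_eq_zero.1 hz with h | h
      · rw [h, ← h0]; simp
      · rw [h]; simp
    rcases (hp i).eq_or_lt with h3 | h3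
    · rw [← h3, min_eq_left (mul_nonneg hc0 h0.le)]
      simp only [zero_mul, sub_self, mul_zero, zero_sub]
      have := mul_nonneg h0.le hu
      linarith
    have hlog : p i * (1 - q j / p i) ≤ p i * (Real.log (p i) - Real.log (q j)) := by
      refine mul_le_mul_of_nonneg_left ?_ h3.le
      have := Real.log_le_sub_one_of_pos (div_pos h0 h3)
      rw [Real.log_div h0.ne' h3.ne'] at this
      linarith
    have hsimp : p i * (1 - q j / p i) = p i - q j := by field_simp
    rw [hsimp] at hlog
    suffices hmain : Real.log c * (p i - min (p i) (c * q j)) - q j ≤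
        p i * (Real.log (p i) - Real.log (q j)) by
      have := mul_le_mul_of_nonneg_right hmain hu
      linarith
    rcases le_total (p i) (c * q j) with hle | hle
    · rw [min_eq_left hle]; linarith
    · have h5 : Real.log c ≤ Real.log (p i) - Real.log (q j) := by
        have := Real.log_le_log (by positivity) hle
        rw [Real.log_mul (by positivity) h0.ne'] at this
        linarith
      rw [min_eq_right hle]
      have h6 := mul_le_mul_of_nonneg_left h5 h3.le
      have h7 : 0 ≤ Real.log c * (c * q j) := by positivity
      nlinarith
  have hsum := Finset.sum_le_sum fun i (_ : i ∈ Finset.univ) =>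
    Finset.sum_le_sum fun j (_ : j ∈ Finset.univ) => key i j
  simp only [Finset.sum_sub_distrib, ← Finset.mul_sum, f2] at hsum
  simp only [overlap_sum_right hU hV, mul_one, hp1] at hsum
  nlinarith [mul_le_mul_of_nonneg_left hmin2 hlc]

end Converse

section Tensor

variable {ι : Type*} [Fintype ι] [DecidableEq ι]

theorem tensorPow_eq (ρ : MatC ι) (n : ℕ) : tensorPow ρ n = tensorProdFam fun _ => ρ := rfl

theorem tensorProdFam_mul {n : ℕ} (f g : Fin n → MatC ι) :
    tensorProdFam f * tensorProdFam g = tensorProdFam fun k => f k * g k := by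
  ext i j
  simp only [Matrix.mul_apply, tensorProdFam, ← Finset.prod_mul_distrib, Finset.prod_univ_sum,
    Fintype.piFinset_univ]

theorem tensorProdFam_conjTranspose {n : ℕ} (f : Fin n → MatC ι) :
    (tensorProdFam f).conjTranspose = tensorProdFam fun k => (f k).conjTranspose := by
  ext i j
  simp [Matrix.conjTranspose_apply, tensorProdFam]

theorem trace_tensorProdFam {n : ℕ} (f : Fin n → MatC ι) :
    (tensorProdFam f).trace = ∏ k, (f k).trace := by
  simp only [Matrix.trace, Matrix.diag_apply, tensorProdFam, Finset.prod_univ_sum,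
    Fintype.piFinset_univ]

theorem tensorProdFam_posSemidef {n : ℕ} {f : Fin n → MatC ι} (h : ∀ k, (f k).PosSemidef) :
    (tensorProdFam f).PosSemidef := by
  choose C hC using fun k => PosSemidef.exists_conjTranspose_mul_self (h k)
  have : tensorProdFam f = (tensorProdFam C).conjTranspose * tensorProdFam C := by
    rw [tensorProdFam_conjTranspose, tensorProdFam_mul]
    congr 1
    ext1 k
    exact hC k
  rw [this]
  exact Matrix.posSemidef_conjTranspose_mul_self _

theorem IsState.tensorProdFam {n : ℕ} {f : Fin n → MatC ι} (h : ∀ k, IsState (f k)) :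
    IsState (tensorProdFam f) :=
  ⟨tensorProdFam_posSemidef fun k => (h k).1, by simp [trace_tensorProdFam, (h _).2]⟩

theorem tensorProdFam_smul {n : ℕ} (c : Fin n → ℂ) (f : Fin n → MatC ι) :
    tensorProdFam (fun k => c k • f k) = (∏ k, c k) • tensorProdFam f := by
  ext i j
  simp [tensorProdFam, Finset.prod_mul_distrib]

theorem tensorProdFam_update_sub {n : ℕ} (f : Fin n → MatC ι) (a : Fin n) (X Y : MatC ι) :
    tensorProdFam (Function.update f a (X - Y)) =
      tensorProdFam (Function.update f a X) - tensorProdFam (Function.update f a Y) := by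
  ext i j
  simp only [tensorProdFam, Matrix.sub_apply]
  rw [← Finset.mul_prod_erase _ _ (Finset.mem_univ a), ← Finset.mul_prod_erase _ _
    (Finset.mem_univ a), ← Finset.mul_prod_erase _ _ (Finset.mem_univ a)]
  have : ∀ Z : MatC ι, ∏ k ∈ Finset.univ.erase a, Function.update f a Z k (i k) (j k) =
      ∏ k ∈ Finset.univ.erase a, f k (i k) (j k) := fun Z =>
    Finset.prod_congr rfl fun k hk => by rw [Function.update_of_ne (Finset.ne_of_mem_erase hk)]
  simp only [this, Function.update_self, Matrix.sub_apply, sub_mul]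

theorem tensorProdFam_mono {n : ℕ} {f g : Fin n → MatC ι} (hf : ∀ k, (f k).PosSemidef)
    (h : ∀ k, (g k - f k).PosSemidef) : (tensorProdFam g - tensorProdFam f).PosSemidef := by
  have hg : ∀ k, (g k).PosSemidef := fun k => by simpa using (h k).add (hf k)
  have key : ∀ s : Finset (Fin n),
      (tensorProdFam (fun k => if k ∈ s then g k else f k) - tensorProdFam f).PosSemidef := by
    intro s
    induction s using Finset.induction_on with
    | empty => simpa using Matrix.PosSemidef.zero
    | insert a s ha ih =>
      set w : Fin n → MatC ι := fun k => if k ∈ s then g k else f k with hw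
      have e1 : (fun k => if k ∈ insert a s then g k else f k) = Function.update w a (g a) := by
        ext1 k
        by_cases hk : k = a
        · subst hk; simp
        · simp [hw, hk]
      have e2 : w = Function.update w a (f a) := by
        rw [eq_comm, Function.update_eq_self_iff]
        simp [hw, ha]
      have e3 : tensorProdFam (fun k => if k ∈ insert a s then g k else f k) - tensorProdFam f =
          tensorProdFam (Function.update w a (g a - f a)) + (tensorProdFam w - tensorProdFam f) := by
        rw [tensorProdFam_update_sub, ← e2, e1]
        abel
      rw [e3]
      refine Matrix.PosSemidef.add (tensorProdFam_posSemidef fun k => ?_) ih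
      by_cases hk : k = a
      · subst hk; simpa using h k
      · rw [Function.update_of_ne hk, hw]
        dsimp only
        split_ifs
        · exact hg k
        · exact hf k
  simpa using key Finset.univ

open scoped Kronecker in
theorem tensorMul_eq {n m : ℕ} (ρ : MatN ι n) (σ : MatN ι m) : tensorMul ρ σ =
    (ρ ⊗ₖ σ).submatrix (Fin.appendEquiv n m).symm (Fin.appendEquiv n m).symm := by
  ext i j
  simp [tensorMul]

theorem tensorMul_mul {n m : ℕ} (ρ ρ' : MatN ι n) (σ σ' : MatN ι m) :
    tensorMul ρ σ * tensorMul ρ' σ' = tensorMul (ρ * ρ') (σ * σ') := by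
  rw [tensorMul_eq, tensorMul_eq, tensorMul_eq, Matrix.submatrix_mul_equiv, Matrix.mul_kronecker_mul]

theorem tensorMul_posSemidef {n m : ℕ} {ρ : MatN ι n} {σ : MatN ι m} (hρ : ρ.PosSemidef)
    (hσ : σ.PosSemidef) : (tensorMul ρ σ).PosSemidef := by
  rw [tensorMul_eq]
  exact (hρ.kronecker hσ).submatrix _

theorem tensorMul_one_one {n m : ℕ} : tensorMul (1 : MatN ι n) (1 : MatN ι m) = 1 := by
  rw [tensorMul_eq, Matrix.one_kronecker_one, Matrix.submatrix_one_equiv]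

theorem tensorMul_sub_left {n m : ℕ} (ρ ρ' : MatN ι n) (σ : MatN ι m) :
    tensorMul (ρ - ρ') σ = tensorMul ρ σ - tensorMul ρ' σ := by
  ext i j; simp [tensorMul, sub_mul]

theorem tensorMul_smul_left {n m : ℕ} (c : ℂ) (ρ : MatN ι n) (σ : MatN ι m) :
    tensorMul (c • ρ) σ = c • tensorMul ρ σ := by
  ext i j; simp [tensorMul, mul_assoc]

theorem tensorMul_smul_right {n m : ℕ} (c : ℂ) (ρ : MatN ι n) (σ : MatN ι m) :
    tensorMul ρ (c • σ) = c • tensorMul ρ σ := by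
  ext i j; simp [tensorMul, mul_left_comm]

theorem tensorMul_sum_right {α : Type*} (s : Finset α) {n m : ℕ} (ρ : MatN ι n)
    (σ : α → MatN ι m) : tensorMul ρ (∑ a ∈ s, σ a) = ∑ a ∈ s, tensorMul ρ (σ a) := by
  ext i j; simp [tensorMul, Finset.mul_sum, Matrix.sum_apply]

theorem trace_tensorMul {n m : ℕ} (ρ : MatN ι n) (σ : MatN ι m) :
    (tensorMul ρ σ).trace = ρ.trace * σ.trace := by
  simp only [Matrix.trace, Matrix.diag_apply, Finset.sum_mul_sum, ← Finset.sum_product',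
    Finset.univ_product_univ]
  refine (Fintype.sum_equiv (Fin.appendEquiv n m) _ _ fun x => ?_).symm
  simp [tensorMul]

theorem tensorPow_add (σ : MatC ι) (n m : ℕ) :
    tensorPow σ (n + m) = tensorMul (tensorPow σ n) (tensorPow σ m) := by
  ext i j
  simp [tensorPow, tensorMul, Fin.prod_univ_add]

theorem trace_mul_tensorMul {n k : ℕ} (ρ : MatN ι (n + k)) (X : MatN ι n) (F : MatN ι k) :
    (ρ * tensorMul X F).trace = (condReduce ρ F * X).trace := by
  simp only [Matrix.trace, Matrix.diag_apply, Matrix.mul_apply, condReduce, Finset.sum_mul]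
  rw [← Fintype.sum_equiv (Fin.appendEquiv n k)
    (fun x : (Fin n → ι) × (Fin k → ι) => ∑ j : Fin (n + k) → ι,
      ρ (Fin.append x.1 x.2) j * tensorMul X F j (Fin.append x.1 x.2)) _ (fun x => rfl)]
  rw [Fintype.sum_prod_type]
  refine Finset.sum_congr rfl fun i _ => ?_
  rw [Finset.sum_comm' (t' := Finset.univ) (s' := fun _ => Finset.univ) (by simp)]
  have : ∀ a, ∑ j : Fin (n + k) → ι,
      ρ (Fin.append i a) j * tensorMul X F j (Fin.append i a) =
      ∑ j : Fin n → ι, ∑ b : Fin k → ι, ρ (Fin.append i a) (Fin.append j b) * F b a * X j i := by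
    intro a
    rw [← Fintype.sum_equiv (Fin.appendEquiv n k)
      (fun x : (Fin n → ι) × (Fin k → ι) =>
        ρ (Fin.append i a) (Fin.append x.1 x.2) *
          tensorMul X F (Fin.append x.1 x.2) (Fin.append i a)) _ (fun x => rfl),
      Fintype.sum_prod_type]
    refine Finset.sum_congr rfl fun j _ => Finset.sum_congr rfl fun b _ => ?_
    simp [tensorMul]
    ring
  rw [Finset.sum_comm]
  simp only [this]
  rw [Finset.sum_comm]

theorem permCopies_eq {n : ℕ} (π : Equiv.Perm (Fin n)) (ρ : MatN ι n) :
    permCopies π ρ = ρ.submatrix (π.arrowCongr (Equiv.refl ι)).symm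
      (π.arrowCongr (Equiv.refl ι)).symm := by
  ext i j
  rfl

theorem permCopies_mul {n : ℕ} (π : Equiv.Perm (Fin n)) (ρ σ : MatN ι n) :
    permCopies π (ρ * σ) = permCopies π ρ * permCopies π σ := by
  rw [permCopies_eq, permCopies_eq, permCopies_eq, Matrix.submatrix_mul_equiv]

theorem permCopies_one {n : ℕ} (π : Equiv.Perm (Fin n)) :
    permCopies π (1 : MatN ι n) = 1 := by
  rw [permCopies_eq, Matrix.submatrix_one_equiv]

theorem permCopies_sub {n : ℕ} (π : Equiv.Perm (Fin n)) (ρ σ : MatN ι n) :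
    permCopies π (ρ - σ) = permCopies π ρ - permCopies π σ := rfl

theorem permCopies_posSemidef {n : ℕ} (π : Equiv.Perm (Fin n)) {ρ : MatN ι n}
    (h : ρ.PosSemidef) : (permCopies π ρ).PosSemidef := by
  rw [permCopies_eq]; exact h.submatrix _

theorem trace_permCopies {n : ℕ} (π : Equiv.Perm (Fin n)) (ρ : MatN ι n) :
    (permCopies π ρ).trace = ρ.trace := by
  rw [permCopies_eq]
  simp only [Matrix.trace, Matrix.diag_apply, Matrix.submatrix_apply]
  exact Equiv.sum_comp (π.arrowCongr (Equiv.refl ι)).symm fun x => ρ x x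

theorem permCopies_permCopies {n : ℕ} (π τ : Equiv.Perm (Fin n)) (ρ : MatN ι n) :
    permCopies π (permCopies τ ρ) = permCopies (π * τ) ρ := rfl

theorem permCopies_tensorProdFam {n : ℕ} (π : Equiv.Perm (Fin n)) (f : Fin n → MatC ι) :
    permCopies π (tensorProdFam f) = tensorProdFam fun k => f (π.symm k) := by
  ext i j
  simp only [permCopies, tensorProdFam, Function.comp]
  exact Fintype.prod_equiv π _ _ fun k => by simp

theorem permCopies_tensorPow {n : ℕ} (π : Equiv.Perm (Fin n)) (σ : MatC ι) :
    permCopies π (tensorPow σ n) = tensorPow σ n := by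
  rw [tensorPow_eq, permCopies_tensorProdFam]

end Tensor

section Net

variable {κ : Type*} [Fintype κ]

theorem convex_isState : Convex ℝ {ρ : Matrix κ κ ℂ | IsState ρ} := by
  intro ρ hρ σ hσ a b ha hb hab
  refine ⟨(hρ.1.smul ha).add (hσ.1.smul hb), ?_⟩
  rw [Matrix.trace_add, Matrix.trace_smul, Matrix.trace_smul, hρ.2, hσ.2, ← add_smul, hab, one_smul]

theorem IsState.norm_apply_le [DecidableEq κ] {ρ : Matrix κ κ ℂ} (h : IsState ρ) (i j : κ) :
    ‖ρ i j‖ ≤ 1 := by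
  obtain ⟨C, hC⟩ := PosSemidef.exists_conjTranspose_mul_self h.1
  have hd : ∀ i, (ρ i i).re = ∑ k, ‖C k i‖ ^ 2 := fun i => by
    rw [hC, Matrix.mul_apply, Complex.re_sum]
    refine Finset.sum_congr rfl fun k _ => ?_
    rw [Matrix.conjTranspose_apply, RCLike.star_def, ← Complex.normSq_eq_conj_mul_self,
      Complex.ofReal_re, Complex.normSq_eq_norm_sq]
  have ht : ∑ i, (ρ i i).re = 1 := by
    have := congrArg Complex.re h.2
    simpa [Matrix.trace] using this
  have hle : ∀ i, (ρ i i).re ≤ 1 := fun i => by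
    rw [← ht]
    refine Finset.single_le_sum (f := fun i => (ρ i i).re) (fun k _ => ?_) (Finset.mem_univ i)
    rw [hd]; positivity
  calc ‖ρ i j‖ = ‖∑ k, star (C k i) * C k j‖ := by
        conv_lhs => rw [hC, Matrix.mul_apply]
        rfl
    _ ≤ ∑ k, ‖star (C k i) * C k j‖ := norm_sum_le _ _
    _ ≤ ∑ k, (‖C k i‖ ^ 2 + ‖C k j‖ ^ 2) / 2 := Finset.sum_le_sum fun k _ => by
        rw [norm_mul, norm_star]
        nlinarith [sq_nonneg (‖C k i‖ - ‖C k j‖)]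
    _ = ((ρ i i).re + (ρ j j).re) / 2 := by
        rw [hd, hd, ← Finset.sum_add_distrib, Finset.sum_div]
    _ ≤ 1 := by linarith [hle i, hle j]

/-- A convex set of states has, for every `δ > 0`, a finite subset dominating it up to a
factor `1 + δ`. -/
theorem exists_finset_dominating [DecidableEq κ] {C : Set (Matrix κ κ ℂ)} (hC : Convex ℝ C)
    (hne : C.Nonempty) (hs : ∀ σ ∈ C, IsState σ) {δ : ℝ} (hδ : 0 < δ) :
    ∃ F : Finset (Matrix κ κ ℂ), F.Nonempty ∧ (F : Set (Matrix κ κ ℂ)) ⊆ C ∧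
      ∀ σ ∈ C, ∃ y ∈ F, ((1 + δ) • y - σ).PosSemidef := by
  let : NormedAddCommGroup (Matrix κ κ ℂ) := Matrix.normedAddCommGroup
  let : NormedSpace ℝ (Matrix κ κ ℂ) := Matrix.normedSpace
  obtain ⟨b, hbC, hspan, hli⟩ := exists_linearIndependent ℝ C
  have : Finite b := hli.finite
  have : Fintype b := Fintype.ofFinite b
  have hspan' : ∀ σ ∈ C, ∃ a : b → ℝ, ∑ v, a v • (v : Matrix κ κ ℂ) = σ := by
    intro σ hσ
    have : σ ∈ Submodule.span ℝ b := hspan ▸ Submodule.subset_span hσ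
    rw [← Subtype.range_coe (s := b)] at this
    exact (Submodule.mem_span_range_iff_exists_fun ℝ).1 this
  have hbne : Nonempty b := by
    by_contra hcon
    rw [not_nonempty_iff] at hcon
    obtain ⟨σ, hσ⟩ := hne
    obtain ⟨a, ha⟩ := hspan' σ hσ
    have := (hs σ hσ).2
    simp [← ha] at this
  set f : (b → ℝ) →ₗ[ℝ] Matrix κ κ ℂ := Fintype.linearCombination ℝ (fun v : b => (v : Matrix κ κ ℂ))
  have hf : ∀ a, f a = ∑ v, a v • (v : Matrix κ κ ℂ) := fun a => rfl
  obtain ⟨K, -, hK⟩ := f.exists_antilipschitzWith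
    (LinearMap.ker_eq_bot.2 (linearIndependent_iff_injective_fintypeLinearCombination.1 hli))
  have hCb : Bornology.IsBounded C := by
    rw [isBounded_iff_forall_norm_le]
    exact ⟨1, fun σ hσ => (Matrix.norm_le_iff zero_le_one).2 (hs σ hσ).norm_apply_le⟩
  have htb := (hK.isBounded_preimage hCb).isCompact_closure.totallyBounded.subset subset_closure
  set r : ℝ := (Fintype.card b : ℝ) with hr
  have hr0 : 0 < r := by rw [hr]; exact_mod_cast Fintype.card_pos
  obtain ⟨t, htC, htf, htcov⟩ := Metric.finite_approx_of_totallyBounded htb (δ / r) (by positivity)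
  set c0 : Matrix κ κ ℂ := ∑ v : b, r⁻¹ • (v : Matrix κ κ ℂ) with hc0
  have hc0C : c0 ∈ C := hC.sum_mem (fun _ _ => by positivity)
    (by rw [Finset.sum_const, Finset.card_univ, nsmul_eq_mul]; exact mul_inv_cancel₀ hr0.ne') (fun v _ => hbC v.2)
  set g : (b → ℝ) → Matrix κ κ ℂ := fun a => (1 + δ)⁻¹ • f a + (δ / (1 + δ)) • c0 with hg
  have hgC : ∀ a ∈ t, g a ∈ C := fun a ha =>
    hC (htC ha) hc0C (by positivity) (by positivity) (by field_simp)
  have hdom : ∀ σ ∈ C, ∃ a ∈ t, ((1 + δ) • g a - σ).PosSemidef := by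
    intro σ hσ
    obtain ⟨x, hx⟩ := hspan' σ hσ
    have hxm : x ∈ f ⁻¹' C := by rw [Set.mem_preimage, hf, hx]; exact hσ
    obtain ⟨a, hat, hxa⟩ := Set.mem_iUnion₂.1 (htcov hxm)
    refine ⟨a, hat, ?_⟩
    have h1 : (1 + δ) • g a - σ = ∑ v : b, (a v - x v + δ / r) • (v : Matrix κ κ ℂ) := by
      have h1 : (1 + δ) • g a = f a + δ • c0 := by
        rw [hg, smul_add, smul_smul, smul_smul, mul_inv_cancel₀ (by positivity), one_smul,
          mul_div_cancel₀ _ (by positivity)]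
      rw [h1, hf, hc0, ← hx, Finset.smul_sum, ← Finset.sum_add_distrib, ← Finset.sum_sub_distrib]
      refine Finset.sum_congr rfl fun v _ => ?_
      rw [smul_smul, ← add_smul, ← sub_smul]
      congr 1
      field_simp
      ring
    rw [h1]
    refine Matrix.posSemidef_sum _ fun v _ => (hs v (hbC v.2)).1.smul ?_
    have h2 : dist (x v) (a v) < δ / r := (dist_le_pi_dist x a v).trans_lt hxa
    rw [Real.dist_eq] at h2
    linarith [(abs_lt.1 h2).2]
  refine ⟨htf.toFinset.image g, ?_, ?_, ?_⟩
  · obtain ⟨σ, hσ⟩ := hne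
    obtain ⟨a, ha, -⟩ := hdom σ hσ
    exact ⟨g a, Finset.mem_image_of_mem _ (htf.mem_toFinset.2 ha)⟩
  · intro y hy
    obtain ⟨a, ha, rfl⟩ := Finset.mem_image.1 hy
    exact hgC a (htf.mem_toFinset.1 ha)
  · intro σ hσ
    obtain ⟨a, ha, h⟩ := hdom σ hσ
    exact ⟨g a, Finset.mem_image_of_mem _ (htf.mem_toFinset.2 ha), h⟩

end Net

section Mixture

variable {ι : Type*} [Fintype ι] [DecidableEq ι]

theorem posSemidef_of_trace_mul_nonneg {κ : Type*} [Fintype κ] [DecidableEq κ]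
    {A : Matrix κ κ ℂ} (hA : A.IsHermitian)
    (h : ∀ M : Matrix κ κ ℂ, M.PosSemidef → 0 ≤ (A * M).trace.re) : A.PosSemidef := by
  obtain ⟨U, p, hU, rfl, -⟩ := IsHermitian.exists_spec hA
  refine spec_posSemidef U fun i => ?_
  have h1 := h (spec U (Pi.single i 1)) (spec_posSemidef U fun a => by
    by_cases ha : a = i <;> simp [ha])
  rw [spec_mul hU, trace_spec hU, Complex.ofReal_re] at h1
  simpa [Pi.single_apply] using h1

theorem measurable_matrix_apply {C : Set (MatC ι)} (i j : ι) :
    Measurable fun σ : ↥C => (σ : MatC ι) i j := by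
  have h1 : Measurable fun M : MatC ι => M i j :=
    (measurable_pi_apply j).comp (measurable_pi_apply (X := fun _ : ι => ι → ℂ) i)
  exact h1.comp measurable_subtype_coe

theorem measurable_prod_apply {C : Set (MatC ι)} {n : ℕ} (i j : Fin n → ι) :
    Measurable fun σ : ↥C => ∏ k, (σ : MatC ι) (i k) (j k) :=
  Finset.measurable_prod _ fun k _ => measurable_matrix_apply (i k) (j k)

theorem norm_prod_apply_le {C : Set (MatC ι)} (hC : ∀ σ ∈ C, IsState σ) {n : ℕ}
    (i j : Fin n → ι) (σ : ↥C) : ‖∏ k, (σ : MatC ι) (i k) (j k)‖ ≤ 1 := by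
  rw [norm_prod]
  exact Finset.prod_le_one (fun _ _ => norm_nonneg _)
    fun k _ => (hC σ σ.2).norm_apply_le (i k) (j k)

theorem integrable_prod_apply {C : Set (MatC ι)} (hC : ∀ σ ∈ C, IsState σ) (μ : Measure ↥C)
    [IsProbabilityMeasure μ] {n : ℕ} (i j : Fin n → ι) :
    Integrable (fun σ : ↥C => ∏ k, (σ : MatC ι) (i k) (j k)) μ :=
  Integrable.of_bound (measurable_prod_apply i j).aestronglyMeasurable 1
    (Eventually.of_forall fun σ => norm_prod_apply_le hC i j σ)

theorem integrable_trace_tensorPow_mul {C : Set (MatC ι)} (hC : ∀ σ ∈ C, IsState σ)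
    (μ : Measure ↥C) [IsProbabilityMeasure μ] {n : ℕ} (M : MatN ι n) :
    Integrable (fun σ : ↥C => (tensorPow (σ : MatC ι) n * M).trace) μ := by
  simp only [Matrix.trace, Matrix.diag_apply, Matrix.mul_apply, tensorPow]
  exact integrable_finsetSum _ fun i _ => integrable_finsetSum _ fun j _ =>
    (integrable_prod_apply hC μ i j).mul_const _

theorem trace_iidMix_mul {C : Set (MatC ι)} (hC : ∀ σ ∈ C, IsState σ) (μ : Measure ↥C)
    [IsProbabilityMeasure μ] {n : ℕ} (M : MatN ι n) :
    (iidMix μ n * M).trace = ∫ σ : ↥C, (tensorPow (σ : MatC ι) n * M).trace ∂μ := by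
  simp only [Matrix.trace, Matrix.diag_apply, Matrix.mul_apply, tensorPow, iidMix]
  rw [integral_finsetSum _ fun i _ => integrable_finsetSum _ fun j _ =>
    (integrable_prod_apply hC μ i j).mul_const _]
  refine Finset.sum_congr rfl fun i _ => ?_
  rw [integral_finsetSum _ fun j _ => (integrable_prod_apply hC μ i j).mul_const _]
  refine Finset.sum_congr rfl fun j _ => ?_
  rw [integral_mul_const]

theorem trace_iidMix_mul_re {C : Set (MatC ι)} (hC : ∀ σ ∈ C, IsState σ) (μ : Measure ↥C)
    [IsProbabilityMeasure μ] {n : ℕ} (M : MatN ι n) :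
    (iidMix μ n * M).trace.re = ∫ σ : ↥C, (tensorPow (σ : MatC ι) n * M).trace.re ∂μ := by
  rw [trace_iidMix_mul hC]
  exact (integral_re (integrable_trace_tensorPow_mul hC μ M)).symm

theorem tensorPow_isState {σ : MatC ι} (h : IsState σ) (n : ℕ) : IsState (tensorPow σ n) :=
  IsState.tensorProdFam fun _ => h

theorem iidMix_isState {C : Set (MatC ι)} (hC : ∀ σ ∈ C, IsState σ) (μ : Measure ↥C)
    [IsProbabilityMeasure μ] (n : ℕ) : IsState (iidMix μ n) := by
  refine ⟨posSemidef_of_trace_mul_nonneg ?_ fun M hM => ?_, ?_⟩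
  · ext i j
    rw [Matrix.conjTranspose_apply, iidMix, iidMix, RCLike.star_def, ← integral_conj]
    refine integral_congr_ae (Eventually.of_forall fun σ => ?_)
    simp only [map_prod]
    exact Finset.prod_congr rfl fun k _ => (hC σ σ.2).1.1.apply (i k) (j k)
  · rw [trace_iidMix_mul_re hC]
    exact integral_nonneg fun σ =>
      PosSemidef.trace_mul_re_nonneg (tensorPow_isState (hC σ σ.2) n).1 hM
  · have := trace_iidMix_mul hC μ (1 : MatN ι n)
    rw [Matrix.mul_one] at this
    rw [this]
    have h1 : ∀ σ : ↥C, (tensorPow (σ : MatC ι) n * 1).trace = 1 := fun σ => by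
      rw [Matrix.mul_one, (tensorPow_isState (hC σ σ.2) n).2]
    simp only [h1]
    simp

theorem trace_iidMix_mul_re_le {C : Set (MatC ι)} (hC : ∀ σ ∈ C, IsState σ) (μ : Measure ↥C)
    [IsProbabilityMeasure μ] {n : ℕ} {M : MatN ι n} {b : ℝ}
    (h : ∀ σ ∈ C, (tensorPow σ n * M).trace.re ≤ b) : (iidMix μ n * M).trace.re ≤ b := by
  rw [trace_iidMix_mul_re hC]
  calc _ ≤ ∫ _ : ↥C, b ∂μ := integral_mono (integrable_trace_tensorPow_mul hC μ M).re
          (integrable_const b) fun σ => h σ σ.2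
    _ = b := by simp

theorem permCopies_iidMix {C : Set (MatC ι)} (μ : Measure ↥C) {n : ℕ} (π : Equiv.Perm (Fin n)) :
    permCopies π (iidMix μ n) = iidMix μ n := by
  ext i j
  simp only [permCopies, iidMix]
  refine integral_congr_ae (Eventually.of_forall fun σ => ?_)
  exact congrFun (congrFun (permCopies_tensorPow π (σ : MatC ι)) i) j

theorem tensorPow_smul (c : ℂ) (σ : MatC ι) (n : ℕ) :
    tensorPow (c • σ) n = c ^ n • tensorPow σ n := by
  rw [tensorPow_eq, tensorProdFam_smul]
  simp [tensorPow_eq]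

/-- There is a probability measure whose i.i.d. mixtures dominate all `σ^{⊗n}` up to
subexponential factors. -/
theorem exists_universal_measure {C : Set (MatC ι)} (hC : Convex ℝ C) (hne : C.Nonempty)
    (hs : ∀ σ ∈ C, IsState σ) :
    ∃ μ : Measure ↥C, IsProbabilityMeasure μ ∧ ∀ δ > (0 : ℝ), ∃ K > (0 : ℝ), ∀ n : ℕ, ∀ σ ∈ C,
      ∀ M : MatN ι n, M.PosSemidef →
        (tensorPow σ n * M).trace.re ≤ K * Real.exp (δ * n) * (iidMix μ n * M).trace.re := by
  choose F hFne hFC hF using fun j : ℕ =>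
    exists_finset_dominating hC hne hs (δ := 1 / ((j : ℝ) + 1)) (by positivity)
  have hcount : (⋃ j, ((F j : Set (MatC ι)))).Countable :=
    Set.countable_iUnion fun j => (F j).countable_toSet
  obtain ⟨y, hy⟩ := hcount.exists_eq_range
    ⟨(hFne 0).choose, Set.mem_iUnion.2 ⟨0, (hFne 0).choose_spec⟩⟩
  have hyC : ∀ i, y i ∈ C := fun i => by
    have : y i ∈ ⋃ j, ((F j : Set (MatC ι))) := hy ▸ Set.mem_range_self i
    obtain ⟨j, hj⟩ := Set.mem_iUnion.1 this
    exact hFC j hj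
  set ν : Measure ℕ := ProbabilityTheory.geometricMeasure ⟨1 / 2, by norm_num, by norm_num⟩
  have hν : ∀ i, 0 < ν.real {i} := fun i =>
    ProbabilityTheory.geometricMeasure_real_singleton_pos
      (by simp [← Subtype.coe_inj]) (by rw [ne_eq, ← Subtype.coe_inj]; norm_num) i
  set Y : ℕ → ↥C := fun i => ⟨y i, hyC i⟩
  have hY : Measurable Y := measurable_from_nat
  have hprob : IsProbabilityMeasure (ν.map Y) := Measure.isProbabilityMeasure_map hY.aemeasurable
  refine ⟨ν.map Y, hprob, fun δ hδ => ?_⟩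
  have hpt : ∀ i n, ∀ M : MatN ι n, M.PosSemidef →
      ν.real {i} * (tensorPow (y i) n * M).trace.re ≤ (iidMix (ν.map Y) n * M).trace.re := by
    intro i n M hM
    have h_intg : Integrable (fun σ : ↥C => (tensorPow (σ : MatC ι) n * M).trace.re) (ν.map Y) :=
      (integrable_trace_tensorPow_mul hs (ν.map Y) M).re
    rw [trace_iidMix_mul_re hs, integral_map hY.aemeasurable h_intg.aestronglyMeasurable]
    have hint2 : Integrable (fun x => (tensorPow (y x) n * M).trace.re) ν :=
      h_intg.comp_measurable hY
    have := setIntegral_le_integral (s := {i}) hint2 (Eventually.of_forall fun x =>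
      PosSemidef.trace_mul_re_nonneg (tensorPow_isState (hs _ (hyC x)) n).1 hM)
    rwa [integral_singleton] at this
  obtain ⟨j, hj⟩ := exists_nat_one_div_lt hδ
  have hidx : ∀ z : MatC ι, ∃ i, z ∈ F j → y i = z := fun z => by
    by_cases hz : z ∈ F j
    · have : z ∈ Set.range y := hy ▸ Set.mem_iUnion.2 ⟨j, hz⟩
      obtain ⟨i, hi⟩ := this
      exact ⟨i, fun _ => hi⟩
    · exact ⟨0, fun h => absurd h hz⟩
  choose ix hix using hidx
  refine ⟨∑ z ∈ F j, (ν.real {ix z})⁻¹, Finset.sum_pos (fun z _ => inv_pos.2 (hν _)) (hFne j), ?_⟩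
  intro n σ hσ M hM
  obtain ⟨z, hz, hzσ⟩ := hF j σ hσ
  set s : ℝ := 1 + 1 / ((j : ℝ) + 1) with hsdef
  have hs0 : 0 ≤ s := by positivity
  have h1 : (tensorPow σ n * M).trace.re ≤ s ^ n * (tensorPow z n * M).trace.re := by
    have h2 : (tensorPow (((s : ℝ) : ℂ) • z) n - tensorPow σ n).PosSemidef :=
      tensorProdFam_mono (fun _ => (hs σ hσ).1) fun _ => by rwa [Complex.coe_smul]
    have := trace_mul_re_mono_left hM h2
    rwa [tensorPow_smul, Matrix.smul_mul, Matrix.trace_smul, smul_eq_mul, ← Complex.ofReal_pow,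
      Complex.re_ofReal_mul] at this
  have h3 : s ^ n ≤ Real.exp (δ * n) := by
    rw [mul_comm, Real.exp_nat_mul]
    refine pow_le_pow_left₀ hs0 ?_ n
    calc s ≤ δ + 1 := by rw [hsdef]; linarith
      _ ≤ _ := Real.add_one_le_exp δ
  have h4 := hpt (ix z) n M hM
  rw [hix z hz] at h4
  have h0 := PosSemidef.trace_mul_re_nonneg (tensorPow_isState (hs z (hFC j hz)) n).1 hM
  have h5 : (tensorPow z n * M).trace.re ≤
      (∑ z ∈ F j, (ν.real {ix z})⁻¹) * (iidMix (ν.map Y) n * M).trace.re := by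
    have h6 : (ν.real {ix z})⁻¹ ≤ ∑ z ∈ F j, (ν.real {ix z})⁻¹ :=
      Finset.single_le_sum (f := fun z => (ν.real {ix z})⁻¹)
        (fun z _ => (inv_pos.2 (hν _)).le) hz
    have h7 : 0 ≤ (iidMix (ν.map Y) n * M).trace.re :=
      PosSemidef.trace_mul_re_nonneg (iidMix_isState hs _ n).1 hM
    calc _ = (ν.real {ix z})⁻¹ * (ν.real {ix z} * (tensorPow z n * M).trace.re) := by
            rw [← mul_assoc, inv_mul_cancel₀ (hν _).ne', one_mul]
      _ ≤ (ν.real {ix z})⁻¹ * (iidMix (ν.map Y) n * M).trace.re :=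
            mul_le_mul_of_nonneg_left h4 (inv_pos.2 (hν _)).le
      _ ≤ _ := mul_le_mul_of_nonneg_right h6 h7
  calc _ ≤ s ^ n * (tensorPow z n * M).trace.re := h1
    _ ≤ Real.exp (δ * n) * (tensorPow z n * M).trace.re := mul_le_mul_of_nonneg_right h3 h0
    _ ≤ Real.exp (δ * n) * ((∑ z ∈ F j, (ν.real {ix z})⁻¹) *
        (iidMix (ν.map Y) n * M).trace.re) := mul_le_mul_of_nonneg_left h5 (Real.exp_pos _).le
    _ = _ := by ring

end Mixture

section Functional

variable {κ : Type*} [Fintype κ] [DecidableEq κ]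

theorem spec_pow {U : Matrix κ κ ℂ} (hU : IsUni U) (p : κ → ℝ) (l : ℕ) :
    spec U p ^ l = spec U (fun i => p i ^ l) := by
  induction l with
  | zero => simp [spec_one hU]
  | succ l ih => rw [pow_succ, ih, spec_mul hU]; simp only [pow_succ]

/-- Functions of a Hermitian matrix are polynomials in it. -/
theorem exists_spec_comp_eq_sum_pow {U : Matrix κ κ ℂ} (hU : IsUni U) (p : κ → ℝ) (f : ℝ → ℝ) :
    ∃ (m : ℕ) (a : ℕ → ℂ), spec U (fun i => f (p i)) =
      ∑ l ∈ Finset.range m, a l • spec U p ^ l := by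
  set s : Finset ℝ := Finset.univ.image p
  set P : Polynomial ℝ := Lagrange.interpolate s id f
  have hP : ∀ i, f (p i) = ∑ l ∈ Finset.range (P.natDegree + 1), P.coeff l * p i ^ l := fun i => by
    rw [← Polynomial.eval_eq_sum_range]
    exact (Lagrange.eval_interpolate_at_node f (Function.injective_id.injOn)
      (Finset.mem_image_of_mem p (Finset.mem_univ i))).symm
  refine ⟨P.natDegree + 1, fun l => (P.coeff l : ℂ), ?_⟩
  simp only [hP, spec_sum, spec_smul, spec_pow hU]

theorem commute_spec_comp {U B : Matrix κ κ ℂ} (hU : IsUni U) {p : κ → ℝ} (f : ℝ → ℝ)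
    (h : Commute B (spec U p)) : Commute B (spec U (fun i => f (p i))) := by
  obtain ⟨m, a, ha⟩ := exists_spec_comp_eq_sum_pow hU p f
  rw [ha]
  exact Commute.sum_right _ _ _ fun l _ => (h.pow_right l).smul_right _

theorem spec_commute {U : Matrix κ κ ℂ} (hU : IsUni U) (f g : κ → ℝ) :
    Commute (spec U f) (spec U g) := by
  rw [Commute, SemiconjBy, spec_mul hU, spec_mul hU]
  simp only [mul_comm]

theorem posSemidef_mul_eq_zero {ρ P : Matrix κ κ ℂ} (hρ : ρ.PosSemidef) (hP : P.PosSemidef)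
    (hPP : P * P = P) (h : (ρ * P).trace.re = 0) : P * ρ = 0 := by
  obtain ⟨C, rfl⟩ := PosSemidef.exists_conjTranspose_mul_self hρ
  have h1 : (C.conjTranspose * C * P).trace = (C * P * (C * P).conjTranspose).trace := by
    rw [Matrix.conjTranspose_mul, hP.1.eq, Matrix.mul_assoc C, ← Matrix.mul_assoc P P, hPP,
      Matrix.mul_assoc, Matrix.trace_mul_comm, Matrix.mul_assoc]
  have h2 : (C * P * (C * P).conjTranspose).trace = 0 := by
    have h3 := (Matrix.posSemidef_self_mul_conjTranspose (C * P)).trace_nonneg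
    rw [h1] at h
    exact Complex.ext h (Complex.le_def.1 h3).2.symm
  rw [Matrix.trace_mul_conjTranspose_self_eq_zero_iff] at h2
  have h4 : P * C.conjTranspose = 0 := by
    rw [← hP.1.eq, ← Matrix.conjTranspose_mul, h2, Matrix.conjTranspose_zero]
  rw [← Matrix.mul_assoc, h4, Matrix.zero_mul]

theorem negEnt_le_of_forall {ρ : Matrix κ κ ℂ} (hρ : IsState ρ) {c : ℝ}
    (h : ∀ (V : Matrix κ κ ℂ) (r : κ → ℝ), IsUni V → (∀ i, 0 < r i) → ∑ i, r i = 1 →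
      (ρ * spec V (fun i => Real.log (r i))).trace.re ≤ c) : negEnt ρ ≤ c := by
  obtain ⟨U, p, hU, hρU, hp, hp1, -, hE⟩ := hρ.exists_spec
  have hN : 0 < (Fintype.card κ : ℝ) := by
    by_contra hN
    have : Fintype.card κ = 0 := by
      have := le_antisymm (not_lt.1 hN) (Nat.cast_nonneg _)
      exact_mod_cast this
    rw [Fintype.card_eq_zero_iff] at this
    simp at hp1
  have key : ∀ s ∈ Set.Ioo (0 : ℝ) 1, negEnt ρ + Real.log (1 - s) ≤ c := by
    intro s hs
    have hr : ∀ i, 0 < (1 - s) * p i + s / Fintype.card κ := fun i =>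
      add_pos_of_nonneg_of_pos (mul_nonneg (by linarith [hs.2]) (hp i)) (div_pos hs.1 hN)
    refine le_trans ?_ (h U (fun i => (1 - s) * p i + s / Fintype.card κ) hU hr ?_)
    · rw [hE, hρU, spec_mul hU, trace_spec hU, Complex.ofReal_re]
      calc _ = ∑ i, (p i * Real.log (p i) + p i * Real.log (1 - s)) := by
            rw [Finset.sum_add_distrib, ← Finset.sum_mul, hp1, one_mul]
        _ ≤ _ := Finset.sum_le_sum fun i _ => by
            rcases (hp i).eq_or_lt with h0 | h0
            · simp [← h0]
            · rw [← mul_add]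
              refine mul_le_mul_of_nonneg_left ?_ h0.le
              have h1s : 0 < 1 - s := by linarith [hs.2]
              rw [← Real.log_mul h0.ne' h1s.ne']
              refine Real.log_le_log (mul_pos h0 h1s) ?_
              have := div_pos hs.1 hN
              nlinarith
    · rw [Finset.sum_add_distrib, ← Finset.mul_sum, hp1]
      simp only [Finset.sum_const, Finset.card_univ, nsmul_eq_mul]
      field_simp
      ring
  have hlim : Tendsto (fun s : ℝ => negEnt ρ + Real.log (1 - s)) (𝓝[>] 0)
      (𝓝 (negEnt ρ + Real.log (1 - 0))) := by
    refine tendsto_nhdsWithin_of_tendsto_nhds ?_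
    refine ContinuousAt.tendsto (f := fun s : ℝ => negEnt ρ + Real.log (1 - s)) ?_
    have : ((1 : ℝ) - 0) ≠ 0 := by norm_num
    exact continuousAt_const.add ((continuousAt_const.sub continuousAt_id).log this)
  rw [sub_zero, Real.log_one, add_zero] at hlim
  exact le_of_tendsto hlim (by
    filter_upwards [Ioo_mem_nhdsGT (show (0 : ℝ) < 1 by norm_num)] with s hs using key s hs)

theorem isCompact_of_isClosed_of_isState {A : Set (Matrix κ κ ℂ)} (hA : IsClosed A)
    (hs : ∀ ρ ∈ A, IsState ρ) : IsCompact A := by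
  have h1 : IsCompact (Set.pi Set.univ fun _ : κ => Set.pi Set.univ fun _ : κ =>
      Metric.closedBall (0 : ℂ) 1) :=
    isCompact_univ_pi fun _ => isCompact_univ_pi fun _ => isCompact_closedBall _ _
  exact IsCompact.of_isClosed_subset h1 hA fun ρ hρ i _ j _ => by
    simpa using (hs ρ hρ).norm_apply_le i j

theorem continuous_trace_mul_re (M : Matrix κ κ ℂ) :
    Continuous fun ρ : Matrix κ κ ℂ => (ρ * M).trace.re :=
  Complex.continuous_re.comp (Continuous.matrix_trace (continuous_id.matrix_mul continuous_const))

/-- If all relative entropies to `ω` exceed `x` on a compact set of states, this persists after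
replacing the zero eigenvalues of `ω` by some `η > 0`. -/
theorem exists_regularised {A : Set (Matrix κ κ ℂ)} (hA : IsClosed A)
    (hs : ∀ ρ ∈ A, IsState ρ) {ω U : Matrix κ κ ℂ} {q : κ → ℝ} (hU : IsUni U)
    (hω : ω = spec U q) (hlog : matLog ω = spec U (fun i => Real.log (q i)))
    {x : ℝ} (hx : ∀ ρ ∈ A, (x : EReal) < relEnt ρ ω) :
    ∃ η > (0 : ℝ), ∀ ρ ∈ A, x ≤ negEnt ρ -
      (ρ * spec U (fun i => Real.log (if q i = 0 then η else q i))).trace.re := by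
  set Z : Matrix κ κ ℂ := spec U (fun i => if q i = 0 then 1 else 0) with hZdef
  have hZ : Z.PosSemidef := spec_posSemidef U fun i => by split_ifs <;> norm_num
  have hZZ : Z * Z = Z := by
    rw [hZdef, spec_mul hU]; congr 1; ext i; split_ifs <;> norm_num
  set T : ℕ → Set (Matrix κ κ ℂ) := fun n => A ∩ ⋂ (V : Matrix κ κ ℂ), ⋂ (r : κ → ℝ),
    ⋂ (_ : IsUni V ∧ (∀ i, 0 < r i) ∧ ∑ i, r i = 1),
      {ρ | (ρ * spec V (fun i => Real.log (r i))).trace.re - (ρ * matLog ω).trace.re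
        + n * (ρ * Z).trace.re ≤ x} with hT
  have hTcl : ∀ n, IsClosed (T n) := fun n => hA.inter <| isClosed_iInter fun V =>
    isClosed_iInter fun r => isClosed_iInter fun _ => isClosed_le
      (((continuous_trace_mul_re _).sub (continuous_trace_mul_re _)).add
        (continuous_const.mul (continuous_trace_mul_re _))) continuous_const
  have hmem : ∀ n ρ, ρ ∈ T n ↔ ρ ∈ A ∧ ∀ (V : Matrix κ κ ℂ) (r : κ → ℝ),
      (IsUni V ∧ (∀ i, 0 < r i) ∧ ∑ i, r i = 1) →
      (ρ * spec V (fun i => Real.log (r i))).trace.re - (ρ * matLog ω).trace.re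
        + n * (ρ * Z).trace.re ≤ x := fun n ρ => by
    simp only [hT, Set.mem_inter_iff, Set.mem_iInter, Set.mem_ofPred_eq]
  obtain ⟨n, hn⟩ : ∃ n, ¬ (T n).Nonempty := by
    by_contra! hne
    have hsub : ∀ n, T (n + 1) ⊆ T n := fun n ρ hρ => by
      rw [hmem] at hρ ⊢
      refine ⟨hρ.1, fun V r hr => le_trans ?_ (hρ.2 V r hr)⟩
      have := PosSemidef.trace_mul_re_nonneg (hs ρ hρ.1).1 hZ
      push_cast
      linarith
    obtain ⟨ρ, hρ⟩ := IsCompact.nonempty_iInter_of_sequence_nonempty_isCompact_isClosed T hsub hne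
      ((isCompact_of_isClosed_of_isState hA hs).of_isClosed_subset (hTcl 0)
        Set.inter_subset_left) hTcl
    rw [Set.mem_iInter] at hρ
    have hρA : ρ ∈ A := (hρ 0).1
    have hst := hs ρ hρA
    have hz0 := PosSemidef.trace_mul_re_nonneg hst.1 hZ
    have hle : negEnt ρ ≤ x + (ρ * matLog ω).trace.re :=
      negEnt_le_of_forall hst fun V r hV hr h1 => by
        have := ((hmem 0 ρ).1 (hρ 0)).2 V r ⟨hV, hr, h1⟩
        simp only [Nat.cast_zero, zero_mul] at this
        linarith
    have hz : (ρ * Z).trace.re = 0 := by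
      by_contra hz
      have hzp := lt_of_le_of_ne hz0 (Ne.symm hz)
      have hb : ∀ n : ℕ, negEnt ρ ≤ x + (ρ * matLog ω).trace.re - n * (ρ * Z).trace.re :=
        fun n => negEnt_le_of_forall hst fun V r hV hr h1 => by
          have := ((hmem n ρ).1 (hρ n)).2 V r ⟨hV, hr, h1⟩
          linarith
      obtain ⟨n, hn⟩ := exists_nat_gt ((x + (ρ * matLog ω).trace.re - negEnt ρ) /
        (ρ * Z).trace.re)
      rw [div_lt_iff₀ hzp] at hn
      linarith [hb n]
    have hZρ := posSemidef_mul_eq_zero hst.1 hZ hZZ hz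
    have hsupp : suppLE ρ ω := suppLE_of_eq_mul (X := spec U (fun i => (q i)⁻¹) * ρ) (by
      rw [← Matrix.mul_assoc, hω, spec_mul hU]
      have : Z + spec U (fun i => q i * (q i)⁻¹) = 1 := by
        rw [hZdef, ← spec_add, ← spec_one hU]
        congr 1; ext i; split_ifs with h
        · simp [h]
        · simp [h]
      calc ρ = (Z + spec U (fun i => q i * (q i)⁻¹)) * ρ := by rw [this, Matrix.one_mul]
        _ = _ := by rw [Matrix.add_mul, hZρ, zero_add])
    have := hx ρ hρA
    rw [relEnt_eq hsupp, EReal.coe_lt_coe_iff] at this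
    linarith
  refine ⟨Real.exp (-n), Real.exp_pos _, fun ρ hρ => ?_⟩
  have hnot : ρ ∉ T n := fun h => hn ⟨ρ, h⟩
  rw [hmem] at hnot
  push Not at hnot
  obtain ⟨V, r, ⟨hV, hr, h1⟩, hlt⟩ := hnot hρ
  have hK := (hs ρ hρ).trace_mul_log_le hV hr
  have heq : spec U (fun i => Real.log (if q i = 0 then Real.exp (-n) else q i)) =
      matLog ω - (n : ℂ) • Z := by
    rw [hlog, hZdef, show ((n : ℂ)) = ((n : ℝ) : ℂ) by push_cast; rfl, ← spec_smul, ← spec_sub]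
    congr 1; ext i; split_ifs with h
    · simp [h]
    · simp
  rw [heq, Matrix.mul_sub, Matrix.trace_sub, Matrix.mul_smul, Matrix.trace_smul, Complex.sub_re,
    smul_eq_mul, show ((n : ℂ)) = ((n : ℝ) : ℂ) by push_cast; rfl, Complex.re_ofReal_mul]
  linarith

end Functional

section Pinching

variable {κ : Type*} [Fintype κ] [DecidableEq κ]

/-- The eigenprojection of `spec U r` for the eigenvalue `c`. -/
def eigenProj (U : Matrix κ κ ℂ) (r : κ → ℝ) (c : ℝ) : Matrix κ κ ℂ :=
  spec U (fun i => if r i = c then 1 else 0)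

/-- The pinching map with respect to the eigenspaces of `spec U r`. -/
def pinch (U : Matrix κ κ ℂ) (r : κ → ℝ) (X : Matrix κ κ ℂ) : Matrix κ κ ℂ :=
  ∑ c ∈ Finset.univ.image r, eigenProj U r c * X * eigenProj U r c

theorem eigenProj_isHermitian (U : Matrix κ κ ℂ) (r : κ → ℝ) (c : ℝ) :
    (eigenProj U r c).IsHermitian := spec_isHermitian U _

theorem eigenProj_mul {U : Matrix κ κ ℂ} (hU : IsUni U) (r : κ → ℝ) (c c' : ℝ) :
    eigenProj U r c * eigenProj U r c' = if c = c' then eigenProj U r c else 0 := by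
  rw [eigenProj, eigenProj, spec_mul hU]
  split_ifs with h
  · subst h
    congr 1; ext i; split_ifs <;> simp
  · have : (fun i => (if r i = c then (1 : ℝ) else 0) * (if r i = c' then 1 else 0)) =
        fun _ => 0 := by
      ext i; split_ifs with h1 h2 <;> simp
      exact h (h1.symm.trans h2)
    rw [this, spec_const hU]; simp

theorem spec_comp_eq_sum_eigenProj (U : Matrix κ κ ℂ) (r : κ → ℝ) (f : ℝ → ℝ) :
    spec U (fun i => f (r i)) = ∑ c ∈ Finset.univ.image r, (f c : ℂ) • eigenProj U r c := by
  simp only [eigenProj, ← spec_smul, ← spec_sum]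
  congr 1; ext i
  simp

theorem sum_eigenProj {U : Matrix κ κ ℂ} (hU : IsUni U) (r : κ → ℝ) :
    ∑ c ∈ Finset.univ.image r, eigenProj U r c = 1 := by
  have := spec_comp_eq_sum_eigenProj U r fun _ => 1
  rw [spec_one hU] at this
  simpa using this.symm

theorem pinch_sub (U : Matrix κ κ ℂ) (r : κ → ℝ) (X Y : Matrix κ κ ℂ) :
    pinch U r (X - Y) = pinch U r X - pinch U r Y := by
  simp only [pinch, Matrix.mul_sub, Matrix.sub_mul, Finset.sum_sub_distrib]

theorem pinch_add (U : Matrix κ κ ℂ) (r : κ → ℝ) (X Y : Matrix κ κ ℂ) :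
    pinch U r (X + Y) = pinch U r X + pinch U r Y := by
  simp only [pinch, Matrix.mul_add, Matrix.add_mul, Finset.sum_add_distrib]

theorem pinch_smul (U : Matrix κ κ ℂ) (r : κ → ℝ) (a : ℝ) (X : Matrix κ κ ℂ) :
    pinch U r (a • X) = a • pinch U r X := by
  simp only [pinch, Matrix.mul_smul, Matrix.smul_mul, Finset.smul_sum]

theorem pinch_posSemidef (U : Matrix κ κ ℂ) (r : κ → ℝ) {X : Matrix κ κ ℂ} (hX : X.PosSemidef) :
    (pinch U r X).PosSemidef :=
  Matrix.posSemidef_sum _ fun c _ => by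
    have := hX.mul_mul_conjTranspose_same (eigenProj U r c)
    rwa [(eigenProj_isHermitian U r c).eq] at this

theorem trace_pinch_mul {U : Matrix κ κ ℂ} (hU : IsUni U) (r : κ → ℝ) (X : Matrix κ κ ℂ)
    {G : Matrix κ κ ℂ} (hG : ∀ c, Commute (eigenProj U r c) G) :
    (pinch U r X * G).trace = (X * G).trace := by
  rw [pinch, Finset.sum_mul, Matrix.trace_sum]
  have : ∀ c, (eigenProj U r c * X * eigenProj U r c * G).trace =
      (X * G * eigenProj U r c).trace := fun c => by
    rw [Matrix.mul_assoc, (hG c).eq, Matrix.mul_assoc, Matrix.trace_mul_comm]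
    simp only [Matrix.mul_assoc]
    rw [eigenProj_mul hU, if_pos rfl]
  simp only [this]
  rw [← Matrix.trace_sum, ← Finset.mul_sum, sum_eigenProj hU, Matrix.mul_one]

theorem trace_pinch {U : Matrix κ κ ℂ} (hU : IsUni U) (r : κ → ℝ) (X : Matrix κ κ ℂ) :
    (pinch U r X).trace = X.trace := by
  simpa using trace_pinch_mul hU r X (G := 1) fun _ => Commute.one_right _

theorem eigenProj_commute_pinch {U : Matrix κ κ ℂ} (hU : IsUni U) (r : κ → ℝ)
    (X : Matrix κ κ ℂ) (c : ℝ) : Commute (eigenProj U r c) (pinch U r X) := by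
  rw [Commute, SemiconjBy, pinch, Finset.mul_sum, Finset.sum_mul]
  refine Finset.sum_congr rfl fun a _ => ?_
  rw [← Matrix.mul_assoc, ← Matrix.mul_assoc, Matrix.mul_assoc (eigenProj U r a * X),
    eigenProj_mul hU, eigenProj_mul hU]
  by_cases h : c = a
  · subst h; simp
  · simp [h, Ne.symm h]

/-- The pinching inequality. -/
theorem pinching_inequality {U : Matrix κ κ ℂ} (hU : IsUni U) (r : κ → ℝ) {X : Matrix κ κ ℂ}
    (hX : X.PosSemidef) :
    (((Finset.univ.image r).card : ℝ) • pinch U r X - X).PosSemidef := by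
  set s := Finset.univ.image r
  set P := eigenProj U r
  have h1 : ∀ c c', ((P c - P c') * X * (P c - P c')).PosSemidef := fun c c' => by
    have := hX.mul_mul_conjTranspose_same (P c - P c')
    rwa [((eigenProj_isHermitian U r c).sub (eigenProj_isHermitian U r c')).eq] at this
  have h2 : (((1 / 2 : ℝ)) • ∑ c ∈ s, ∑ c' ∈ s, (P c - P c') * X * (P c - P c')).PosSemidef :=
    Matrix.PosSemidef.smul (Matrix.posSemidef_sum _ fun c _ => Matrix.posSemidef_sum _
      fun c' _ => h1 c c') (by norm_num)
  have h3 : ∑ c ∈ s, ∑ c' ∈ s, P c * X * P c' = X := by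
    have : ∑ c ∈ s, ∑ c' ∈ s, P c * X * P c' = (∑ c ∈ s, P c) * X * ∑ c' ∈ s, P c' := by
      simp only [Finset.sum_mul, Finset.mul_sum]
      exact Finset.sum_comm
    rw [this, sum_eigenProj hU, Matrix.one_mul, Matrix.mul_one]
  have h4 : ∑ c ∈ s, ∑ c' ∈ s, P c' * X * P c = X := Finset.sum_comm.trans h3
  convert h2 using 1
  have h5 : ∑ c ∈ s, ∑ c' ∈ s, (P c - P c') * X * (P c - P c') =
      (s.card : ℝ) • pinch U r X + (s.card : ℝ) • pinch U r X - X - X := by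
    have : ∀ c c', (P c - P c') * X * (P c - P c') =
        P c * X * P c + P c' * X * P c' - P c * X * P c' - P c' * X * P c := fun c c' => by
      noncomm_ring
    simp only [this, Finset.sum_sub_distrib, Finset.sum_add_distrib, h3, h4, Finset.sum_const]
    rw [← Finset.smul_sum]
    simp only [← Nat.cast_smul_eq_nsmul ℝ]
    rfl
  rw [h5]
  module

end Pinching

section Witness

variable {κ : Type*} [Fintype κ] [DecidableEq κ]

theorem nonneg_of_spec_posSemidef {U : Matrix κ κ ℂ} (hU : IsUni U) {f : κ → ℝ}
    (h : (spec U f).PosSemidef) (i : κ) : 0 ≤ f i := by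
  have h1 := PosSemidef.trace_mul_re_nonneg h (spec_posSemidef U (f := Pi.single i 1) fun a => by
    by_cases ha : a = i <;> simp [ha])
  rw [spec_mul hU, trace_spec hU, Complex.ofReal_re] at h1
  simpa [Pi.single_apply] using h1

theorem IsState.card_pos {ρ : Matrix κ κ ℂ} (hρ : IsState ρ) : 0 < (Fintype.card κ : ℝ) := by
  have h : Nonempty κ := by
    by_contra h
    rw [not_nonempty_iff] at h
    simpa [Matrix.trace] using hρ.2
  exact_mod_cast Fintype.card_pos

/-- The pinching mixed equally with the maximally mixed state. -/
def smoothPinch (U : Matrix κ κ ℂ) (r : κ → ℝ) (X : Matrix κ κ ℂ) : Matrix κ κ ℂ :=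
  (2⁻¹ : ℝ) • pinch U r X + (2 * Fintype.card κ : ℝ)⁻¹ • (1 : Matrix κ κ ℂ)

theorem smoothPinch_isState {U : Matrix κ κ ℂ} (hU : IsUni U) (r : κ → ℝ) {ρ : Matrix κ κ ℂ}
    (hρ : IsState ρ) : IsState (smoothPinch U r ρ) := by
  refine ⟨((pinch_posSemidef U r hρ.1).smul (by norm_num)).add
    (Matrix.PosSemidef.one.smul (by positivity)), ?_⟩
  have := hρ.card_pos
  have h0 : (Fintype.card κ : ℂ) ≠ 0 := by exact_mod_cast this.ne'
  rw [smoothPinch, Matrix.trace_add, Matrix.trace_smul, Matrix.trace_smul, trace_pinch hU, hρ.2,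
    Matrix.trace_one, Complex.real_smul, Complex.real_smul]
  push_cast
  field_simp
  norm_num

theorem eigenProj_commute_smoothPinch {U : Matrix κ κ ℂ} (hU : IsUni U) (r : κ → ℝ)
    (X : Matrix κ κ ℂ) (c : ℝ) : Commute (eigenProj U r c) (smoothPinch U r X) :=
  ((eigenProj_commute_pinch hU r X c).smul_right _).add_right ((Commute.one_right _).smul_right _)

theorem exists_spec_smoothPinch {U : Matrix κ κ ℂ} (hU : IsUni U) (r : κ → ℝ) {ρ : Matrix κ κ ℂ}
    (hρ : IsState ρ) : ∃ V p, IsUni V ∧ smoothPinch U r ρ = spec V p ∧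
      (∀ i, (2 * Fintype.card κ : ℝ)⁻¹ ≤ p i) ∧ ∑ i, p i = 1 ∧
      matLog (smoothPinch U r ρ) = spec V (fun i => Real.log (p i)) := by
  obtain ⟨V, p, hV, h1, -, h2, h3, -⟩ := (smoothPinch_isState hU r hρ).exists_spec
  refine ⟨V, p, hV, h1, fun i => ?_, h2, h3⟩
  have h4 : (spec V (fun i => p i - (2 * Fintype.card κ : ℝ)⁻¹)).PosSemidef := by
    rw [spec_sub, spec_const hV, ← h1, smoothPinch, Complex.coe_smul, add_sub_cancel_right]
    exact (pinch_posSemidef U r hρ.1).smul (by norm_num)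
  exact sub_nonneg.1 (nonneg_of_spec_posSemidef hV h4 i)

theorem IsState.trace_sq_re_le_one {ρ : Matrix κ κ ℂ} (hρ : IsState ρ) :
    (ρ * ρ).trace.re ≤ 1 := by
  obtain ⟨V, p, hV, rfl, hp, h1, -⟩ := hρ.exists_spec
  rw [spec_mul hV, trace_spec hV, Complex.ofReal_re, ← h1]
  refine Finset.sum_le_sum fun i _ => ?_
  have : p i ≤ 1 := h1 ▸ Finset.single_le_sum (fun i _ => hp i) (Finset.mem_univ i)
  nlinarith [hp i]

theorem IsState.trace_sub_sq_re_le {ρ σ : Matrix κ κ ℂ} (hρ : IsState ρ) (hσ : IsState σ) :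
    ((ρ - σ) * (ρ - σ)).trace.re ≤ 2 := by
  have h1 : (ρ - σ) * (ρ - σ) = ρ * ρ + σ * σ - ρ * σ - σ * ρ := by noncomm_ring
  rw [h1]
  simp only [Matrix.trace_sub, Matrix.trace_add, Complex.sub_re, Complex.add_re]
  linarith [hρ.trace_sq_re_le_one, hσ.trace_sq_re_le_one,
    PosSemidef.trace_mul_re_nonneg hρ.1 hσ.1, PosSemidef.trace_mul_re_nonneg hσ.1 hρ.1]

/-- Second-order expansion of the relative entropy around a full-rank state. -/
theorem IsState.negEnt_segment_le {ρ σ V : Matrix κ κ ℂ} {q : κ → ℝ} {c t : ℝ} (hρ : IsState ρ)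
    (hσ : IsState σ) (hV : IsUni V) (hσV : σ = spec V q) (hc : 0 < c) (hq : ∀ i, c ≤ q i)
    (ht : t ∈ Set.Icc (0 : ℝ) 1) :
    negEnt (σ + t • (ρ - σ)) -
      ((σ + t • (ρ - σ)) * spec V (fun i => Real.log (q i))).trace.re ≤ 2 * c⁻¹ * t ^ 2 := by
  have hst : IsState (σ + t • (ρ - σ)) := by
    have := convex_isState (κ := κ) hσ hρ (sub_nonneg.2 ht.2) ht.1 (by ring)
    have h2 : σ + t • (ρ - σ) = (1 - t) • σ + t • ρ := by module
    rw [h2]; exact this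
  have hq0 : ∀ i, 0 < q i := fun i => hc.trans_le (hq i)
  refine (hst.negEnt_sub_le_quad hV hq0).trans ?_
  set Q := spec V (fun i => (q i)⁻¹)
  have hσQ : σ * Q = 1 := by
    rw [hσV, spec_mul hV, ← spec_one hV]
    congr 1; ext i; exact mul_inv_cancel₀ (hq0 i).ne'
  have hQσ : Q * σ = 1 := by
    rw [hσV, spec_mul hV, ← spec_one hV]
    congr 1; ext i; exact inv_mul_cancel₀ (hq0 i).ne'
  set Δ := ρ - σ with hΔ
  have hΔ0 : Δ.trace = 0 := by rw [hΔ, Matrix.trace_sub, hρ.2, hσ.2, sub_self]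
  have h3 : ((σ + t • Δ) * (σ + t • Δ) * Q).trace = 1 + (t ^ 2 : ℝ) • (Δ * Δ * Q).trace := by
    have : (σ + t • Δ) * (σ + t • Δ) * Q = σ * (σ * Q) + t • (σ * Δ * Q) + t • (Δ * (σ * Q))
        + (t ^ 2) • (Δ * Δ * Q) := by
      simp only [Matrix.add_mul, Matrix.mul_add, Matrix.smul_mul, Matrix.mul_smul,
        Matrix.mul_assoc, smul_add, smul_smul, sq]
      abel
    rw [this]
    simp only [Matrix.trace_add, Matrix.trace_smul, hσQ, Matrix.mul_one, hσ.2, hΔ0]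
    rw [Matrix.trace_mul_cycle, hQσ, Matrix.one_mul, hΔ0]
    simp
  rw [h3, Complex.add_re, Complex.one_re, Complex.real_smul, Complex.re_ofReal_mul]
  have hΔH : Δ.IsHermitian := hρ.1.1.sub hσ.1.1
  have hΔΔ : (Δ * Δ).PosSemidef := by
    have := Matrix.posSemidef_self_mul_conjTranspose Δ
    rwa [hΔH.eq] at this
  have h4 : (Δ * Δ * Q).trace.re ≤ c⁻¹ * 2 := by
    have h5 := trace_mul_re_mono_right hΔΔ (spec_mono V fun i => inv_anti₀ hc (hq i))
    rw [spec_const hV, Matrix.mul_smul, Matrix.trace_smul, Matrix.mul_one, smul_eq_mul,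
      Complex.re_ofReal_mul] at h5
    exact h5.trans (mul_le_mul_of_nonneg_left (hρ.trace_sub_sq_re_le hσ) (inv_pos.2 hc).le)
  nlinarith [sq_nonneg t]

end Witness

section WitnessExistence

variable {κ : Type*} [Fintype κ] [DecidableEq κ]

theorem smoothPinch_segment {U : Matrix κ κ ℂ} (r : κ → ℝ) (ρ σ : Matrix κ κ ℂ) (t : ℝ) :
    smoothPinch U r (σ + t • (ρ - σ)) =
      smoothPinch U r σ + t • (smoothPinch U r ρ - smoothPinch U r σ) := by
  simp only [smoothPinch, pinch_add, pinch_smul, pinch_sub]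
  module

theorem exists_exp_witness {U V : Matrix κ κ ℂ} (hU : IsUni U) (hV : IsUni V) {r p : κ → ℝ}
    (hr : ∀ i, 0 < r i) (hp : ∀ i, 0 < p i) (h1 : ∑ i, p i = 1)
    (hcomm : Commute (spec V p) (spec U (fun i => Real.log (r i)))) :
    ∃ W g, IsUni W ∧ spec V (fun i => Real.log (p i)) - spec U (fun i => Real.log (r i)) =
      spec W g ∧ (spec U r * spec W (fun i => Real.exp (g i))).trace.re = 1 := by
  obtain ⟨W, g, hW, hg, -⟩ := IsHermitian.exists_spec
    ((spec_isHermitian V (fun i => Real.log (p i))).sub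
      (spec_isHermitian U (fun i => Real.log (r i))))
  refine ⟨W, g, hW, hg, ?_⟩
  have hc2 : Commute (spec V (fun i => Real.log (p i))) (-spec U (fun i => Real.log (r i))) :=
    (commute_spec_comp hV Real.log hcomm.symm).symm.neg_right
  have h2 : spec W (fun i => Real.exp (g i)) = spec V p * spec U (fun i => (r i)⁻¹) := by
    rw [← exp_spec hW, ← hg, sub_eq_add_neg, Matrix.exp_add_of_commute _ _ hc2, ← spec_neg,
      exp_spec hV, exp_spec hU]
    congr 2
    · ext i; exact Real.exp_log (hp i)
    · ext i; rw [Real.exp_neg, Real.exp_log (hr i)]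
  have h3 : spec U (fun i => (r i)⁻¹) * spec U r = 1 := by
    rw [spec_mul hU, ← spec_one hU]
    congr 1; ext i; exact inv_mul_cancel₀ (hr i).ne'
  rw [h2, Matrix.trace_mul_comm, Matrix.mul_assoc, h3, Matrix.mul_one, trace_spec hV, h1]
  simp

/-- A Hermitian witness separating a convex set of states from a positive operator, with almost
optimal exponent. -/
theorem exists_witness {A : Set (Matrix κ κ ℂ)} (hA : Convex ℝ A) (hne : A.Nonempty)
    (hs : ∀ ρ ∈ A, IsState ρ) {U : Matrix κ κ ℂ} (hU : IsUni U) {r : κ → ℝ} (hr : ∀ i, 0 < r i)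
    {x : ℝ} (hx : ∀ ρ ∈ A, x ≤ negEnt ρ - (ρ * spec U (fun i => Real.log (r i))).trace.re) :
    ∃ W g, IsUni W ∧ (spec U r * spec W (fun i => Real.exp (g i))).trace.re = 1 ∧
      ∀ ρ ∈ A, x - Real.log (2 * (Finset.univ.image r).card) - 2 ≤ (ρ * spec W g).trace.re := by
  set L := spec U (fun i => Real.log (r i)) with hL
  set Ψ : Matrix κ κ ℂ → ℝ := fun ρ => negEnt (smoothPinch U r ρ) -
    (smoothPinch U r ρ * L).trace.re with hΨ
  have hN : 0 < (Fintype.card κ : ℝ) := (hs _ hne.some_mem).card_pos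
  set c : ℝ := (2 * Fintype.card κ : ℝ)⁻¹ with hc
  have hc0 : 0 < c := by positivity
  set t : ℝ := c / (c + 4) with ht
  have ht0 : 0 < t := by positivity
  have ht1 : t ≤ 1 := by rw [ht, div_le_one (by positivity)]; linarith
  have hbdd : BddBelow (Ψ '' A) := ⟨-(∑ i, r i - 1), by
    rintro _ ⟨ρ, hρ, rfl⟩
    have := (smoothPinch_isState hU r (hs ρ hρ)).trace_mul_log_le hU hr
    simp only [hΨ, hL]
    linarith⟩
  obtain ⟨_, ⟨σ, hσA, rfl⟩, hσ⟩ := exists_lt_of_csInf_lt (hne.image Ψ)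
    (show sInf (Ψ '' A) < sInf (Ψ '' A) + t / 2 by linarith)
  have hmin : ∀ ρ ∈ A, Ψ σ - t / 2 ≤ Ψ ρ := fun ρ hρ => by
    have := csInf_le hbdd (Set.mem_image_of_mem Ψ hρ)
    linarith
  obtain ⟨V, p, hV, hVp, hpc, hp1, hlog⟩ := exists_spec_smoothPinch hU r (hs σ hσA)
  have hp0 : ∀ i, 0 < p i := fun i => hc0.trans_le (hpc i)
  have hLc : ∀ X : Matrix κ κ ℂ, (∀ a, Commute (eigenProj U r a) X) → Commute X L := by
    intro X hX
    rw [hL, spec_comp_eq_sum_eigenProj]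
    exact Commute.sum_right _ _ _ fun a _ => (hX a).symm.smul_right _
  obtain ⟨W, g, hW, hg, hexp⟩ := exists_exp_witness hU hV hr hp0 hp1
    (hLc _ fun a => hVp ▸ eigenProj_commute_smoothPinch hU r σ a)
  refine ⟨W, g, hW, hexp, fun ρ hρ => ?_⟩
  have hGc : ∀ a, Commute (eigenProj U r a) (spec W g) := fun a => by
    rw [← hg]
    refine Commute.sub_right (commute_spec_comp hV Real.log ?_) ?_
    · rw [← hVp]; exact eigenProj_commute_smoothPinch hU r σ a
    · exact spec_commute hU _ _
  set τ := smoothPinch U r σ with hτ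
  set Δ := smoothPinch U r ρ - τ with hΔ
  have hΔG : (Δ * spec W g).trace.re =
      ((ρ * spec W g).trace.re - (σ * spec W g).trace.re) / 2 := by
    have : Δ = (2⁻¹ : ℝ) • pinch U r (ρ - σ) := by
      rw [hΔ, hτ, smoothPinch, smoothPinch, pinch_sub]; module
    rw [this, Matrix.smul_mul, Matrix.trace_smul, trace_pinch_mul hU r _ hGc, Complex.real_smul,
      Complex.re_ofReal_mul, Matrix.sub_mul, Matrix.trace_sub, Complex.sub_re]
    ring
  have hstep : -1 ≤ (Δ * spec W g).trace.re := by
    have hmem : σ + t • (ρ - σ) ∈ A := by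
      have := hA hσA hρ (sub_nonneg.2 ht1) ht0.le (by ring)
      have h2 : σ + t • (ρ - σ) = (1 - t) • σ + t • ρ := by module
      rw [h2]; exact this
    have h3 := hmin _ hmem
    have h4 := (smoothPinch_isState hU r (hs ρ hρ)).negEnt_segment_le
      (smoothPinch_isState hU r (hs σ hσA)) hV hVp hc0 hpc ⟨ht0.le, ht1⟩
    rw [← smoothPinch_segment] at h4
    have h5 : (smoothPinch U r (σ + t • (ρ - σ)) * spec V (fun i => Real.log (p i))).trace.re -
        (smoothPinch U r (σ + t • (ρ - σ)) * L).trace.re = Ψ σ + t * (Δ * spec W g).trace.re := by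
      have h6 : Ψ σ = (τ * spec W g).trace.re := by
        rw [← hg, Matrix.mul_sub, Matrix.trace_sub, Complex.sub_re, ← hlog]; rfl
      rw [h6, ← Complex.sub_re, ← Matrix.trace_sub, ← Matrix.mul_sub, hg, smoothPinch_segment,
        Matrix.add_mul, Matrix.trace_add, Complex.add_re, Matrix.smul_mul, Matrix.trace_smul,
        Complex.real_smul, Complex.re_ofReal_mul]
    have h7 : 2 * c⁻¹ * t ^ 2 ≤ t / 2 := by
      have : c⁻¹ * t ≤ 1 / 4 := by
        rw [ht, ← mul_div_assoc, inv_mul_cancel₀ hc0.ne']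
        exact one_div_le_one_div_of_le (by norm_num) (by linarith)
      nlinarith
    have h8 : Ψ σ - t / 2 ≤ t / 2 + (Ψ σ + t * (Δ * spec W g).trace.re) := by
      rw [← h5]
      simp only [hΨ] at h3 ⊢
      linarith
    have : t * (-1) ≤ t * (Δ * spec W g).trace.re := by linarith
    exact le_of_mul_le_mul_left this ht0
  have hbase : x - Real.log (2 * (Finset.univ.image r).card) ≤ (σ * spec W g).trace.re := by
    have hne' : Nonempty κ := by
      rw [← Fintype.card_pos_iff]; exact_mod_cast hN
    have hv : 0 < (2 * (Finset.univ.image r).card : ℝ) := by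
      have : 0 < (Finset.univ.image r).card := Finset.card_pos.2 (Finset.univ_nonempty.image r)
      positivity
    have hdom : (((2 * (Finset.univ.image r).card : ℝ) : ℂ) • spec V p - σ).PosSemidef := by
      rw [← hVp, hτ, smoothPinch, Complex.coe_smul]
      have h9 := (pinching_inequality hU r (hs σ hσA).1).add
        ((Matrix.PosSemidef.one (n := κ) (R := ℂ)).smul
          (show (0 : ℝ) ≤ 2 * (Finset.univ.image r).card * c by positivity))
      convert h9 using 1
      module
    have h10 := (hs σ hσA).negEnt_sub_le_log hV hp0 hv hdom
    have h11 := hx σ hσA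
    rw [← hg, Matrix.mul_sub, Matrix.trace_sub, Complex.sub_re]
    linarith
  rw [hΔG] at hstep
  linarith

end WitnessExistence

section EigenvalueCount

variable {ι : Type*} [Fintype ι] [DecidableEq ι]

/-- The type of a pair of multi-indices: how often each pair of single indices occurs. -/
def pairType {k : ℕ} (ij : (Fin k → ι) × (Fin k → ι)) : ι × ι → Fin (k + 1) := fun p =>
  ⟨(Finset.univ.filter fun t => (ij.1 t, ij.2 t) = p).card,
    Nat.lt_succ_of_le ((Finset.card_le_univ _).trans (Fintype.card_fin k).le)⟩

theorem exists_perm_of_card_fiber_eq {α β : Type*} [Fintype α] [DecidableEq β]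
    {f g : α → β}
    (h : ∀ b, (Finset.univ.filter fun a => f a = b).card =
      (Finset.univ.filter fun a => g a = b).card) :
    ∃ π : Equiv.Perm α, g ∘ π = f := by
  have e : ∀ b, {a // f a = b} ≃ {a // g a = b} := fun b =>
    Fintype.equivOfCardEq (by rw [Fintype.card_subtype, Fintype.card_subtype, h b])
  refine ⟨((Equiv.sigmaFiberEquiv f).symm.trans (Equiv.sigmaCongrRight e)).trans
    (Equiv.sigmaFiberEquiv g), ?_⟩
  ext a
  exact (e (f a) ⟨a, rfl⟩).2

theorem apply_eq_of_pairType_eq {k : ℕ} {M : MatN ι k} (hM : ∀ π, permCopies π M = M)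
    {ij kl : (Fin k → ι) × (Fin k → ι)} (h : pairType ij = pairType kl) :
    M ij.1 ij.2 = M kl.1 kl.2 := by
  obtain ⟨π, hπ⟩ := exists_perm_of_card_fiber_eq (f := fun t => (ij.1 t, ij.2 t))
    (g := fun t => (kl.1 t, kl.2 t)) fun b => congrArg Fin.val (congrFun h b)
  have h1 : kl.1 ∘ π = ij.1 := by ext t; exact congrArg Prod.fst (congrFun hπ t)
  have h2 : kl.2 ∘ π = ij.2 := by ext t; exact congrArg Prod.snd (congrFun hπ t)
  rw [← h1, ← h2]
  exact congrFun (congrFun (hM π) kl.1) kl.2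

/-- Linearly independent permutation-invariant operators are polynomially few. -/
theorem card_le_of_linearIndependent {k : ℕ} {α : Type*} [Fintype α] {v : α → MatN ι k}
    (hv : LinearIndependent ℂ v) (hinv : ∀ a π, permCopies π (v a) = v a) :
    Fintype.card α ≤ (k + 1) ^ (Fintype.card ι * Fintype.card ι) := by
  let Φ : ((ι × ι → Fin (k + 1)) → ℂ) →ₗ[ℂ] MatN ι k :=
    { toFun := fun g i j => g (pairType (i, j))
      map_add' := fun _ _ => rfl
      map_smul' := fun _ _ => rfl }
  have hg : ∀ a, ∃ g : (ι × ι → Fin (k + 1)) → ℂ, Φ g = v a := fun a => by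
    refine ⟨fun c => if h : ∃ ij : (Fin k → ι) × (Fin k → ι), pairType ij = c then
      v a h.choose.1 h.choose.2 else 0, ?_⟩
    ext i j
    have h : ∃ ij : (Fin k → ι) × (Fin k → ι), pairType ij = pairType (i, j) := ⟨(i, j), rfl⟩
    change (dite _ _ _ : ℂ) = _
    rw [dif_pos h]
    exact apply_eq_of_pairType_eq (hinv a) h.choose_spec
  choose g hg using hg
  have hli : LinearIndependent ℂ g := by
    refine LinearIndependent.of_comp Φ ?_
    have : Φ ∘ g = v := funext hg
    rwa [this]
  have := hli.fintype_card_le_finrank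
  rw [Module.finrank_fintype_fun_eq_card] at this
  simpa using this

theorem permCopies_smul {n : ℕ} (π : Equiv.Perm (Fin n)) (c : ℂ) (M : MatN ι n) :
    permCopies π (c • M) = c • permCopies π M := rfl

theorem permCopies_sum {n : ℕ} {α : Type*} (s : Finset α) (π : Equiv.Perm (Fin n))
    (f : α → MatN ι n) : permCopies π (∑ a ∈ s, f a) = ∑ a ∈ s, permCopies π (f a) := by
  ext i j
  simp only [permCopies, Matrix.sum_apply]

theorem permCopies_pow {n : ℕ} (π : Equiv.Perm (Fin n)) (M : MatN ι n) (l : ℕ) :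
    permCopies π (M ^ l) = permCopies π M ^ l := by
  induction l with
  | zero => simp [permCopies_one]
  | succ l ih => rw [pow_succ, permCopies_mul, ih, pow_succ]

theorem card_image_eigenvalues_le {k : ℕ} {U : MatN ι k} {q : (Fin k → ι) → ℝ} (hU : IsUni U)
    (hinv : ∀ π, permCopies π (spec U q) = spec U q) :
    (Finset.univ.image q).card ≤ (k + 1) ^ (Fintype.card ι * Fintype.card ι) := by
  have hli : LinearIndependent ℂ fun c : ↥(Finset.univ.image q) => eigenProj U q c := by
    rw [Fintype.linearIndependent_iff]
    intro b hb c
    have h1 := congrArg (fun M => M * eigenProj U q c) hb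
    simp only [Finset.sum_mul, Matrix.smul_mul, eigenProj_mul hU, Matrix.zero_mul, smul_ite,
      smul_zero] at h1
    rw [Finset.sum_eq_single c (fun b _ hbc => by
      rw [if_neg]; exact fun h => hbc (Subtype.ext h)) (by simp), if_pos rfl] at h1
    obtain ⟨i, -, hi⟩ := Finset.mem_image.1 c.2
    have h2 : (eigenProj U q c).trace ≠ 0 := by
      rw [eigenProj, trace_spec hU]
      have : 0 < ∑ a, (if q a = (c : ℝ) then (1 : ℝ) else 0) :=
        Finset.sum_pos' (fun a _ => by split_ifs <;> norm_num) ⟨i, Finset.mem_univ i, by simp [hi]⟩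
      exact_mod_cast this.ne'
    rcases smul_eq_zero.1 h1 with h | h
    · exact h
    · rw [h, Matrix.trace_zero] at h2; exact absurd rfl h2
  have := card_le_of_linearIndependent hli fun c π => by
    obtain ⟨m, a, ha⟩ := exists_spec_comp_eq_sum_pow hU q fun y => if y = c then 1 else 0
    have h3 : eigenProj U q c = ∑ l ∈ Finset.range m, a l • spec U q ^ l := ha
    rw [h3]
    simp only [permCopies_sum, permCopies_smul, permCopies_pow, hinv]
  simpa using this

end EigenvalueCount

section SequentialTest

variable {ι : Type*} [Fintype ι] [DecidableEq ι]

/-- Existence of a test with type I errors at most `ε` and type II errors at most `b`. -/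
def HasTest {κ : Type*} [Fintype κ] [DecidableEq κ] (A B : Set (Matrix κ κ ℂ)) (ε b : ℝ) : Prop :=
  ∃ E : Matrix κ κ ℂ, E.PosSemidef ∧ (1 - E).PosSemidef ∧
    (∀ ρ ∈ A, (ρ * (1 - E)).trace.re ≤ ε) ∧ ∀ σ ∈ B, (σ * E).trace.re ≤ b

theorem trace_mul_im_eq_zero {κ : Type*} [Fintype κ] {A B : Matrix κ κ ℂ} (hA : A.IsHermitian)
    (hB : B.IsHermitian) : (A * B).trace.im = 0 := by
  have h : star (A * B).trace = (A * B).trace := by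
    rw [← Matrix.trace_conjTranspose, Matrix.conjTranspose_mul, hA.eq, hB.eq,
      Matrix.trace_mul_comm]
  exact Complex.conj_eq_iff_im.1 h

/-- The number of copies occupied by `r` idle copies and `m` blocks of size `k`. -/
def blockLen (r k : ℕ) : ℕ → ℕ
  | 0 => r
  | m + 1 => blockLen r k m + k

theorem blockLen_eq (r k m : ℕ) : blockLen r k m = r + k * m := by
  induction m with
  | zero => rfl
  | succ m ih => rw [blockLen, ih]; ring

/-- The test accepting when the sum of the outcomes `g` over `m` blocks is at least `t`. -/
def seqTest {k : ℕ} (r : ℕ) (W : MatN ι k) (g : (Fin k → ι) → ℝ) :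
    (m : ℕ) → ℝ → MatN ι (blockLen r k m)
  | 0, t => if t ≤ 0 then 1 else 0
  | m + 1, t => ∑ x, tensorMul (seqTest r W g m (t - g x)) (spec W (Pi.single x 1))

/-- The operator `1 ⊗ F ⊗ ⋯ ⊗ F`. -/
def seqFilter {k : ℕ} (r : ℕ) (F : MatN ι k) : (m : ℕ) → MatN ι (blockLen r k m)
  | 0 => 1
  | m + 1 => tensorMul (seqFilter r F m) F

theorem spec_single_posSemidef {κ : Type*} [Fintype κ] [DecidableEq κ] (W : Matrix κ κ ℂ) (x : κ) :
    (spec W (Pi.single x 1)).PosSemidef :=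
  spec_posSemidef W fun a => by by_cases ha : a = x <;> simp [ha]

theorem sum_spec_single {κ : Type*} [Fintype κ] [DecidableEq κ] {W : Matrix κ κ ℂ}
    (hW : IsUni W) : ∑ x, spec W (Pi.single x 1) = 1 := by
  have := spec_eq_sum_single W fun _ => 1
  rw [spec_one hW] at this
  simpa using this.symm

theorem one_sub_sum_tensorMul_spec_single {n k : ℕ} {W : MatN ι k} (hW : IsUni W)
    (T : (Fin k → ι) → MatN ι n) : 1 - ∑ x, tensorMul (T x) (spec W (Pi.single x 1)) =
      ∑ x, tensorMul (1 - T x) (spec W (Pi.single x 1)) := by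
  simp only [tensorMul_sub_left, Finset.sum_sub_distrib, ← tensorMul_sum_right, sum_spec_single hW,
    tensorMul_one_one]

theorem seqTest_posSemidef {k r : ℕ} (W : MatN ι k) (g : (Fin k → ι) → ℝ) (m : ℕ) (t : ℝ) :
    (seqTest r W g m t).PosSemidef := by
  induction m generalizing t with
  | zero =>
    rw [seqTest]; split_ifs
    · exact Matrix.PosSemidef.one
    · exact Matrix.PosSemidef.zero
  | succ m ih =>
    exact Matrix.posSemidef_sum _ fun x _ => tensorMul_posSemidef (ih _) (spec_single_posSemidef W x)

theorem one_sub_seqTest_posSemidef {k r : ℕ} {W : MatN ι k} (hW : IsUni W)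
    (g : (Fin k → ι) → ℝ) (m : ℕ) (t : ℝ) : (1 - seqTest r W g m t).PosSemidef := by
  induction m generalizing t with
  | zero =>
    rw [seqTest]; split_ifs
    · simpa using Matrix.PosSemidef.zero
    · simpa using Matrix.PosSemidef.one
  | succ m ih =>
    have h := one_sub_sum_tensorMul_spec_single hW fun x => seqTest r W g m (t - g x)
    suffices H : (1 - ∑ x, tensorMul (seqTest r W g m (t - g x))
      (spec W (Pi.single x 1))).PosSemidef from H
    rw [h]
    exact Matrix.posSemidef_sum _ fun x _ => tensorMul_posSemidef (ih _) (spec_single_posSemidef W x)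

theorem trace_tensorPow_mul_tensorMul_re {n k : ℕ} {σ : MatC ι} (hσ : IsState σ) {X : MatN ι n}
    {Y : MatN ι k} (hX : X.IsHermitian) :
    (tensorPow σ (n + k) * tensorMul X Y).trace.re =
      (tensorPow σ n * X).trace.re * (tensorPow σ k * Y).trace.re := by
  rw [tensorPow_add, tensorMul_mul, trace_tensorMul, Complex.mul_re,
    trace_mul_im_eq_zero (tensorPow_isState hσ n).1.1 hX, zero_mul, sub_zero]

theorem trace_tensorPow_mul_seqTest_le {k r : ℕ} (W : MatN ι k) (g : (Fin k → ι) → ℝ)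
    {σ : MatC ι} (hσ : IsState σ) {b : ℝ} (hb : 0 ≤ b)
    (h : (tensorPow σ k * spec W (fun x => Real.exp (g x))).trace.re ≤ b) (m : ℕ) (t : ℝ) :
    (tensorPow σ (blockLen r k m) * seqTest r W g m t).trace.re ≤ Real.exp (-t) * b ^ m := by
  induction m generalizing t with
  | zero =>
    rw [seqTest]; split_ifs with ht
    · have : 1 ≤ Real.exp (-t) := Real.one_le_exp (by linarith)
      simpa [(tensorPow_isState hσ _).2] using this
    · simpa using (Real.exp_pos _).le
  | succ m ih =>
    have h1 : (tensorPow σ (blockLen r k (m + 1)) * seqTest r W g (m + 1) t).trace.re =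
        ∑ x, (tensorPow σ (blockLen r k m) * seqTest r W g m (t - g x)).trace.re *
          (tensorPow σ k * spec W (Pi.single x 1)).trace.re := by
      change (tensorPow σ (blockLen r k m + k) *
        ∑ x, tensorMul (seqTest r W g m (t - g x)) (spec W (Pi.single x 1))).trace.re = _
      rw [Matrix.mul_sum, Matrix.trace_sum, Complex.re_sum]
      exact Finset.sum_congr rfl fun x _ =>
        trace_tensorPow_mul_tensorMul_re hσ (seqTest_posSemidef W g m _).1
    have h2 : (tensorPow σ k * spec W (fun x => Real.exp (g x))).trace.re =
        ∑ x, Real.exp (g x) * (tensorPow σ k * spec W (Pi.single x 1)).trace.re := by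
      rw [spec_eq_sum_single, Matrix.mul_sum, Matrix.trace_sum, Complex.re_sum]
      exact Finset.sum_congr rfl fun x _ => by
        rw [Matrix.mul_smul, Matrix.trace_smul, smul_eq_mul, Complex.re_ofReal_mul]
    rw [h1]
    calc _ ≤ ∑ x, Real.exp (-(t - g x)) * b ^ m *
          (tensorPow σ k * spec W (Pi.single x 1)).trace.re :=
          Finset.sum_le_sum fun x _ => mul_le_mul_of_nonneg_right (ih _)
            (PosSemidef.trace_mul_re_nonneg (tensorPow_isState hσ k).1 (spec_single_posSemidef W x))
      _ = Real.exp (-t) * b ^ m * ∑ x, Real.exp (g x) *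
          (tensorPow σ k * spec W (Pi.single x 1)).trace.re := by
          rw [Finset.mul_sum]
          refine Finset.sum_congr rfl fun x _ => ?_
          rw [neg_sub, sub_eq_add_neg, Real.exp_add]; ring
      _ ≤ Real.exp (-t) * b ^ m * b := by
          rw [← h2]
          exact mul_le_mul_of_nonneg_left h (by positivity)
      _ = _ := by ring

theorem exp_neg_le_exp_sq_mul {u : ℝ} (hu : |u| ≤ 1 / 2) :
    Real.exp (-u) ≤ Real.exp (2 * u ^ 2) * (1 - u) := by
  have h1 := Real.abs_exp_sub_one_sub_id_le (x := -u) (by rw [abs_neg]; linarith)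
  have h2 := (abs_le.1 h1).2
  have h3 := Real.add_one_le_exp (2 * u ^ 2)
  have h4 := (abs_le.1 hu).2
  nlinarith [sq_nonneg u]

theorem seqFilter_posSemidef {k : ℕ} (r : ℕ) {F : MatN ι k} (hF : F.PosSemidef) (m : ℕ) :
    (seqFilter r F m).PosSemidef := by
  induction m with
  | zero => exact Matrix.PosSemidef.one
  | succ m ih => exact tensorMul_posSemidef ih hF

theorem one_sub_seqTest_le {k r : ℕ} {W : MatN ι k} (hW : IsUni W) {g : (Fin k → ι) → ℝ}
    {b η : ℝ} (hg : ∀ x, |g x| ≤ b) (hη : 0 ≤ η) (hηb : η * b ≤ 1 / 2) (m : ℕ) (t : ℝ) :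
    (Real.exp (η * t + m * (2 * (η * b) ^ 2)) • seqFilter r (spec W fun x => 1 - η * g x) m -
      (1 - seqTest r W g m t)).PosSemidef := by
  have habs : ∀ x, |η * g x| ≤ η * b := fun x => by
    rw [abs_mul, abs_of_nonneg hη]; exact mul_le_mul_of_nonneg_left (hg x) hη
  have hF : (spec W fun x => 1 - η * g x).PosSemidef := spec_posSemidef W fun x => by
    linarith [(abs_le.1 (habs x)).2]
  induction m generalizing t with
  | zero =>
    rw [seqTest, seqFilter]; split_ifs with ht
    · simpa using (Matrix.PosSemidef.one (n := Fin (blockLen r k 0) → ι) (R := ℂ)).smul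
        (Real.exp_pos (η * t)).le
    · have h1 : (0 : ℝ) ≤ Real.exp (η * t) - 1 := by
        have := Real.one_le_exp (mul_nonneg hη (not_le.1 ht).le)
        linarith
      convert (Matrix.PosSemidef.one (n := Fin (blockLen r k 0) → ι) (R := ℂ)).smul h1 using 1
      simp only [Nat.cast_zero, zero_mul, add_zero, sub_zero]
      module
  | succ m ih =>
    set Q := seqFilter r (spec W fun x => 1 - η * g x) m
    have hQ : Q.PosSemidef := seqFilter_posSemidef r hF m
    set e : ℝ := Real.exp (η * t + ((m + 1 : ℕ) : ℝ) * (2 * (η * b) ^ 2))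
    have h1 : e • tensorMul Q (spec W fun x => 1 - η * g x) =
        ∑ x, tensorMul ((e * (1 - η * g x)) • Q) (spec W (Pi.single x 1)) := by
      rw [spec_eq_sum_single, tensorMul_sum_right, Finset.smul_sum]
      refine Finset.sum_congr rfl fun x _ => ?_
      rw [tensorMul_smul_right, ← Complex.coe_smul, ← Complex.coe_smul, tensorMul_smul_left,
        smul_smul]
      push_cast; rfl
    have h0 := one_sub_sum_tensorMul_spec_single hW fun x => seqTest r W g m (t - g x)
    suffices H : (e • tensorMul Q (spec W fun x => 1 - η * g x) -
      (1 - ∑ x, tensorMul (seqTest r W g m (t - g x)) (spec W (Pi.single x 1)))).PosSemidef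
      from H
    rw [h1, h0, ← Finset.sum_sub_distrib]
    refine Matrix.posSemidef_sum _ fun x _ => ?_
    rw [← tensorMul_sub_left]
    refine tensorMul_posSemidef ?_ (spec_single_posSemidef W x)
    have h2 : Real.exp (η * (t - g x) + m * (2 * (η * b) ^ 2)) ≤ e * (1 - η * g x) := by
      have h3 := exp_neg_le_exp_sq_mul ((habs x).trans hηb)
      have h4 : 2 * (η * g x) ^ 2 ≤ 2 * (η * b) ^ 2 := by
        have := sq_le_sq' (by linarith [(abs_le.1 (habs x)).1]) (abs_le.1 (habs x)).2
        linarith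
      have h5 : (0 : ℝ) ≤ 1 - η * g x := by linarith [(abs_le.1 (habs x)).2]
      calc Real.exp (η * (t - g x) + m * (2 * (η * b) ^ 2)) =
            Real.exp (η * t + m * (2 * (η * b) ^ 2)) * Real.exp (-(η * g x)) := by
            rw [← Real.exp_add]; congr 1; ring
        _ ≤ Real.exp (η * t + m * (2 * (η * b) ^ 2)) *
            (Real.exp (2 * (η * b) ^ 2) * (1 - η * g x)) :=
            mul_le_mul_of_nonneg_left (h3.trans (mul_le_mul_of_nonneg_right
              (Real.exp_le_exp.2 h4) h5)) (Real.exp_pos _).le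
        _ = e * (1 - η * g x) := by
            rw [← mul_assoc, ← Real.exp_add]
            congr 2; push_cast; ring
    have h6 := (hQ.smul (sub_nonneg.2 h2)).add (ih (t - g x))
    convert h6 using 1
    module

theorem reindex_mem {A : ∀ n : ℕ, Set (MatN ι n)} (hQIII : AxiomQIII A) {n m : ℕ} (h : n = m)
    (e : Fin n ≃ Fin m) {ρ : MatN ι n} (hρ : ρ ∈ A n) :
    (fun i j => ρ (i ∘ e) (j ∘ e) : MatN ι m) ∈ A m := by
  subst h
  exact hQIII n ρ hρ e

theorem exists_marginal_mem {A : ∀ n : ℕ, Set (MatN ι n)} (hs : ∀ n, ∀ ρ ∈ A n, IsState ρ)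
    (hQIII : AxiomQIII A) (hQIV : AxiomQIV A) {n k : ℕ} (hn : 1 ≤ n) (hk : 1 ≤ k)
    {ρ : MatN ι (n + k)} (hρ : ρ ∈ A (n + k)) :
    ∃ ω ∈ A k, ∀ F : MatN ι k, (ρ * tensorMul 1 F).trace = (ω * F).trace := by
  set ρ' : MatN ι (k + n) := fun i j => ρ (i ∘ finAddFlip) (j ∘ finAddFlip) with hρ'
  have hmem : ρ' ∈ A (k + n) := reindex_mem hQIII (add_comm n k) finAddFlip hρ
  obtain ⟨V, hV, h⟩ := hQIV n hn
  obtain ⟨lam, ω, -, hω, hred⟩ := h 1 (mem_of_mem_nhds hV) Matrix.isHermitian_one k hk ρ' hmem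
  have htr : ∀ F, (ρ' * tensorMul F 1).trace = lam * (ω * F).trace := fun F => by
    rw [trace_mul_tensorMul, hred, Matrix.smul_mul, Matrix.trace_smul, smul_eq_mul]
  have hlam : (lam : ℂ) = 1 := by
    have := htr 1
    rw [tensorMul_one_one, Matrix.mul_one, Matrix.mul_one, (hs _ _ hmem).2, (hs _ _ hω).2,
      mul_one] at this
    exact this.symm
  refine ⟨ω, hω, fun F => ?_⟩
  rw [← one_mul (ω * F).trace, ← hlam, ← htr]
  set e : (Fin (k + n) → ι) ≃ (Fin (n + k) → ι) :=
    (finAddFlip (m := n) (n := k)).symm.arrowCongr (Equiv.refl ι)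
  have h1 : ρ' = ρ.submatrix e e := rfl
  have h2 : tensorMul F (1 : MatN ι n) = (tensorMul (1 : MatN ι n) F).submatrix e e := by
    ext i j
    simp only [tensorMul, Matrix.submatrix_apply]
    rw [mul_comm]
    have hl : ∀ i : Fin (k + n) → ι, (fun t => e i (Fin.castAdd k t)) =
        fun t => i (Fin.natAdd k t) := fun i => by
      funext t; simp [e, Equiv.arrowCongr]
    have hr : ∀ i : Fin (k + n) → ι, (fun t => e i (Fin.natAdd n t)) =
        fun t => i (Fin.castAdd n t) := fun i => by
      funext t; simp [e, Equiv.arrowCongr]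
    rw [hl, hl, hr, hr]
  rw [h1, h2, Matrix.submatrix_mul_equiv]
  set M : MatN ι (n + k) := ρ * tensorMul 1 F with hM
  exact (Equiv.sum_comp e fun i => M i i).symm

theorem trace_mul_seqFilter_le {A : ∀ n : ℕ, Set (MatN ι n)} (hs : ∀ n, ∀ ρ ∈ A n, IsState ρ)
    {k r : ℕ} (hr : 1 ≤ r) {F : MatN ι k}
    (hF : ∀ n : ℕ, 1 ≤ n → ∀ ρ ∈ A (n + k), ∃ (lam : ℝ) (ω : MatN ι n), 0 ≤ lam ∧ lam ≤ 1 ∧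
      ω ∈ A n ∧ condReduce ρ F = (lam : ℂ) • ω) (m : ℕ) :
    ∀ ρ ∈ A (blockLen r k m), (ρ * seqFilter r F m).trace.re ≤ 1 := by
  induction m with
  | zero =>
    intro ρ hρ
    rw [seqFilter, Matrix.mul_one, (hs _ ρ hρ).2, Complex.one_re]
  | succ m ih =>
    intro ρ hρ
    obtain ⟨lam, ω, h0, h1, hω, h⟩ := hF (blockLen r k m)
      (by rw [blockLen_eq]; omega) ρ hρ
    have h2 : (ρ * seqFilter r F (m + 1)).trace = lam * (ω * seqFilter r F m).trace := by
      have h3 := trace_mul_tensorMul (n := blockLen r k m) (k := k) ρ (seqFilter r F m) F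
      rw [h, Matrix.smul_mul, Matrix.trace_smul, smul_eq_mul] at h3
      exact h3
    rw [h2, Complex.re_ofReal_mul]
    nlinarith [ih ω hω]

end SequentialTest

section BlockTest

variable {ι : Type*} [Fintype ι] [DecidableEq ι]

theorem exists_hasTest_blockLen {A : ∀ n : ℕ, Set (MatN ι n)} (hs : ∀ n, ∀ ρ ∈ A n, IsState ρ)
    (hQIII : AxiomQIII A) (hQIV : AxiomQIV A) {C : Set (MatC ι)} (hC : ∀ σ ∈ C, IsState σ)
    {k : ℕ} (hk : 1 ≤ k) {W : MatN ι k} (hW : IsUni W) {g : (Fin k → ι) → ℝ}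
    (hg : ∀ ω ∈ A k, 0 ≤ (ω * spec W g).trace.re) {K : ℝ} (hK : 0 ≤ K)
    (hσ : ∀ σ ∈ C, (tensorPow σ k * spec W fun x => Real.exp (g x)).trace.re ≤ K)
    {ε : ℝ} (hε : 0 < ε) :
    ∃ m₀ : ℕ, ∀ r, 1 ≤ r → ∀ m, m₀ ≤ m →
      HasTest (A (blockLen r k m)) (iidSet C (blockLen r k m)) ε (Real.exp m * K ^ m) := by
  obtain ⟨V, hV, hcond⟩ := hQIV k hk
  set b : ℝ := ∑ x, |g x| with hb
  have hgb : ∀ x, |g x| ≤ b := fun x =>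
    Finset.single_le_sum (f := fun x => |g x|) (fun _ _ => abs_nonneg _) (Finset.mem_univ x)
  have hb0 : 0 ≤ b := Finset.sum_nonneg fun _ _ => abs_nonneg _
  have hFeq : ∀ η : ℝ, spec W (fun x => 1 - η * g x) = 1 - (η : ℂ) • spec W g := fun η => by
    rw [← spec_one hW, ← spec_smul, ← spec_sub]
  have hcont : Tendsto (fun η : ℝ => (1 : MatN ι k) - (η : ℂ) • spec W g) (𝓝 0) (𝓝 1) := by
    have : Continuous fun η : ℝ => (1 : MatN ι k) - (η : ℂ) • spec W g := by fun_prop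
    simpa using this.tendsto 0
  have hev : ∀ᶠ η : ℝ in 𝓝[>] 0, (1 : MatN ι k) - (η : ℂ) • spec W g ∈ V ∧
      η * b ≤ 1 / 2 ∧ 2 * η * b ^ 2 ≤ 1 / 2 ∧ 0 < η := by
    refine Eventually.and (nhdsWithin_le_nhds (hcont hV)) (.and ?_ (.and ?_ self_mem_nhdsWithin))
    · have : Tendsto (fun η : ℝ => η * b) (𝓝 0) (𝓝 0) := by
        have h : Continuous fun η : ℝ => η * b := by fun_prop
        simpa using h.tendsto 0
      exact nhdsWithin_le_nhds (this.eventually_le_const (by norm_num))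
    · have : Tendsto (fun η : ℝ => 2 * η * b ^ 2) (𝓝 0) (𝓝 0) := by
        have h : Continuous fun η : ℝ => 2 * η * b ^ 2 := by fun_prop
        simpa using h.tendsto 0
      exact nhdsWithin_le_nhds (this.eventually_le_const (by norm_num))
  obtain ⟨η, hηV, hη1, hη2, hη⟩ := hev.exists
  rw [← hFeq] at hηV
  have hF : ∀ n : ℕ, 1 ≤ n → ∀ ρ ∈ A (n + k), ∃ (lam : ℝ) (ω : MatN ι n), 0 ≤ lam ∧ lam ≤ 1 ∧
      ω ∈ A n ∧ condReduce ρ (spec W fun x => 1 - η * g x) = (lam : ℂ) • ω := by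
    intro n hn ρ hρ
    obtain ⟨lam, ω, h0, hω, h⟩ := hcond _ hηV (spec_isHermitian _ _) n hn ρ hρ
    refine ⟨lam, ω, h0, ?_, hω, h⟩
    obtain ⟨ω', hω', h'⟩ := exists_marginal_mem hs hQIII hQIV hn hk hρ
    have h1 := trace_mul_tensorMul ρ 1 (spec W fun x => 1 - η * g x)
    rw [h, h', Matrix.mul_one, Matrix.trace_smul, (hs _ _ hω).2, hFeq, Matrix.mul_sub,
      Matrix.mul_one, Matrix.trace_sub, (hs _ _ hω').2, Matrix.mul_smul, Matrix.trace_smul] at h1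
    have h2 := congrArg Complex.re h1
    simp only [smul_eq_mul, Complex.sub_re, Complex.one_re, Complex.re_ofReal_mul, mul_one,
      Complex.ofReal_re] at h2
    have := mul_nonneg hη.le (hg ω' hω')
    linarith
  have hlim : Tendsto (fun m : ℕ => Real.exp (-((η / 2) * m))) atTop (𝓝 0) :=
    Real.tendsto_exp_neg_atTop_nhds_zero.comp
      (tendsto_natCast_atTop_atTop.const_mul_atTop (by positivity))
  obtain ⟨m₀, hm₀⟩ := eventually_atTop.1 (hlim.eventually_le_const hε)
  refine ⟨m₀, fun r hr m hm => ⟨seqTest r W g m (-m), seqTest_posSemidef _ _ _ _,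
    one_sub_seqTest_posSemidef hW _ _ _, fun ρ hρ => ?_, ?_⟩⟩
  · have h1 := trace_mul_re_mono_right (hs _ ρ hρ).1
      (one_sub_seqTest_le (r := r) hW hgb hη.le hη1 m (-m))
    refine h1.trans (le_trans ?_ (hm₀ m hm))
    rw [Matrix.mul_smul, Matrix.trace_smul, Complex.smul_re, smul_eq_mul]
    calc _ ≤ Real.exp (η * -m + m * (2 * (η * b) ^ 2)) * 1 :=
          mul_le_mul_of_nonneg_left (trace_mul_seqFilter_le hs hr hF m ρ hρ) (Real.exp_pos _).le
      _ ≤ _ := by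
          rw [mul_one]
          refine Real.exp_le_exp.2 ?_
          have : (m : ℝ) * η * (2 * η * b ^ 2) ≤ m * η * (1 / 2) :=
            mul_le_mul_of_nonneg_left hη2 (by positivity)
          nlinarith
  · rintro _ ⟨σ, hσC, rfl⟩
    have := trace_tensorPow_mul_seqTest_le (r := r) W g (hC σ hσC) hK (hσ σ hσC) m (-m)
    rwa [neg_neg] at this

theorem HasTest.mono {κ : Type*} [Fintype κ] [DecidableEq κ] {A B : Set (Matrix κ κ ℂ)}
    {ε b b' : ℝ} (h : HasTest A B ε b) (hb : b ≤ b') : HasTest A B ε b' := by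
  obtain ⟨E, h1, h2, h3, h4⟩ := h
  exact ⟨E, h1, h2, h3, fun σ hσ => (h4 σ hσ).trans hb⟩

/-- A single block observable separating `A k` from the tensor powers yields tests of all
large lengths, with exponentially small type II error. -/
theorem eventually_hasTest {A : ∀ n : ℕ, Set (MatN ι n)} (hs : ∀ n, ∀ ρ ∈ A n, IsState ρ)
    (hQIII : AxiomQIII A) (hQIV : AxiomQIV A) {C : Set (MatC ι)} (hC : ∀ σ ∈ C, IsState σ)
    {k : ℕ} (hk : 1 ≤ k) {W : MatN ι k} (hW : IsUni W) {g : (Fin k → ι) → ℝ} {a K y : ℝ}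
    (hg : ∀ ω ∈ A k, a ≤ (ω * spec W g).trace.re) (hK : 0 < K)
    (hσ : ∀ σ ∈ C, (tensorPow σ k * spec W fun x => Real.exp (g x)).trace.re ≤ K)
    (hy : 0 ≤ y) (hya : k * y ≤ a - Real.log K - 1) {ε : ℝ} (hε : 0 < ε) :
    ∀ᶠ n in atTop, HasTest (A n) (iidSet C n) ε (Real.exp (-(((n : ℝ) - k) * y))) := by
  obtain ⟨m₀, hm₀⟩ := exists_hasTest_blockLen (g := fun x => g x - a) (K := K * Real.exp (-a))
    hs hQIII hQIV hC hk hW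
    (fun ω hω => by
      have h1 : spec W (fun x => g x - a) = spec W g - (a : ℂ) • 1 := by
        rw [← spec_one hW, ← spec_smul, ← spec_sub]; simp
      rw [h1, Matrix.mul_sub, Matrix.mul_smul, Matrix.mul_one, Matrix.trace_sub,
        Matrix.trace_smul, (hs _ _ hω).2]
      simpa using hg ω hω) (by positivity)
    (fun σ hσC => by
      have h1 : (spec W fun x => Real.exp (g x - a)) =
          (Real.exp (-a) : ℂ) • spec W fun x => Real.exp (g x) := by
        rw [← spec_smul]
        congr 1; funext x; rw [← Real.exp_add]; ring_nf
      rw [h1, Matrix.mul_smul, Matrix.trace_smul, mul_comm K]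
      simpa [← Complex.ofReal_exp, ← Complex.ofReal_neg] using
        mul_le_mul_of_nonneg_left (hσ σ hσC) (Real.exp_pos (-a)).le) hε
  filter_upwards [eventually_ge_atTop (k * m₀ + 1)] with n hn
  have hkm : m₀ ≤ (n - 1) / k := by
    rw [Nat.le_div_iff_mul_le (by omega), mul_comm]; omega
  have h1 := hm₀ ((n - 1) % k + 1) (by omega) _ hkm
  have hlen : blockLen ((n - 1) % k + 1) k ((n - 1) / k) = n := by
    rw [blockLen_eq]
    have := Nat.mod_add_div (n - 1) k
    omega
  set m := (n - 1) / k
  rw [hlen] at h1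
  refine h1.mono ?_
  have hnk : (n : ℝ) - k ≤ m * k := by
    have h2 := Nat.mod_lt (n - 1) (show 0 < k by omega)
    have h3 : n ≤ k + k * m := by rw [blockLen_eq] at hlen; omega
    have h4 : (n : ℝ) ≤ k + k * m := by exact_mod_cast h3
    linarith
  have h5 : Real.exp m * (K * Real.exp (-a)) ^ m = Real.exp (m * (1 + Real.log K - a)) := by
    conv_lhs => rw [← Real.exp_log hK]
    rw [← Real.exp_add, ← Real.exp_nat_mul, ← Real.exp_add]
    congr 1; ring
  rw [h5, Real.exp_le_exp]
  have h6 := mul_le_mul_of_nonneg_right hnk hy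
  have h7 := mul_le_mul_of_nonneg_left hya (Nat.cast_nonneg (α := ℝ) m)
  nlinarith

end BlockTest

section Multilinear

theorem multilinearMap_le_of_mem_convexHull {V : Type*} [AddCommGroup V] [Module ℝ V] {n : ℕ}
    (φ : MultilinearMap ℝ (fun _ : Fin n => V) ℝ) {B : Set V} {b : ℝ}
    (h : ∀ f : Fin n → V, (∀ k, f k ∈ B) → φ f ≤ b) {f : Fin n → V}
    (hf : ∀ k, f k ∈ convexHull ℝ B) : φ f ≤ b := by
  have key : ∀ s : Finset (Fin n), ∀ f : Fin n → V, (∀ k ∈ s, f k ∈ convexHull ℝ B) →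
      (∀ k ∉ s, f k ∈ B) → φ f ≤ b := by
    intro s
    induction s using Finset.induction_on with
    | empty => exact fun f _ hf => h f fun k => hf k (Finset.notMem_empty k)
    | insert a s ha ih =>
      intro f hf1 hf2
      have hconv : Convex ℝ {x | φ (Function.update f a x) ≤ b} :=
        (convex_Iic b).linear_preimage (φ.toLinearMap f a)
      have hsub : B ⊆ {x | φ (Function.update f a x) ≤ b} := fun x hx => by
        refine ih _ (fun k hk => ?_) fun k hk => ?_
        · rw [Function.update_of_ne (ne_of_mem_of_not_mem hk ha)]
          exact hf1 k (Finset.mem_insert_of_mem hk)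
        · by_cases hka : k = a
          · subst hka; rwa [Function.update_self]
          · rw [Function.update_of_ne hka]
            exact hf2 k (by simp [hka, hk])
      have := convexHull_min hsub hconv (hf1 a (Finset.mem_insert_self a s))
      rwa [Set.mem_ofPred_eq, Function.update_eq_self] at this
  exact key Finset.univ f (fun k _ => hf k) fun k hk => absurd (Finset.mem_univ k) hk

theorem factorial_mul_exp_le (m : ℕ) :
    (m.factorial : ℝ) * Real.exp m ≤ Real.exp 1 * (m + 1) * m ^ m := by
  have hstrong : ∀ m : ℕ, ((m + 1).factorial : ℝ) * Real.exp (m + 1 : ℕ) ≤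
      Real.exp 1 * (m + 1 : ℕ) * ((m + 1 : ℕ) : ℝ) ^ (m + 1) := by
    intro m
    induction m with
    | zero => simp
    | succ m ih =>
      have h1 : Real.exp 1 * ((m + 1 : ℕ) : ℝ) ^ (m + 2) ≤ ((m + 2 : ℕ) : ℝ) ^ (m + 2) := by
        have h := Real.one_sub_div_pow_le_exp_neg (n := m + 2) (t := 1)
          (by push_cast; linarith [(Nat.cast_nonneg m : (0 : ℝ) ≤ m)])
        have h2 : (1 : ℝ) - 1 / ((m + 2 : ℕ) : ℝ) = ((m + 1 : ℕ) : ℝ) / ((m + 2 : ℕ) : ℝ) := by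
          have : ((m + 2 : ℕ) : ℝ) ≠ 0 := by positivity
          field_simp; push_cast; ring
        rw [h2, div_pow, Real.exp_neg, div_le_iff₀ (by positivity)] at h
        calc _ ≤ Real.exp 1 * ((Real.exp 1)⁻¹ * ((m + 2 : ℕ) : ℝ) ^ (m + 2)) :=
              mul_le_mul_of_nonneg_left h (Real.exp_pos 1).le
          _ = _ := by rw [mul_inv_cancel_left₀ (Real.exp_pos 1).ne']
      have h2 : Real.exp ((m + 1 + 1 : ℕ) : ℝ) = Real.exp 1 * Real.exp ((m + 1 : ℕ) : ℝ) := by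
        rw [← Real.exp_add]; push_cast; congr 1; ring
      rw [Nat.factorial_succ, h2]
      calc (((m + 1 + 1) * (m + 1).factorial : ℕ) : ℝ) *
            (Real.exp 1 * Real.exp ((m + 1 : ℕ) : ℝ))
          = (m + 2 : ℕ) * Real.exp 1 * ((m + 1).factorial * Real.exp ((m + 1 : ℕ) : ℝ)) := by
            push_cast; ring
        _ ≤ (m + 2 : ℕ) * Real.exp 1 * (Real.exp 1 * (m + 1 : ℕ) * ((m + 1 : ℕ) : ℝ) ^ (m + 1)) :=
            mul_le_mul_of_nonneg_left ih (by positivity)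
        _ = (m + 2 : ℕ) * Real.exp 1 * (Real.exp 1 * ((m + 1 : ℕ) : ℝ) ^ (m + 2)) := by ring
        _ ≤ (m + 2 : ℕ) * Real.exp 1 * ((m + 2 : ℕ) : ℝ) ^ (m + 2) :=
            mul_le_mul_of_nonneg_left h1 (by positivity)
        _ = _ := by ring
  rcases m with _ | m
  · simp
  · refine (hstrong m).trans ?_
    have : (0 : ℝ) ≤ Real.exp 1 * ((m + 1 : ℕ) : ℝ) ^ (m + 1) := by positivity
    nlinarith

variable {J : Type*} [Fintype J] {n : ℕ}

theorem card_perm_comp_eq_le (w w' : Fin n → J) :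
    (Finset.univ.filter fun π : Equiv.Perm (Fin n) => w ∘ π = w').card ≤
      ∏ j, (Finset.univ.filter fun k => w k = j).card.factorial := by
  have hst : (Finset.univ.filter fun π : Equiv.Perm (Fin n) => w ∘ π = w).card =
      ∏ j, (Finset.univ.filter fun k => w k = j).card.factorial := by
    rw [← Fintype.card_subtype, DomMulAct.stabilizer_card]
    simp only [Fintype.card_subtype]
  rw [← hst]
  rcases (Finset.univ.filter fun π : Equiv.Perm (Fin n) => w ∘ π = w').eq_empty_or_nonempty
    with h | ⟨π₀, h₀⟩
  · rw [h]; simp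
  · refine Finset.card_le_card_of_injOn (fun π => π * π₀⁻¹) (fun π hπ => ?_)
      fun π _ τ _ h => mul_right_cancel h
    simp only [Finset.coe_filter, Finset.mem_univ, true_and, Set.mem_ofPred_eq,
      Finset.mem_filter] at hπ h₀ ⊢
    rw [Equiv.Perm.coe_mul, ← Function.comp_assoc, hπ, ← h₀]
    funext k; simp

/-- Summing over all `v` dominates, up to the size of the stabiliser, summing over products of a
map preserving `w` and a permutation. -/
theorem mul_le_prod_factorial_mul_sum (w : Fin n → J) (H : (Fin n → J) → ℝ)
    (hH : ∀ v, 0 ≤ H v) (hsymm : ∀ v (π : Equiv.Perm (Fin n)), H (v ∘ π) = H v) :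
    ((n.factorial * ∏ j, (Finset.univ.filter fun k => w k = j).card ^
        (Finset.univ.filter fun k => w k = j).card : ℕ) : ℝ) * H w ≤
      ((∏ j, (Finset.univ.filter fun k => w k = j).card.factorial : ℕ) : ℝ) *
        ∑ v : Fin n → Fin n, H (w ∘ v) := by
  set G : Finset (Fin n → Fin n) := Finset.univ.filter fun u => w ∘ u = w with hG
  have hGcard : G.card = ∏ j, (Finset.univ.filter fun k => w k = j).card ^
      (Finset.univ.filter fun k => w k = j).card := by
    have h1 : G = Fintype.piFinset fun k => Finset.univ.filter fun l => w l = w k := by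
      ext u
      simp only [hG, Finset.mem_filter, Finset.mem_univ, true_and, Fintype.mem_piFinset,
        funext_iff, Function.comp_apply]
    rw [h1, Fintype.card_piFinset, ← Finset.prod_fiberwise Finset.univ w]
    refine Finset.prod_congr rfl fun j _ => ?_
    rw [Finset.prod_congr rfl (g := fun _ => (Finset.univ.filter fun k => w k = j).card)
      fun k hk => by rw [(Finset.mem_filter.1 hk).2], Finset.prod_const]
  have h1 : ((n.factorial * G.card : ℕ) : ℝ) * H w =
      ∑ x ∈ G ×ˢ (Finset.univ : Finset (Equiv.Perm (Fin n))), H (w ∘ (x.1 ∘ x.2)) := by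
    rw [Finset.sum_congr rfl (g := fun _ => H w) fun x hx => by
      rw [← Function.comp_assoc, hsymm, (Finset.mem_filter.1 (Finset.mem_product.1 hx).1).2],
      Finset.sum_const, Finset.card_product, Finset.card_univ, Fintype.card_perm,
      Fintype.card_fin, nsmul_eq_mul, mul_comm G.card]
  rw [← hGcard, h1, ← Finset.sum_fiberwise _ fun x : (Fin n → Fin n) × Equiv.Perm (Fin n) =>
    x.1 ∘ x.2, Finset.mul_sum]
  refine Finset.sum_le_sum fun v _ => ?_
  rw [Finset.sum_congr rfl (g := fun _ => H (w ∘ v)) fun x hx => by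
    rw [(Finset.mem_filter.1 hx).2], Finset.sum_const, nsmul_eq_mul]
  refine mul_le_mul_of_nonneg_right ?_ (hH _)
  norm_cast
  refine le_trans (Finset.card_le_card_of_injOn Prod.snd (fun x hx => ?_) ?_)
    (card_perm_comp_eq_le w (w ∘ v))
  · simp only [Finset.coe_filter, Finset.mem_product, Finset.mem_univ, and_true,
      Set.mem_ofPred_eq, Finset.mem_filter, true_and, hG] at hx ⊢
    rw [← hx.2, ← Function.comp_assoc, hx.1]
  · rintro ⟨u, π⟩ hx ⟨u', π'⟩ hx' h
    simp only [Finset.coe_filter, Finset.mem_product, Finset.mem_univ, and_true,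
      Set.mem_ofPred_eq] at hx hx' h
    subst h
    have h2 : u ∘ π = u' ∘ π := hx.2.trans hx'.2.symm
    rw [Prod.mk.injEq]
    exact ⟨π.surjective.injective_comp_right h2, rfl⟩

theorem prod_factorial_mul_pow_le (c : J → ℕ) (hc : ∑ j, c j = n) :
    ((∏ j, (c j).factorial : ℕ) : ℝ) * n ^ n ≤
      (Real.exp 1 * (n + 1)) ^ Fintype.card J * ((n.factorial * ∏ j, c j ^ c j : ℕ) : ℝ) := by
  have h1 : (n : ℝ) ^ n ≤ Real.exp n * n.factorial := by
    have := Real.pow_div_factorial_le_exp n n.cast_nonneg n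
    rwa [div_le_iff₀ (by positivity)] at this
  have h2 : Real.exp n = ∏ j, Real.exp (c j) := by
    rw [← Real.exp_sum, ← hc]; push_cast; rfl
  have h3 : ∏ j, ((c j).factorial * Real.exp (c j) : ℝ) ≤
      ∏ j, (Real.exp 1 * (n + 1) * (c j : ℝ) ^ c j) := by
    refine Finset.prod_le_prod (fun j _ => by positivity) fun j _ =>
      (factorial_mul_exp_le (c j)).trans ?_
    have : (c j : ℝ) ≤ n := by
      rw [← hc]; exact_mod_cast Finset.single_le_sum (fun _ _ => Nat.zero_le _) (Finset.mem_univ j)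
    gcongr
  rw [Finset.prod_mul_distrib, Finset.prod_mul_distrib, Finset.prod_const, Finset.card_univ,
    ← h2] at h3
  push_cast
  calc _ ≤ (∏ j, ((c j).factorial : ℝ)) * (Real.exp n * n.factorial) :=
        mul_le_mul_of_nonneg_left h1 (Finset.prod_nonneg fun _ _ => by positivity)
    _ = ((∏ j, ((c j).factorial : ℝ)) * Real.exp n) * n.factorial := by ring
    _ ≤ _ := mul_le_mul_of_nonneg_right h3 (by positivity)
    _ = _ := by ring

/-- A symmetric multilinear form which is nonnegative on a convex set is controlled, up to a
polynomial factor, by its values on the diagonal. -/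
theorem multilinearMap_comp_le_of_symm {V : Type*} [AddCommGroup V] [Module ℝ V] (hn : 0 < n)
    (φ : MultilinearMap ℝ (fun _ : Fin n => V) ℝ) {C : Set V} (hC : Convex ℝ C)
    (hsymm : ∀ (f : Fin n → V) (π : Equiv.Perm (Fin n)), φ (f ∘ π) = φ f)
    (hnonneg : ∀ f : Fin n → V, (∀ k, f k ∈ C) → 0 ≤ φ f) {b : ℝ}
    (hb : ∀ x ∈ C, φ (fun _ => x) ≤ b) {y : J → V} (hy : ∀ j, y j ∈ C) (w : Fin n → J) :
    φ (y ∘ w) ≤ (Real.exp 1 * (n + 1)) ^ Fintype.card J * b := by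
  have hn' : (0 : ℝ) < n := by exact_mod_cast hn
  set x : V := ∑ k, (n : ℝ)⁻¹ • y (w k) with hx
  have hxC : x ∈ C := hC.sum_mem (fun _ _ => by positivity)
    (by simp [hn'.ne']) fun k _ => hy _
  have hsum : (n : ℝ) ^ n * φ (fun _ => x) = ∑ v : Fin n → Fin n, φ (y ∘ (w ∘ v)) := by
    have h1 : (fun _ : Fin n => x) = fun _ => (n : ℝ)⁻¹ • ∑ k, y (w k) := by
      rw [hx, Finset.smul_sum]
    rw [h1, φ.map_smul_univ (fun _ => (n : ℝ)⁻¹) fun _ => ∑ k, y (w k),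
      φ.map_sum fun _ k => y (w k)]
    simp only [Finset.prod_const, Finset.card_univ, Fintype.card_fin, smul_eq_mul]
    rw [← mul_assoc, ← mul_pow, mul_inv_cancel₀ hn'.ne', one_pow, one_mul]
    rfl
  have h1 := mul_le_prod_factorial_mul_sum w (fun v => φ (y ∘ v)) (fun v => hnonneg _ fun _ => hy _)
    fun v π => by rw [← Function.comp_assoc]; exact hsymm _ π
  have h2 := prod_factorial_mul_pow_le (n := n) (fun j => (Finset.univ.filter fun k => w k = j).card)
    (by simpa using Finset.sum_card_fiberwise_eq_card_filter Finset.univ Finset.univ w)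
  have hb0 : 0 ≤ b := (hnonneg _ fun _ => hxC).trans (hb x hxC)
  rw [← hsum] at h1
  set P : ℕ := ∏ j, (Finset.univ.filter fun k => w k = j).card.factorial
  set Q : ℕ := n.factorial * ∏ j, (Finset.univ.filter fun k => w k = j).card ^
    (Finset.univ.filter fun k => w k = j).card with hQ
  have hQ0 : (0 : ℝ) < Q := by
    have : 0 < Q := Nat.mul_pos n.factorial_pos (Finset.prod_pos fun j _ => by
      rcases Nat.eq_zero_or_pos (Finset.univ.filter fun k => w k = j).card with h | h
      · rw [h]; norm_num
      · exact pow_pos h _)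
    exact_mod_cast this
  refine le_of_mul_le_mul_left ?_ hQ0
  calc (Q : ℝ) * φ (y ∘ w) ≤ P * (n ^ n * φ fun _ => x) := h1
    _ ≤ P * (n ^ n * b) := by gcongr; exact hb x hxC
    _ = P * n ^ n * b := by ring
    _ ≤ _ := mul_le_mul_of_nonneg_right h2 hb0
    _ = _ := by ring

end Multilinear

section ArbitrarilyVarying

variable {ι : Type*} [Fintype ι] [DecidableEq ι] {n : ℕ}

/-- The real multilinear form `f ↦ Re Tr[(f₁ ⊗ ⋯ ⊗ fₙ) E]`. -/
def traceForm (E : MatN ι n) : MultilinearMap ℝ (fun _ : Fin n => MatC ι) ℝ where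
  toFun f := (tensorProdFam f * E).trace.re
  map_update_add' := by
    intro inst f a X Y
    obtain rfl : inst = instDecidableEqFin n := Subsingleton.elim _ _
    have := tensorProdFam_update_sub f a (X + Y) Y
    rw [add_sub_cancel_right] at this
    rw [this, Matrix.sub_mul, Matrix.trace_sub, Complex.sub_re, sub_add_cancel]
  map_update_smul' := by
    intro inst f a c X
    obtain rfl : inst = instDecidableEqFin n := Subsingleton.elim _ _
    have h : Function.update f a (c • X) = fun k => (if k = a then (c : ℂ) else 1) •
        Function.update f a X k := by
      funext k
      by_cases hk : k = a
      · subst hk; simp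
      · simp [hk]
    have h2 : tensorProdFam (Function.update f a (c • X)) =
        (c : ℂ) • tensorProdFam (Function.update f a X) := by
      rw [h, tensorProdFam_smul]; simp
    rw [h2, Matrix.smul_mul, Matrix.trace_smul, smul_eq_mul, Complex.re_ofReal_mul, smul_eq_mul]

theorem traceForm_apply (E : MatN ι n) (f : Fin n → MatC ι) :
    traceForm E f = (tensorProdFam f * E).trace.re := rfl

theorem HasTest.avSet_convexHull {A : Set (MatN ι n)} {B : Set (MatC ι)} {ε b : ℝ}
    (h : HasTest A (avSet B n) ε b) : HasTest A (avSet (convexHull ℝ B) n) ε b := by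
  obtain ⟨E, h1, h2, h3, h4⟩ := h
  refine ⟨E, h1, h2, h3, ?_⟩
  rintro _ ⟨f, hf, rfl⟩
  exact multilinearMap_le_of_mem_convexHull (traceForm E) (fun f hf => h4 _ ⟨f, hf, rfl⟩) hf

theorem HasTest.anti {κ : Type*} [Fintype κ] [DecidableEq κ] {A B B' : Set (Matrix κ κ ℂ)}
    {ε b : ℝ} (h : HasTest A B' ε b) (hB : B ⊆ B') : HasTest A B ε b := by
  obtain ⟨E, h1, h2, h3, h4⟩ := h
  exact ⟨E, h1, h2, h3, fun σ hσ => h4 σ (hB hσ)⟩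

theorem avSet_mono {B B' : Set (MatC ι)} (h : B ⊆ B') : avSet B n ⊆ avSet B' n := by
  rintro _ ⟨f, hf, rfl⟩; exact ⟨f, fun k => h (hf k), rfl⟩

theorem iidSet_subset_avSet (B : Set (MatC ι)) : iidSet B n ⊆ avSet B n := by
  rintro _ ⟨σ, hσ, rfl⟩; exact ⟨fun _ => σ, fun _ => hσ, rfl⟩

theorem trace_mul_permCopies (ρ E : MatN ι n) (π : Equiv.Perm (Fin n)) :
    (ρ * permCopies π E).trace = (permCopies π⁻¹ ρ * E).trace := by
  rw [← trace_permCopies π⁻¹, permCopies_mul, permCopies_permCopies, inv_mul_cancel]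
  rfl

/-- The average of an operator over the permutations of the tensor factors. -/
def symmetrize (E : MatN ι n) : MatN ι n :=
  ((n.factorial : ℝ)⁻¹ : ℝ) • ∑ π : Equiv.Perm (Fin n), permCopies π E

theorem symmetrize_posSemidef {E : MatN ι n} (h : E.PosSemidef) : (symmetrize E).PosSemidef :=
  (Matrix.posSemidef_sum _ fun π _ => permCopies_posSemidef π h).smul (by positivity)

theorem one_sub_symmetrize (E : MatN ι n) : 1 - symmetrize E = symmetrize (1 - E) := by
  simp only [symmetrize, permCopies_sub, permCopies_one, Finset.sum_sub_distrib, smul_sub]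
  congr 1
  rw [Finset.sum_const, Finset.card_univ, Fintype.card_perm, Fintype.card_fin,
    ← Nat.cast_smul_eq_nsmul ℝ, smul_smul, inv_mul_cancel₀ (by positivity), one_smul]

theorem trace_mul_symmetrize_re (ρ E : MatN ι n) : (ρ * symmetrize E).trace.re =
    (n.factorial : ℝ)⁻¹ * ∑ π : Equiv.Perm (Fin n), (permCopies π⁻¹ ρ * E).trace.re := by
  simp only [symmetrize, Matrix.mul_smul, Matrix.trace_smul, Complex.smul_re, smul_eq_mul,
    Matrix.mul_sum, Matrix.trace_sum, Complex.re_sum, trace_mul_permCopies]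

theorem trace_mul_symmetrize_le {ρ E : MatN ι n} {b : ℝ}
    (h : ∀ π : Equiv.Perm (Fin n), (permCopies π ρ * E).trace.re ≤ b) :
    (ρ * symmetrize E).trace.re ≤ b := by
  rw [trace_mul_symmetrize_re, inv_mul_le_iff₀ (by positivity)]
  refine (Finset.sum_le_sum fun π _ => h π⁻¹).trans ?_
  rw [Finset.sum_const, Finset.card_univ, Fintype.card_perm, Fintype.card_fin, nsmul_eq_mul]

theorem permCopies_symmetrize (π : Equiv.Perm (Fin n)) (E : MatN ι n) :
    permCopies π (symmetrize E) = symmetrize E := by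
  change (n.factorial : ℝ)⁻¹ • permCopies π (∑ τ : Equiv.Perm (Fin n), permCopies τ E) = _
  rw [permCopies_sum, symmetrize]
  congr 1
  simp only [permCopies_permCopies]
  exact Equiv.sum_comp (Equiv.mulLeft π) fun τ => permCopies τ E

theorem HasTest.avSet_of_iidSet (hn : 0 < n) {A : Set (MatN ι n)}
    (hA : ∀ ρ ∈ A, ∀ π, permCopies π ρ ∈ A) {C : Set (MatC ι)} (hC : Convex ℝ C)
    (hs : ∀ σ ∈ C, IsState σ) {F : Finset (MatC ι)} (hFC : (F : Set (MatC ι)) ⊆ C) {δ : ℝ}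
    (hδ : 0 ≤ δ) (hF : ∀ σ ∈ C, ∃ y ∈ F, ((1 + δ) • y - σ).PosSemidef) {ε b : ℝ}
    (h : HasTest A (iidSet C n) ε b) :
    HasTest A (avSet C n) ε ((1 + δ) ^ n * ((Real.exp 1 * (n + 1)) ^ F.card * b)) := by
  obtain ⟨E, h1, h2, h3, h4⟩ := h
  have hE := symmetrize_posSemidef h1
  refine ⟨symmetrize E, hE, ?_, fun ρ hρ => ?_, ?_⟩
  · rw [one_sub_symmetrize]; exact symmetrize_posSemidef h2
  · rw [one_sub_symmetrize]
    exact trace_mul_symmetrize_le fun π => h3 _ (hA ρ hρ π)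
  · rintro _ ⟨f, hf, rfl⟩
    choose y hyF hy using fun k => hF (f k) (hf k)
    have hmono := trace_mul_re_mono_left hE
      (tensorProdFam_mono (fun k => (hs _ (hf k)).1) hy)
    refine hmono.trans ?_
    have h5 : (tensorProdFam (fun k => (1 + δ) • y k) * symmetrize E).trace.re =
        (1 + δ) ^ n * traceForm (symmetrize E) y := by
      change traceForm (symmetrize E) (fun k => (1 + δ) • y k) = _
      rw [(traceForm (symmetrize E)).map_smul_univ (fun _ => 1 + δ) y]
      simp
    rw [h5]
    refine mul_le_mul_of_nonneg_left ?_ (by positivity)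
    have h6 := multilinearMap_comp_le_of_symm (J := F) hn (traceForm (symmetrize E)) hC
      (fun f π => ?_) (fun f hf => ?_) (b := b) (fun x hx => ?_) (y := fun j => (j : MatC ι))
      (fun j => hFC j.2) fun k => ⟨y k, hyF k⟩
    · rw [Fintype.card_coe] at h6
      exact h6
    · rw [traceForm_apply, traceForm_apply]
      have : tensorProdFam (f ∘ π) = permCopies π⁻¹ (tensorProdFam f) := by
        rw [permCopies_tensorProdFam]; rfl
      rw [this, ← trace_mul_permCopies, permCopies_symmetrize]
    · exact PosSemidef.trace_mul_re_nonneg (IsState.tensorProdFam fun k => hs _ (hf k)).1 hE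
    · rw [traceForm_apply, ← tensorPow_eq]
      exact trace_mul_symmetrize_le fun π => by
        rw [permCopies_tensorPow]; exact h4 _ ⟨x, hx, rfl⟩

end ArbitrarilyVarying

section Exponents

theorem HasTest.one {κ : Type*} [Fintype κ] [DecidableEq κ] {A B : Set (Matrix κ κ ℂ)}
    (hB : ∀ σ ∈ B, IsState σ) {ε : ℝ} (hε : 0 ≤ ε) : HasTest A B ε 1 :=
  ⟨1, .one, by simpa using Matrix.PosSemidef.zero, fun ρ _ => by simpa using hε,
    fun σ hσ => by simp [(hB σ hσ).2]⟩

theorem hasTest_of_typeII_lt {κ : Type*} [Fintype κ] [DecidableEq κ] {A B : Set (Matrix κ κ ℂ)}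
    (hB : ∀ σ ∈ B, IsState σ) {ε b : ℝ} (hε : 0 ≤ ε) (h : typeII A B ε < b) :
    HasTest A B ε b := by
  obtain ⟨E₀, h₀⟩ := HasTest.one (A := A) hB hε
  rw [typeII] at h
  obtain ⟨_, ⟨E, h1, h2, h3, rfl⟩, h4⟩ := exists_lt_of_csInf_lt
    (by exact ⟨_, E₀, h₀.1, h₀.2.1, h₀.2.2.1, rfl⟩) h
  refine ⟨E, h1, h2, h3, fun σ hσ => h4.le.trans' (le_csSup ?_ ⟨σ, hσ, rfl⟩)⟩
  refine ⟨1, ?_⟩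
  rintro _ ⟨τ, hτ, rfl⟩
  have := trace_mul_re_mono_right (hB τ hτ).1 h2
  simpa [(hB τ hτ).2] using this

theorem HasTest.typeII_le {κ : Type*} [Fintype κ] [DecidableEq κ] {A B : Set (Matrix κ κ ℂ)}
    (hB : ∀ σ ∈ B, IsState σ) (hne : B.Nonempty) {ε b : ℝ} (h : HasTest A B ε b) :
    typeII A B ε ≤ b := by
  obtain ⟨E, h1, h2, h3, h4⟩ := h
  obtain ⟨σ₀, hσ₀⟩ := hne
  rw [typeII]
  refine le_trans (csInf_le ?_ ⟨E, h1, h2, h3, rfl⟩) (csSup_le ⟨_, σ₀, hσ₀, rfl⟩ ?_)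
  · refine ⟨0, ?_⟩
    rintro _ ⟨E', h1', -, -, rfl⟩
    refine Real.sSup_nonneg ?_
    rintro _ ⟨σ, hσ, rfl⟩
    exact PosSemidef.trace_mul_re_nonneg (hB σ hσ).1 h1'
  · rintro _ ⟨σ, hσ, rfl⟩
    exact h4 σ hσ

theorem le_cFrac_mul_negLog {n : ℕ} (hn : 0 < n) {t y : ℝ} (h : t ≤ Real.exp (-(n * y))) :
    (y : EReal) ≤ cFrac n * negLog t := by
  have hn' : (0 : ℝ) < (n : ℝ)⁻¹ := by positivity
  rw [cFrac, negLog]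
  split_ifs with ht
  · rw [EReal.coe_mul_top_of_pos hn']; exact le_top
  · rw [← EReal.coe_mul, EReal.coe_le_coe_iff]
    have h1 := Real.log_le_log (not_le.1 ht) h
    rw [Real.log_exp] at h1
    rw [inv_mul_eq_div, le_div_iff₀ (by positivity)]
    linarith

theorem lt_exp_of_lt_cFrac_mul_negLog {n : ℕ} (hn : 0 < n) {t y : ℝ}
    (h : (y : EReal) < cFrac n * negLog t) : t < Real.exp (-(n * y)) := by
  by_contra! ht
  have ht0 : 0 < t := (Real.exp_pos _).trans_le ht
  refine absurd h (not_lt.2 ?_)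
  rw [cFrac, negLog, if_neg (not_le.2 ht0), ← EReal.coe_mul, EReal.coe_le_coe_iff,
    inv_mul_eq_div, div_le_iff₀ (by positivity)]
  have h1 := Real.log_le_log (Real.exp_pos _) ht
  rw [Real.log_exp] at h1
  linarith

theorem le_cFrac_mul_iInf {κ : Type*} [Fintype κ] [DecidableEq κ] {A : Set (Matrix κ κ ℂ)}
    {ω : Matrix κ κ ℂ} {n : ℕ} (hn : 0 < n) {x y : ℝ} (hy : n * y ≤ x)
    (h : ∀ ρ ∈ A, (x : EReal) ≤ relEnt ρ ω) : (y : EReal) ≤ cFrac n * ⨅ ρ ∈ A, relEnt ρ ω := by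
  have hn' : (0 : ℝ) < (n : ℝ)⁻¹ := by positivity
  have h1 : (x : EReal) ≤ ⨅ ρ ∈ A, relEnt ρ ω := le_iInf₂ h
  have h2 : cFrac n * (x : EReal) ≤ cFrac n * ⨅ ρ ∈ A, relEnt ρ ω :=
    mul_le_mul_of_nonneg_left h1 (by rw [cFrac]; exact_mod_cast hn'.le)
  refine le_trans ?_ h2
  rw [cFrac, ← EReal.coe_mul, EReal.coe_le_coe_iff, inv_mul_eq_div, le_div_iff₀ (by positivity)]
  linarith

theorem lt_relEnt_of_lt_cFrac_mul_iInf {κ : Type*} [Fintype κ] [DecidableEq κ]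
    {A : Set (Matrix κ κ ℂ)} {ω : Matrix κ κ ℂ} {n : ℕ} (hn : 0 < n) {y : ℝ}
    (h : (y : EReal) < cFrac n * ⨅ ρ ∈ A, relEnt ρ ω) {ρ : Matrix κ κ ℂ} (hρ : ρ ∈ A) :
    ((n * y : ℝ) : EReal) < relEnt ρ ω := by
  by_contra! hle
  have hn' : (0 : ℝ) < (n : ℝ)⁻¹ := by positivity
  have h1 : (⨅ ρ ∈ A, relEnt ρ ω) ≤ ((n * y : ℝ) : EReal) := (iInf₂_le ρ hρ).trans hle
  have h2 : cFrac n * (⨅ ρ ∈ A, relEnt ρ ω) ≤ cFrac n * ((n * y : ℝ) : EReal) :=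
    mul_le_mul_of_nonneg_left h1 (by rw [cFrac]; exact_mod_cast hn'.le)
  refine absurd h (not_lt.2 (h2.trans ?_))
  rw [cFrac, ← EReal.coe_mul, EReal.coe_le_coe_iff, inv_mul_cancel_left₀ (by positivity)]

theorem eventually_mul_pow_le_exp (c : ℝ) (N : ℕ) {δ : ℝ} (hδ : 0 < δ) :
    ∀ᶠ n : ℕ in atTop, c * ((n : ℝ) + 1) ^ N ≤ Real.exp (δ * n) := by
  have h := (isLittleO_pow_exp_pos_mul_atTop N hδ).bound
    (c := (Real.exp δ * (|c| + 1))⁻¹) (by positivity)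
  have h2 : Tendsto (fun n : ℕ => (n : ℝ) + 1) atTop atTop :=
    tendsto_natCast_atTop_atTop.atTop_add tendsto_const_nhds
  filter_upwards [h2.eventually h] with n hn
  have h4 : Real.exp (δ * ((n : ℝ) + 1)) = Real.exp δ * Real.exp (δ * n) := by
    rw [← Real.exp_add]; congr 1; ring
  rw [Real.norm_eq_abs, Real.norm_eq_abs, Real.abs_exp, abs_of_nonneg (by positivity),
    inv_mul_eq_div, le_div_iff₀ (by positivity), h4, mul_left_comm,
    mul_comm (((n : ℝ) + 1) ^ N)] at hn
  have h3 := le_of_mul_le_mul_left hn (Real.exp_pos δ)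
  refine le_trans ?_ h3
  exact mul_le_mul_of_nonneg_right (by linarith [le_abs_self c]) (by positivity)

variable {ι : Type*} [Fintype ι] [DecidableEq ι] {A B B' : ∀ n : ℕ, Set (MatN ι n)}

theorem eventually_hasTest_of_lt_steinExponent (hB : ∀ n, ∀ σ ∈ B n, IsState σ) {y : ℝ}
    (h : (y : EReal) < steinExponent A B) {ε : ℝ} (hε : ε ∈ Set.Ioo (0 : ℝ) 1) :
    ∀ᶠ n in atTop, HasTest (A n) (B n) ε (Real.exp (-(n * y))) := by
  have h1 := eventually_lt_of_lt_liminf (h.trans_le (iInf₂_le ε hε))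
  filter_upwards [h1, eventually_gt_atTop 0] with n hn hn0
  exact hasTest_of_typeII_lt (hB n) hε.1.le (lt_exp_of_lt_cFrac_mul_negLog hn0 hn)

theorem le_steinExponent (hB : ∀ n, ∀ σ ∈ B n, IsState σ) (hne : ∀ n, (B n).Nonempty) {y : ℝ}
    (h : ∀ ε ∈ Set.Ioo (0 : ℝ) 1, ∀ᶠ n in atTop, HasTest (A n) (B n) ε (Real.exp (-(n * y)))) :
    (y : EReal) ≤ steinExponent A B := by
  refine le_iInf₂ fun ε hε => le_liminf_of_le (by isBoundedDefault) ?_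
  filter_upwards [h ε hε, eventually_gt_atTop 0] with n hn hn0
  exact le_cFrac_mul_negLog hn0 (hn.typeII_le (hB n) (hne n))

theorem steinExponent_le_of_hasTest (hB : ∀ n, ∀ σ ∈ B n, IsState σ)
    (hB' : ∀ n, ∀ σ ∈ B' n, IsState σ) (hne : ∀ n, (B' n).Nonempty)
    (h : ∀ (y z : ℝ), z < y → ∀ᶠ n in atTop, ∀ ε, HasTest (A n) (B n) ε (Real.exp (-(n * y))) →
      HasTest (A n) (B' n) ε (Real.exp (-(n * z)))) :
    steinExponent A B ≤ steinExponent A B' := by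
  refine EReal.ge_of_forall_gt_iff_ge.1 fun z hz => ?_
  obtain ⟨y, hzy, hy⟩ := EReal.lt_iff_exists_real_btwn.1 hz
  refine le_steinExponent hB' hne fun ε hε => ?_
  filter_upwards [eventually_hasTest_of_lt_steinExponent hB hy hε,
    h y z (EReal.coe_lt_coe_iff.1 hzy)] with n h1 h2
  exact h2 ε h1

theorem steinExponent_nonneg (hB : ∀ n, ∀ σ ∈ B n, IsState σ) (hne : ∀ n, (B n).Nonempty) :
    0 ≤ steinExponent A B := by
  have := le_steinExponent (A := A) hB hne (y := 0) fun ε hε => Eventually.of_forall fun n => by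
    simpa using HasTest.one (A := A n) (hB n) hε.1.le
  exact_mod_cast this

theorem avSet_isState {C : Set (MatC ι)} (hs : ∀ σ ∈ C, IsState σ) (n : ℕ) :
    ∀ σ ∈ avSet C n, IsState σ := by
  rintro _ ⟨f, hf, rfl⟩
  exact IsState.tensorProdFam fun k => hs _ (hf k)

theorem iidSet_nonempty {C : Set (MatC ι)} (hne : C.Nonempty) (n : ℕ) : (iidSet C n).Nonempty :=
  hne.elim fun σ hσ => ⟨_, σ, hσ, rfl⟩

theorem steinExponent_avSet_convexHull {B : Set (MatC ι)} (hs : ∀ σ ∈ convexHull ℝ B, IsState σ)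
    (hne : B.Nonempty) :
    steinExponent A (avSet B) = steinExponent A (avSet (convexHull ℝ B)) := by
  have hs' : ∀ σ ∈ B, IsState σ := fun σ hσ => hs σ (subset_convexHull ℝ B hσ)
  have hexp : ∀ {y z : ℝ} (n : ℕ), z < y → Real.exp (-(n * y)) ≤ Real.exp (-(n * z)) :=
    fun n h => Real.exp_le_exp.2 (neg_le_neg (mul_le_mul_of_nonneg_left h.le n.cast_nonneg))
  refine le_antisymm ?_ ?_
  · exact steinExponent_le_of_hasTest (avSet_isState hs') (avSet_isState hs)
      (fun n => (iidSet_nonempty hne.convexHull n).mono (iidSet_subset_avSet _))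
      fun y z hzy => Eventually.of_forall fun n ε h => h.avSet_convexHull.mono (hexp n hzy)
  · exact steinExponent_le_of_hasTest (avSet_isState hs) (avSet_isState hs')
      (fun n => (iidSet_nonempty hne n).mono (iidSet_subset_avSet _))
      fun y z hzy => Eventually.of_forall fun n ε h =>
        (h.anti (avSet_mono (subset_convexHull ℝ B))).mono (hexp n hzy)

theorem steinExponent_avSet_eq_iidSet (hA : AxiomQIII A) {C : Set (MatC ι)} (hC : Convex ℝ C)
    (hs : ∀ σ ∈ C, IsState σ) (hne : C.Nonempty) :
    steinExponent A (avSet C) = steinExponent A (iidSet C) := by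
  have hs' : ∀ n, ∀ σ ∈ iidSet C n, IsState σ := fun n σ hσ =>
    avSet_isState hs n σ (iidSet_subset_avSet C hσ)
  refine le_antisymm ?_ ?_
  · refine steinExponent_le_of_hasTest (avSet_isState hs) hs' (iidSet_nonempty hne)
      fun y z hzy => Eventually.of_forall fun n ε h => (h.anti (iidSet_subset_avSet C)).mono
        (Real.exp_le_exp.2 (neg_le_neg (mul_le_mul_of_nonneg_left hzy.le n.cast_nonneg)))
  · refine steinExponent_le_of_hasTest hs' (avSet_isState hs)
      (fun n => (iidSet_nonempty hne n).mono (iidSet_subset_avSet _)) fun y z hzy => ?_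
    have hδ : 0 < (y - z) / 2 := by linarith
    obtain ⟨F, -, hFC, hF⟩ := exists_finset_dominating hC hne hs hδ
    filter_upwards [eventually_mul_pow_le_exp (Real.exp 1 ^ F.card) F.card hδ,
      eventually_gt_atTop 0] with n hn hn0 ε h
    refine (h.avSet_of_iidSet hn0 (hA n) hC hs hFC hδ.le hF).mono ?_
    have h1 : (1 + (y - z) / 2) ^ n ≤ Real.exp ((y - z) / 2 * n) := by
      rw [mul_comm, Real.exp_nat_mul]
      exact pow_le_pow_left₀ (by positivity) (by linarith [Real.add_one_le_exp ((y - z) / 2)]) n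
    rw [← mul_pow] at hn
    calc _ ≤ Real.exp ((y - z) / 2 * n) * (Real.exp ((y - z) / 2 * n) * Real.exp (-(n * y))) := by
          gcongr
      _ = _ := by rw [← Real.exp_add, ← Real.exp_add]; congr 1; ring

end Exponents

section Assembly

variable {ι : Type*} [Fintype ι] [DecidableEq ι] {A : ∀ n : ℕ, Set (MatN ι n)}

theorem nonempty_of_free_of_tensorPow (hQI : AxiomQI A) (hQII : AxiomQII A) {k : ℕ}
    (hk : 1 ≤ k) : (A k).Nonempty := by
  obtain ⟨τ, hτ, -⟩ := hQI
  have h := hQII k 1 hk le_rfl _ hτ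
  exact mul_one k ▸ (⟨_, h⟩ : (A (k * 1)).Nonempty)

theorem iidSet_isState {C : Set (MatC ι)} (hs : ∀ σ ∈ C, IsState σ) (n : ℕ) :
    ∀ σ ∈ iidSet C n, IsState σ :=
  fun σ hσ => avSet_isState hs n σ (iidSet_subset_avSet C hσ)

theorem HasTest.le_relEnt_iidMix (hA : ∀ n, ∀ ρ ∈ A n, IsState ρ) {C : Set (MatC ι)}
    (hs : ∀ σ ∈ C, IsState σ) (μ : Measure ↥C) [IsProbabilityMeasure μ] {n : ℕ} {ε b c : ℝ}
    (h : HasTest (A n) (iidSet C n) ε b) (hc : 1 ≤ c) {ρ : MatN ι n} (hρ : ρ ∈ A n) :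
    (((1 - 2 * (ε + c * b)) * Real.log c - 1 : ℝ) : EReal) ≤ relEnt ρ (iidMix μ n) := by
  obtain ⟨E, h1, h2, h3, h4⟩ := h
  exact le_relEnt_of_test (hA n ρ hρ) (iidMix_isState hs μ n) h1 h2 hc (h3 ρ hρ)
    (trace_iidMix_mul_re_le hs μ fun σ hσ => h4 _ ⟨σ, hσ, rfl⟩)

theorem steinExponent_le_liminf (hA : ∀ n, ∀ ρ ∈ A n, IsState ρ) {C : Set (MatC ι)}
    (hs : ∀ σ ∈ C, IsState σ) (μ : Measure ↥C) [IsProbabilityMeasure μ] :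
    steinExponent A (iidSet C) ≤
      liminf (fun n : ℕ => cFrac n * ⨅ ρ ∈ A n, relEnt ρ (iidMix μ n)) atTop := by
  refine EReal.ge_of_forall_gt_iff_ge.1 fun z hz => le_liminf_of_le (by isBoundedDefault) ?_
  rcases lt_or_ge z 0 with hz0 | hz0
  · have h1 : ∀ᶠ n : ℕ in atTop, (n : ℝ) * z ≤ -1 :=
      (tendsto_natCast_atTop_atTop.atTop_mul_const_of_neg hz0).eventually_le_atBot (-1)
    filter_upwards [h1, eventually_gt_atTop 0] with n hn hn0
    refine le_cFrac_mul_iInf hn0 hn fun ρ hρ => ?_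
    have := (HasTest.one (A := A n) (iidSet_isState hs n) le_rfl).le_relEnt_iidMix hA hs μ
      (le_refl 1) hρ
    simpa using this
  · obtain ⟨y, hzy, hy⟩ := EReal.lt_iff_exists_real_btwn.1 hz
    rw [EReal.coe_lt_coe_iff] at hzy
    have hy0 : 0 < y := hz0.trans_lt hzy
    set ε : ℝ := (y - z) / (8 * y) with hε
    have hε0 : 0 < ε := div_pos (by linarith) (by linarith)
    have hεy : ε * (8 * y) = y - z := div_mul_cancel₀ _ (by positivity)
    have hε1 : ε ≤ 1 / 8 := by rw [hε, div_le_iff₀ (by positivity)]; linarith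
    have hlim : ∀ᶠ n : ℕ in atTop, 1 - Real.log ε ≤ n * ((y - z) / 2) :=
      (tendsto_natCast_atTop_atTop.atTop_mul_const (by linarith)).eventually_ge_atTop _
    filter_upwards [eventually_hasTest_of_lt_steinExponent (iidSet_isState hs) hy
      (ε := ε) ⟨hε0, by linarith⟩, eventually_gt_atTop 0, hlim] with n hn hn0 hlog
    have hlogc : Real.log (ε * Real.exp (n * y)) = Real.log ε + n * y := by
      rw [Real.log_mul hε0.ne' (Real.exp_pos _).ne', Real.log_exp]
    have hny : (n : ℝ) * ((y - z) / 2) ≤ n * y :=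
      mul_le_mul_of_nonneg_left (by linarith) n.cast_nonneg
    have hc : 1 ≤ ε * Real.exp (n * y) := by
      rw [← Real.log_nonneg_iff (by positivity), hlogc]
      linarith
    refine le_cFrac_mul_iInf hn0 ?_ fun ρ hρ => hn.le_relEnt_iidMix hA hs μ hc hρ
    rw [hlogc, mul_assoc, ← Real.exp_add, add_neg_cancel, Real.exp_zero, mul_one]
    have hlogε : Real.log ε ≤ 0 := Real.log_nonpos hε0.le (by linarith)
    have : ε * (n * y) * 8 = n * (y - z) := by rw [← hεy]; ring
    nlinarith

/-- If, at one block length, all of `A k` has large relative entropy to the universal mixture,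
then tests with a comparable exponent exist at all large lengths. -/
theorem eventually_hasTest_of_lt_relEnt (hA : ∀ n, ∀ ρ ∈ A n, IsState ρ)
    (hA_closed : ∀ n, IsClosed (A n)) (hA_convex : ∀ n, Convex ℝ (A n))
    (hQIII : AxiomQIII A) (hQIV : AxiomQIV A) {C : Set (MatC ι)}
    (hs : ∀ σ ∈ C, IsState σ) (μ : Measure ↥C) [IsProbabilityMeasure μ] {k : ℕ} (hk : 1 ≤ k)
    (hne : (A k).Nonempty) {K x y : ℝ} (hK : 0 < K) (hKμ : ∀ σ ∈ C, ∀ M : MatN ι k, M.PosSemidef →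
      (tensorPow σ k * M).trace.re ≤ K * (iidMix μ k * M).trace.re)
    (hx : ∀ ρ ∈ A k, (x : EReal) < relEnt ρ (iidMix μ k)) (hy : 0 ≤ y)
    (hxy : k * y + Real.log (2 * ((k : ℝ) + 1) ^ (Fintype.card ι * Fintype.card ι)) +
      Real.log K + 3 ≤ x) {ε : ℝ} (hε : 0 < ε) :
    ∀ᶠ n in atTop, HasTest (A n) (iidSet C n) ε (Real.exp (-(((n : ℝ) - k) * y))) := by
  obtain ⟨U, q, hU, hω, hq, -, hlog, -⟩ := (iidMix_isState hs μ k).exists_spec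
  obtain ⟨η, hη, hreg⟩ := exists_regularised (hA_closed k) (hA k) hU hω hlog hx
  obtain ⟨W, g, hW, h1, hg⟩ := exists_witness (hA_convex k) hne (hA k) hU
    (r := fun i => if q i = 0 then η else q i)
    (fun i => by
      by_cases h : q i = 0
      · simpa [h] using hη
      · simpa [h] using lt_of_le_of_ne (hq i) (Ne.symm h)) hreg
  set r : (Fin k → ι) → ℝ := fun i => if q i = 0 then η else q i with hr
  have hexp : (spec W fun i => Real.exp (g i)).PosSemidef :=
    spec_posSemidef W fun i => (Real.exp_pos _).le
  have hcard : (Finset.univ.image r).card ≤ (k + 1) ^ (Fintype.card ι * Fintype.card ι) := by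
    refine le_trans ?_ (card_image_eigenvalues_le hU (q := q) fun π => ?_)
    · have : Finset.univ.image r =
          (Finset.univ.image q).image fun t => if t = 0 then η else t := by
        rw [Finset.image_image]; rfl
      rw [this]
      exact Finset.card_image_le
    · rw [← hω]; exact permCopies_iidMix μ π
  have hcard0 : 0 < (Finset.univ.image r).card := by
    obtain ⟨ρ, hρ⟩ := hne
    have : Nonempty (Fin k → ι) := Fintype.card_pos_iff.1 (by exact_mod_cast (hA k ρ hρ).card_pos)
    exact Finset.card_pos.2 (Finset.univ_nonempty.image r)
  have hlogcard : Real.log (2 * ((Finset.univ.image r).card : ℝ)) ≤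
      Real.log (2 * ((k : ℝ) + 1) ^ (Fintype.card ι * Fintype.card ι)) := by
    have h0 : (0 : ℝ) < (Finset.univ.image r).card := by exact_mod_cast hcard0
    have h2 : ((Finset.univ.image r).card : ℝ) ≤
        ((k : ℝ) + 1) ^ (Fintype.card ι * Fintype.card ι) := by exact_mod_cast hcard
    exact Real.log_le_log (by positivity) (by linarith)
  refine eventually_hasTest hA hQIII hQIV hs hk hW hg hK (fun σ hσ => ?_) hy (by linarith) hε
  refine (hKμ σ hσ _ hexp).trans ?_
  have h3 : (iidMix μ k * spec W fun i => Real.exp (g i)).trace.re ≤ 1 := by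
    rw [← h1, hω]
    refine trace_mul_re_mono_left hexp (spec_mono U fun i => ?_)
    by_cases h : q i = 0
    · simp [hr, h, hη.le]
    · simp [hr, h]
  nlinarith

theorem exists_limsup_le_steinExponent (hA : ∀ n, ∀ ρ ∈ A n, IsState ρ)
    (hA_closed : ∀ n, IsClosed (A n)) (hA_convex : ∀ n, Convex ℝ (A n)) (hQI : AxiomQI A)
    (hQII : AxiomQII A) (hQIII : AxiomQIII A) (hQIV : AxiomQIV A) {C : Set (MatC ι)}
    (hC : Convex ℝ C) (hs : ∀ σ ∈ C, IsState σ) (hne : C.Nonempty) :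
    ∃ μ : Measure ↥C, IsProbabilityMeasure μ ∧
      limsup (fun n : ℕ => cFrac n * ⨅ ρ ∈ A n, relEnt ρ (iidMix μ n)) atTop ≤
        steinExponent A (iidSet C) := by
  obtain ⟨μ, hμ, huniv⟩ := exists_universal_measure hC hne hs
  refine ⟨μ, hμ, ?_⟩
  by_contra! hlt
  obtain ⟨z, hSz, hz⟩ := EReal.lt_iff_exists_real_btwn.1 hlt
  obtain ⟨x, hzx, hx⟩ := EReal.lt_iff_exists_real_btwn.1 hz
  rw [EReal.coe_lt_coe_iff] at hzx
  have hz0 : 0 < z := by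
    have := (steinExponent_nonneg (iidSet_isState hs) (iidSet_nonempty hne)).trans_lt hSz
    exact_mod_cast this
  set δ : ℝ := (x - z) / 3 with hδ
  have hδ0 : 0 < δ := by rw [hδ]; linarith
  obtain ⟨K, hK, hKμ⟩ := huniv δ hδ0
  set N := Fintype.card ι * Fintype.card ι
  obtain ⟨k, hxk, hk, hasy⟩ := ((frequently_lt_of_lt_limsup (by isBoundedDefault) hx).and_eventually
    ((eventually_ge_atTop 1).and
      (eventually_mul_pow_le_exp (2 * K * Real.exp 3) N hδ0))).exists
  refine absurd hSz (not_lt.2 (le_steinExponent (iidSet_isState hs) (iidSet_nonempty hne)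
    fun ε hε => ?_))
  have hlog : Real.log (2 * ((k : ℝ) + 1) ^ N) + Real.log K + 3 ≤ δ * k := by
    have h1 := Real.log_le_log (by positivity) hasy
    rw [Real.log_exp] at h1
    have h2 : 2 * K * Real.exp 3 * ((k : ℝ) + 1) ^ N = 2 * ((k : ℝ) + 1) ^ N * K * Real.exp 3 := by
      ring
    rwa [h2, Real.log_mul (by positivity) (Real.exp_pos 3).ne', Real.log_mul (by positivity) hK.ne',
      Real.log_exp] at h1
  have h1 := eventually_hasTest_of_lt_relEnt hA hA_closed hA_convex hQIII hQIV hs μ hk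
    (nonempty_of_free_of_tensorPow hQI hQII hk) (K := K * Real.exp (δ * k)) (x := k * x)
    (y := z + δ) (by positivity) (hKμ k)
    (fun ρ hρ => lt_relEnt_of_lt_cFrac_mul_iInf hk hxk hρ) (by linarith) (by
      rw [Real.log_mul hK.ne' (Real.exp_pos _).ne', Real.log_exp]
      have h3 : (k : ℝ) * x = k * z + 3 * (δ * k) := by rw [hδ]; ring
      rw [h3]
      linarith) hε.1
  have h2 : ∀ᶠ n : ℕ in atTop, (k : ℝ) * (z + δ) ≤ n * δ :=
    (tendsto_natCast_atTop_atTop.atTop_mul_const hδ0).eventually_ge_atTop _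
  filter_upwards [h1, h2] with n hn hn2
  exact hn.mono (Real.exp_le_exp.2 (by linarith))

end Assembly

/-- **Generalised quantum Sanov theorem revisited (arbitrarily varying alternative).**
`Stein(𝒜‖ℬ₁^{av}) = Stein(𝒜‖co(ℬ₁)^{av}) = Stein(𝒜‖co(ℬ₁)^{iid})
  = min*_{μ∈𝒫(co(ℬ₁))} lim_n (1/n) inf_{ρ_n∈𝒜_n} D(ρ_n‖∫dμ(σ) σ^{⊗n})`. -/
theorem generalised_quantum_Sanov_av (d : ℕ)
    (A : ∀ n : ℕ, Set (MatN (Fin d) n))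
    (hA_states : ∀ n : ℕ, ∀ ρ ∈ A n, IsState ρ)
    (hA_closed : ∀ n : ℕ, IsClosed (A n))
    (hA_convex : ∀ n : ℕ, Convex ℝ (A n))
    (hQI : AxiomQI A) (hQII : AxiomQII A) (hQIII : AxiomQIII A) (hQIV : AxiomQIV A)
    (B1 : Set (MatC (Fin d)))
    (hB_states : ∀ σ ∈ B1, IsState σ)
    (hB_ne : B1.Nonempty) (hB_closed : IsClosed B1) :
    ∃ S : EReal,
      steinExponent A (avSet B1) = S ∧
      steinExponent A (avSet (convexHull ℝ B1)) = S ∧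
      steinExponent A (iidSet (convexHull ℝ B1)) = S ∧
      (∃ μ : Measure ↥(convexHull ℝ B1), IsProbabilityMeasure μ ∧
        Filter.Tendsto (fun n : ℕ => cFrac n * ⨅ ρ ∈ A n, relEnt ρ (iidMix μ n))
          Filter.atTop (nhds S)) ∧
      (∀ μ : Measure ↥(convexHull ℝ B1), IsProbabilityMeasure μ → ∀ L : EReal,
        Filter.Tendsto (fun n : ℕ => cFrac n * ⨅ ρ ∈ A n, relEnt ρ (iidMix μ n))
          Filter.atTop (nhds L) → S ≤ L) := by
  have hs : ∀ σ ∈ convexHull ℝ B1, IsState σ := convexHull_min hB_states convex_isState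
  have hC : Convex ℝ (convexHull ℝ B1) := convex_convexHull ℝ B1
  have hne : (convexHull ℝ B1).Nonempty := hB_ne.convexHull
  have hav := steinExponent_avSet_eq_iidSet hQIII hC hs hne
  refine ⟨steinExponent A (iidSet (convexHull ℝ B1)),
    (steinExponent_avSet_convexHull hs hB_ne).trans hav, hav, rfl, ?_, ?_⟩
  · obtain ⟨μ, hμ, hlim⟩ := exists_limsup_le_steinExponent hA_states hA_closed hA_convex
      hQI hQII hQIII hQIV hC hs hne
    exact ⟨μ, hμ, tendsto_of_le_liminf_of_limsup_le
      (steinExponent_le_liminf hA_states hs μ) hlim⟩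
  · intro μ hμ L hL
    exact (steinExponent_le_liminf hA_states hs μ).trans_eq hL.liminf_eq

end QSanov
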